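/- arXiv:2508.13959 — 8 statements merged into one kernel-verified Lean document; each statement's English description precedes it below -/
import Mathlib

section
/- Let d, ℓ ≥ 1, let {M_x}_{x∈𝒳} be a POVM on ℂ^d with finite outcome set 𝒳 and Tr[M_x] > 0 for every x ∈ 𝒳, let V_1, …, V_ℓ be Hermitian d×d complex matrices orthonormal for the trace inner product (Tr[V_i V_j] = 1 if i = j and 0 otherwise), let ε > 0, and for each sign vector z ∈ {−1,1}^ℓ let a_z ∈ [0,1] and σ_z = I/d + a_z·(ε/√(d·ℓ))·Σ_{i=1}^ℓ z_i V_i. Then the average over uniformly random z ∈ {−1,1}^ℓ of the chi-square divergence Σ_{x∈𝒳} (Tr[M_x σ_z] − Tr[M_x]/d)² / (Tr[M_x]/d) is at most (ε²/ℓ)·Σ_{i=1}^ℓ Σ_{x∈𝒳} Tr[M_x V_i]² / Tr[M_x], which in turn is at most (ε²/ℓ)·Σ_{x∈𝒳} Tr[M_x²]/Tr[M_x]. -/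
open Matrix
open scoped BigOperators ComplexOrder

/-- Distinct coordinates of a uniformly random sign vector are uncorrelated. -/
lemma sum_sign_mul_sign {ι : Type*} [Fintype ι] [DecidableEq ι] (i j : ι) :
    ∑ z : ι → Bool, (if z i then (1 : ℝ) else -1) * (if z j then 1 else -1)
      = if i = j then 2 ^ Fintype.card ι else 0 := by
  split_ifs with h
  · subst h
    have h1 : ∀ z : ι → Bool,
        (if z i then (1 : ℝ) else -1) * (if z i then 1 else -1) = 1 := by
      intro z
      split_ifs <;> norm_num
    simp [h1]
  · refine Finset.sum_involution (fun z _ => Function.update z i (!z i)) ?_ ?_ ?_ ?_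
    · intro z _
      have hj : Function.update z i (!z i) j = z j :=
        Function.update_of_ne (Ne.symm h) _ _
      rw [hj, Function.update_self]
      cases z i <;> cases z j <;> norm_num
    · intro z _ _ hz
      have := congrFun hz i
      simp at this
    · intro z _
      exact Finset.mem_univ _
    · intro z _
      simp

/-- The second moment of a Rademacher sum. -/
lemma sum_sq_sum_sign_mul {ι : Type*} [Fintype ι] [DecidableEq ι] (c : ι → ℝ) :
    ∑ z : ι → Bool, (∑ i, (if z i then (1 : ℝ) else -1) * c i) ^ 2
      = 2 ^ Fintype.card ι * ∑ i, c i ^ 2 := by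
  calc ∑ z : ι → Bool, (∑ i, (if z i then (1 : ℝ) else -1) * c i) ^ 2
      = ∑ z : ι → Bool, ∑ i, ∑ j, (c i * c j) *
          ((if z i then (1 : ℝ) else -1) * (if z j then 1 else -1)) := by
        refine Finset.sum_congr rfl fun z _ => ?_
        rw [sq, Finset.sum_mul_sum]
        refine Finset.sum_congr rfl fun i _ => Finset.sum_congr rfl fun j _ => ?_
        ring
    _ = ∑ i, ∑ j, (c i * c j) * ∑ z : ι → Bool,
          ((if z i then (1 : ℝ) else -1) * (if z j then 1 else -1)) := by
        rw [Finset.sum_comm]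
        refine Finset.sum_congr rfl fun i _ => ?_
        rw [Finset.sum_comm]
        simp only [Finset.mul_sum]
    _ = 2 ^ Fintype.card ι * ∑ i, c i ^ 2 := by
        simp_rw [sum_sign_mul_sign]
        simp only [mul_ite, mul_zero, Finset.sum_ite_eq, Finset.mem_univ, if_true]
        rw [Finset.mul_sum]
        refine Finset.sum_congr rfl fun i _ => ?_
        ring

/-- The square of a Hermitian matrix has nonnegative trace. -/
lemma Matrix.IsHermitian.trace_mul_self_re_nonneg {n : Type*} [Fintype n]
    {A : Matrix n n ℂ} (hA : A.IsHermitian) : 0 ≤ (A * A).trace.re := by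
  have h := (Matrix.posSemidef_conjTranspose_mul_self A).trace_nonneg
  rw [hA.eq] at h
  exact (Complex.le_def.mp h).1

/-- Bessel's inequality for the trace inner product on Hermitian matrices. -/
lemma Matrix.IsHermitian.sum_sq_trace_mul_le {n ι : Type*} [Fintype n] [Fintype ι]
    [DecidableEq ι] {A : Matrix n n ℂ} (hA : A.IsHermitian) (V : ι → Matrix n n ℂ)
    (hV : ∀ i, (V i).IsHermitian)
    (hVortho : ∀ i j, (V i * V j).trace = if i = j then 1 else 0) :
    ∑ i, ((A * V i).trace.re) ^ 2 ≤ (A * A).trace.re := by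
  set P : Matrix n n ℂ := ∑ i, (((A * V i).trace.re : ℝ) : ℂ) • V i with hP
  have hPherm : P.IsHermitian := by
    unfold Matrix.IsHermitian
    rw [hP, Matrix.conjTranspose_sum]
    refine Finset.sum_congr rfl fun i _ => ?_
    rw [Matrix.conjTranspose_smul, (hV i).eq, RCLike.star_def, Complex.conj_ofReal]
  have hAP : (A * P).trace.re = ∑ i, ((A * V i).trace.re) ^ 2 := by
    rw [hP, Finset.mul_sum, Matrix.trace_sum, Complex.re_sum]
    refine Finset.sum_congr rfl fun i _ => ?_
    rw [Matrix.mul_smul, Matrix.trace_smul, smul_eq_mul, Complex.re_ofReal_mul, sq]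
  have hPP : (P * P).trace.re = ∑ i, ((A * V i).trace.re) ^ 2 := by
    rw [hP, Finset.sum_mul_sum, Matrix.trace_sum, Complex.re_sum]
    refine Finset.sum_congr rfl fun i _ => ?_
    simp only [Matrix.trace_sum, Matrix.mul_smul, Matrix.smul_mul, Matrix.trace_smul, hVortho,
      smul_eq_mul, mul_ite, mul_one, mul_zero, Finset.sum_ite_eq, Finset.mem_univ, if_true]
    rw [Complex.re_ofReal_mul, Complex.ofReal_re, sq]
  have h := (hA.sub hPherm).trace_mul_self_re_nonneg
  rw [sub_mul, mul_sub, mul_sub, Matrix.trace_sub, Matrix.trace_sub, Matrix.trace_sub,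
    Matrix.trace_mul_comm P A, Complex.sub_re, Complex.sub_re, Complex.sub_re, hAP, hPP] at h
  linarith

/-- averaged chi-square divergence bound for a POVM measuring
the perturbed states σ_z versus the maximally mixed state. -/
theorem averaged_chiSquare_le_info_channel
    {d ℓ : ℕ} (hd : 1 ≤ d) (hℓ : 1 ≤ ℓ)
    {𝒳 : Type*} [Fintype 𝒳]
    (M : 𝒳 → Matrix (Fin d) (Fin d) ℂ)
    (hMpsd : ∀ x, (M x).PosSemidef)
    (hMsum : ∑ x, M x = 1)
    (hMtr : ∀ x, 0 < (M x).trace.re)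
    (V : Fin ℓ → Matrix (Fin d) (Fin d) ℂ)
    (hVherm : ∀ i, (V i).IsHermitian)
    (hVortho : ∀ i j, ((V i) * (V j)).trace = if i = j then 1 else 0)
    (ε : ℝ) (hε : 0 < ε)
    (a : (Fin ℓ → Bool) → ℝ) (ha : ∀ z, a z ∈ Set.Icc (0 : ℝ) 1)
    (σ : (Fin ℓ → Bool) → Matrix (Fin d) (Fin d) ℂ)
    (hσ : ∀ z, σ z = ((d : ℂ))⁻¹ • (1 : Matrix (Fin d) (Fin d) ℂ)
      + ((a z * (ε / Real.sqrt (d * ℓ)) : ℝ) : ℂ) •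
          ∑ i, (if z i then (1 : ℂ) else -1) • V i) :
    ((1 : ℝ) / 2 ^ ℓ) * ∑ z : Fin ℓ → Bool, ∑ x,
        (((M x) * (σ z)).trace.re - (M x).trace.re / d) ^ 2 / ((M x).trace.re / d)
      ≤ (ε ^ 2 / ℓ) * ∑ i, ∑ x, ((M x * V i).trace.re) ^ 2 / (M x).trace.re
    ∧ (ε ^ 2 / ℓ) * ∑ i, ∑ x, ((M x * V i).trace.re) ^ 2 / (M x).trace.re
      ≤ (ε ^ 2 / ℓ) * ∑ x, ((M x * M x).trace.re) / (M x).trace.re := by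
  have hd0 : (0 : ℝ) < d := by exact_mod_cast hd
  have hℓ0 : (0 : ℝ) < ℓ := by exact_mod_cast hℓ
  constructor
  · have hdev : ∀ z x, (M x * σ z).trace.re - (M x).trace.re / d
        = a z * (ε / Real.sqrt (d * ℓ)) *
          ∑ i, (if z i then (1 : ℝ) else -1) * (M x * V i).trace.re := by
      intro z x
      have hsum : (M x * ∑ i, (if z i then (1 : ℂ) else -1) • V i).trace.re
          = ∑ i, (if z i then (1 : ℝ) else -1) * (M x * V i).trace.re := by
        rw [Finset.mul_sum, Matrix.trace_sum, Complex.re_sum]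
        refine Finset.sum_congr rfl fun i _ => ?_
        split_ifs <;> simp
      have hinv : ((d : ℂ))⁻¹ = (((d : ℝ)⁻¹ : ℝ) : ℂ) := by push_cast; rfl
      rw [hσ, mul_add, Matrix.mul_smul, Matrix.mul_smul, mul_one, Matrix.trace_add,
        Matrix.trace_smul, Matrix.trace_smul, smul_eq_mul, smul_eq_mul, Complex.add_re,
        Complex.re_ofReal_mul, hsum, hinv, Complex.re_ofReal_mul]
      ring
    have hterm : ∀ z x,
        ((M x * σ z).trace.re - (M x).trace.re / d) ^ 2 / ((M x).trace.re / d)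
        ≤ ε ^ 2 / ℓ / (M x).trace.re *
          (∑ i, (if z i then (1 : ℝ) else -1) * (M x * V i).trace.re) ^ 2 := by
      intro z x
      have ht := hMtr x
      have ha2 : a z ^ 2 ≤ 1 := pow_le_one₀ (ha z).1 (ha z).2
      rw [hdev]
      set S := ∑ i, (if z i then (1 : ℝ) else -1) * (M x * V i).trace.re
      have heq : (a z * (ε / Real.sqrt (d * ℓ)) * S) ^ 2 / ((M x).trace.re / d)
          = a z ^ 2 * (ε ^ 2 / ℓ / (M x).trace.re * S ^ 2) := by
        rw [mul_pow, mul_pow, div_pow, Real.sq_sqrt (by positivity)]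
        field_simp
      rw [heq]
      exact mul_le_of_le_one_left (by positivity) ha2
    calc ((1 : ℝ) / 2 ^ ℓ) * ∑ z : Fin ℓ → Bool, ∑ x,
          ((M x * σ z).trace.re - (M x).trace.re / d) ^ 2 / ((M x).trace.re / d)
        ≤ ((1 : ℝ) / 2 ^ ℓ) * ∑ z : Fin ℓ → Bool, ∑ x, ε ^ 2 / ℓ / (M x).trace.re *
          (∑ i, (if z i then (1 : ℝ) else -1) * (M x * V i).trace.re) ^ 2 := by
          gcongr with z _ x _
          exact hterm z x
      _ = (ε ^ 2 / ℓ) * ∑ i, ∑ x, ((M x * V i).trace.re) ^ 2 / (M x).trace.re := by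
          rw [Finset.sum_comm, Finset.sum_comm (s := (Finset.univ : Finset (Fin ℓ))),
            Finset.mul_sum, Finset.mul_sum]
          refine Finset.sum_congr rfl fun x _ => ?_
          rw [← Finset.mul_sum, sum_sq_sum_sign_mul, Fintype.card_fin, ← Finset.sum_div]
          field_simp
  · refine mul_le_mul_of_nonneg_left ?_ (by positivity)
    rw [Finset.sum_comm]
    refine Finset.sum_le_sum fun x _ => ?_
    rw [← Finset.sum_div]
    exact div_le_div_of_nonneg_right
      ((hMpsd x).isHermitian.sum_sq_trace_mul_le V hVherm hVortho) (hMtr x).le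
end

section
/- For every POVM {M_x}_{x∈𝒳} on ℂ^d with finite outcome set 𝒳 of cardinality k and Tr[M_x] > 0 for every x ∈ 𝒳, one has Σ_{x∈𝒳} Tr[M_x²]/Tr[M_x] ≤ min(k, d). -/
open Matrix
open scoped BigOperators ComplexOrder

namespace Matrix

open scoped MatrixOrder in
theorem PosSemidef.exists_eq_conjTranspose_mul_self {n : Type*} [Fintype n] {A : Matrix n n ℂ}
    (hA : A.PosSemidef) : ∃ B : Matrix n n ℂ, A = Bᴴ * B := by
  classical
  exact CStarAlgebra.nonneg_iff_eq_star_mul_self.mp hA.nonneg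

section Frobenius

attribute [local instance] Matrix.frobeniusNormedAddCommGroup

theorem re_trace_conjTranspose_mul_self_eq_frobenius_norm_sq {m n : Type*} [Fintype m] [Fintype n]
    (A : Matrix m n ℂ) : (Aᴴ * A).trace.re = ‖A‖ ^ 2 := by
  rw [frobenius_norm_def, ← Real.sqrt_eq_rpow, Real.sq_sqrt (by positivity), Finset.sum_comm]
  simp [trace, mul_apply, conjTranspose_apply, Complex.sq_norm, Complex.normSq_apply]

theorem PosSemidef.re_trace_mul_self_le_sq {n : Type*} [Fintype n] {A : Matrix n n ℂ}
    (hA : A.PosSemidef) : (A * A).trace.re ≤ A.trace.re ^ 2 := by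
  classical
  obtain ⟨B, rfl⟩ := hA.exists_eq_conjTranspose_mul_self
  have h := re_trace_conjTranspose_mul_self_eq_frobenius_norm_sq (Bᴴ * B)
  rw [hA.isHermitian.eq] at h
  rw [h, re_trace_conjTranspose_mul_self_eq_frobenius_norm_sq B]
  have hmul := frobenius_norm_mul Bᴴ B
  rw [frobenius_norm_conjTranspose, ← sq] at hmul
  gcongr

end Frobenius

theorem PosSemidef.re_trace_mul_nonneg {n : Type*} [Fintype n] {A B : Matrix n n ℂ}
    (hA : A.PosSemidef) (hB : B.PosSemidef) : 0 ≤ (A * B).trace.re := by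
  classical
  obtain ⟨C, rfl⟩ := hA.exists_eq_conjTranspose_mul_self
  rw [Matrix.mul_assoc, trace_mul_comm]
  exact (Complex.nonneg_iff.mp (hB.mul_mul_conjTranspose_same C).trace_nonneg).1

theorem PosSemidef.re_trace_mul_self_le {n : Type*} [Fintype n] [DecidableEq n]
    {A : Matrix n n ℂ} (hA : A.PosSemidef) (hA' : (1 - A).PosSemidef) :
    (A * A).trace.re ≤ A.trace.re := by
  have h := hA.re_trace_mul_nonneg hA'
  rw [Matrix.mul_sub, Matrix.mul_one, trace_sub, Complex.sub_re] at h
  linarith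

end Matrix

/-- the trace norm of the measurement information channel of a
POVM with `k` outcomes on `ℂ^d` is at most `min k d`. -/
theorem info_channel_trace_norm_le_min
    {d : ℕ} {𝒳 : Type*} [Fintype 𝒳]
    (M : 𝒳 → Matrix (Fin d) (Fin d) ℂ)
    (hMpsd : ∀ x, (M x).PosSemidef)
    (hMsum : ∑ x, M x = 1)
    (hMtr : ∀ x, 0 < (M x).trace.re) :
    ∑ x, ((M x * M x).trace.re) / (M x).trace.re
      ≤ min (Fintype.card 𝒳 : ℝ) (d : ℝ) := by
  classical
  refine le_min ?_ ?_
  · have hcompl (x : 𝒳) : (1 - M x).PosSemidef := by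
      rw [← hMsum, ← Finset.sum_erase_eq_sub (Finset.mem_univ x)]
      exact posSemidef_sum _ fun y _ ↦ hMpsd y
    calc ∑ x, (M x * M x).trace.re / (M x).trace.re ≤ ∑ _x : 𝒳, (1 : ℝ) :=
          Finset.sum_le_sum fun x _ ↦
            (div_le_one (hMtr x)).mpr ((hMpsd x).re_trace_mul_self_le (hcompl x))
      _ = Fintype.card 𝒳 := by simp
  · calc ∑ x, (M x * M x).trace.re / (M x).trace.re ≤ ∑ x, (M x).trace.re :=
          Finset.sum_le_sum fun x _ ↦ (div_le_iff₀ (hMtr x)).mpr <| by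
            simpa only [sq] using (hMpsd x).re_trace_mul_self_le_sq
      _ = d := by rw [← Complex.re_sum, ← trace_sum, hMsum]; simp
end

section
/- Let ρ be a density matrix on ℂ^d and e₀ a fixed unit vector in ℂ^d. Writing v = U e₀ and P_v = v v^†, one has d · ∫_{U(d)} (P_v ⊗ P_v) · ⟨v, ρ v⟩ dμ(U) = (1/((d+1)(d+2))) · (I⊗I + F)·(I⊗I + I⊗ρ + ρ⊗I), where μ is Haar measure on the unitary group U(d), ⊗ is the Kronecker product, and F is the d²×d² swap matrix determined by F(a ⊗ b) = b ⊗ a for all a, b ∈ ℂ^d. -/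
open Matrix MeasureTheory
open scoped BigOperators ComplexOrder Kronecker

namespace Matrix.unitaryGroup

variable {d : ℕ}

instance : CompactSpace (Matrix.unitaryGroup (Fin d) ℂ) := by
  have hK : IsCompact (Set.pi Set.univ fun _ : Fin d => Set.pi Set.univ fun _ : Fin d =>
      Metric.closedBall (0 : ℂ) 1) :=
    isCompact_univ_pi fun _ => isCompact_univ_pi fun _ => isCompact_closedBall _ _
  refine isCompact_iff_compactSpace.mp (hK.of_isClosed_subset ?_ ?_)
  · exact isClosed_unitary (R := Matrix (Fin d) (Fin d) ℂ)
  · intro U hU i _ j _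
    simpa using entry_norm_bound_of_unitary hU i j

section OneParameter

open scoped Matrix.Norms.L2Operator

/-- Every Hermitian matrix `H` generates a one-parameter family of unitaries `exp (i t H)`. -/
lemma exists_hasDerivAt (H : selfAdjoint (Matrix (Fin d) (Fin d) ℂ)) :
    ∃ V : ℝ → Matrix.unitaryGroup (Fin d) ℂ, V 0 = 1 ∧
      ∀ (w : Fin d → ℂ) (a : Fin d) (t : ℝ),
        HasDerivAt (fun s => ((V s : Matrix (Fin d) (Fin d) ℂ) *ᵥ w) a)
          (Complex.I * ((H : Matrix (Fin d) (Fin d) ℂ) *ᵥ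
            ((V t : Matrix (Fin d) (Fin d) ℂ) *ᵥ w)) a) t := by
  refine ⟨fun t => selfAdjoint.expUnitary (t • H), by simp, fun w a t => ?_⟩
  let φ : Matrix (Fin d) (Fin d) ℂ →ₗ[ℝ] ℂ :=
    { toFun := fun A => (A *ᵥ w) a
      map_add' := fun A B => by simp [add_mulVec]
      map_smul' := fun c A => by simp [smul_mulVec] }
  have h := hasDerivAt_exp_smul_const' (𝕂 := ℝ)
    (Complex.I • (H : Matrix (Fin d) (Fin d) ℂ)) t
  have h2 := (LinearMap.toContinuousLinearMap φ).hasFDerivAt.comp_hasDerivAt t h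
  convert! h2 using 1
  · ext s
    simp [φ, smul_comm s Complex.I]
  · simp [φ, smul_comm t Complex.I, smul_mulVec, mulVec_mulVec]

end OneParameter

/-- The derivative of `v a * v b * v c * conj (v i * v j * v k)` along `v ↦ H v`, where the
conjugated coordinates are moved by `- conj v * H`. -/
noncomputable def variation (H : Matrix (Fin d) (Fin d) ℂ) (a b c i j k : Fin d)
    (v : Fin d → ℂ) : ℂ :=
  ((H *ᵥ v) a * v b * v c + v a * (H *ᵥ v) b * v c + v a * v b * (H *ᵥ v) c) *
      (star v i * star v j * star v k) -
    v a * v b * v c *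
      ((star v ᵥ* H) i * star v j * star v k + star v i * (star v ᵥ* H) j * star v k +
        star v i * star v j * (star v ᵥ* H) k)

@[fun_prop]
lemma continuous_mulVec_apply (e : Fin d → ℂ) (a : Fin d) :
    Continuous fun U : Matrix.unitaryGroup (Fin d) ℂ =>
      ((U : Matrix (Fin d) (Fin d) ℂ) *ᵥ e) a := by
  have : Continuous fun U : Matrix.unitaryGroup (Fin d) ℂ =>
      (U : Matrix (Fin d) (Fin d) ℂ) *ᵥ e := by fun_prop
  exact (continuous_apply a).comp this

lemma continuous_variation (H : Matrix (Fin d) (Fin d) ℂ) (a b c i j k : Fin d) :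
    Continuous (variation H a b c i j k) := by
  unfold variation
  have h1 : Continuous fun v : Fin d → ℂ => H *ᵥ v := by fun_prop
  have h2 : Continuous fun v : Fin d → ℂ => star v ᵥ* H := by fun_prop
  fun_prop

lemma variation_add_smul (A B : Matrix (Fin d) (Fin d) ℂ) (z : ℂ) (a b c i j k : Fin d)
    (v : Fin d → ℂ) :
    variation (A + z • B) a b c i j k v =
      variation A a b c i j k v + z * variation B a b c i j k v := by
  simp only [variation, add_mulVec, smul_mulVec, vecMul_add, vecMul_smul, Pi.add_apply,
    Pi.smul_apply, smul_eq_mul]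
  ring

variable [MeasurableSpace (Matrix.unitaryGroup (Fin d) ℂ)]
  {μ : Measure (Matrix.unitaryGroup (Fin d) ℂ)}

/-- The sixth-order moments of the vector `U e`. -/
noncomputable def moment (μ : Measure (Matrix.unitaryGroup (Fin d) ℂ)) (e : Fin d → ℂ)
    (a b c i j k : Fin d) : ℂ :=
  ∫ U : Matrix.unitaryGroup (Fin d) ℂ,
    ((U : Matrix (Fin d) (Fin d) ℂ) *ᵥ e) a * ((U : Matrix (Fin d) (Fin d) ℂ) *ᵥ e) b *
      ((U : Matrix (Fin d) (Fin d) ℂ) *ᵥ e) c *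
      (star ((U : Matrix (Fin d) (Fin d) ℂ) *ᵥ e) i *
        star ((U : Matrix (Fin d) (Fin d) ℂ) *ᵥ e) j *
        star ((U : Matrix (Fin d) (Fin d) ℂ) *ᵥ e) k) ∂μ

lemma moment_swap_left (e : Fin d → ℂ) (a b c i j k : Fin d) :
    moment μ e a b c i j k = moment μ e b a c i j k :=
  integral_congr_ae (.of_forall fun U => by ring)

lemma moment_swap_right (e : Fin d → ℂ) (a b c i j k : Fin d) :
    moment μ e a b c i j k = moment μ e a c b i j k :=
  integral_congr_ae (.of_forall fun U => by ring)

lemma moment_star_swap_left (e : Fin d → ℂ) (a b c i j k : Fin d) :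
    moment μ e a b c i j k = moment μ e a b c j i k :=
  integral_congr_ae (.of_forall fun U => by ring)

lemma moment_star_swap_right (e : Fin d → ℂ) (a b c i j k : Fin d) :
    moment μ e a b c i j k = moment μ e a b c i k j :=
  integral_congr_ae (.of_forall fun U => by ring)

variable [BorelSpace (Matrix.unitaryGroup (Fin d) ℂ)] [IsProbabilityMeasure μ]

lemma integrable_of_continuous {g : Matrix.unitaryGroup (Fin d) ℂ → ℂ} (hg : Continuous g) :
    Integrable g μ :=
  hg.integrable_of_hasCompactSupport (HasCompactSupport.of_compactSpace g)

/-- Derivatives along one-parameter families have vanishing integral against a left-invariant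
probability measure. -/
lemma integral_eq_zero_of_hasDerivAt
    (hinv : ∀ V : Matrix.unitaryGroup (Fin d) ℂ, μ.map (fun U => V * U) = μ)
    {g h : Matrix.unitaryGroup (Fin d) ℂ → ℂ} (hg : Continuous g) (hh : Continuous h)
    {V : ℝ → Matrix.unitaryGroup (Fin d) ℂ} (hV : V 0 = 1)
    (hd : ∀ U t, HasDerivAt (fun s => g (V s * U)) (h (V t * U)) t) :
    ∫ U, h U ∂μ = 0 := by
  obtain ⟨C, hC⟩ := isCompact_univ.exists_bound_of_continuousOn hh.continuousOn
  have key := (hasDerivAt_integral_of_dominated_loc_of_deriv_le (μ := μ) (x₀ := (0 : ℝ))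
    (F := fun s U => g (V s * U)) (F' := fun s U => h (V s * U)) (bound := fun _ => C)
    Filter.univ_mem
    (Filter.Eventually.of_forall fun s =>
      (hg.comp (continuous_const_mul (V s))).aestronglyMeasurable)
    (integrable_of_continuous (hg.comp (continuous_const_mul (V 0))))
    (hh.comp (continuous_const_mul (V 0))).aestronglyMeasurable
    (Filter.Eventually.of_forall fun U s _ => hC _ (Set.mem_univ _))
    (integrable_const C)
    (Filter.Eventually.of_forall fun U s _ => hd U s)).2
  have hconst : (fun s => ∫ U, g (V s * U) ∂μ) = fun _ => ∫ U, g U ∂μ := by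
    ext s
    conv_rhs => rw [← hinv (V s)]
    rw [integral_map (continuous_const_mul (V s)).aemeasurable hg.aestronglyMeasurable]
  rw [hconst] at key
  simpa [hV] using key.unique (hasDerivAt_const _ _)

lemma integral_variation_selfAdjoint
    (hinv : ∀ V : Matrix.unitaryGroup (Fin d) ℂ, μ.map (fun U => V * U) = μ)
    (H : selfAdjoint (Matrix (Fin d) (Fin d) ℂ)) (e : Fin d → ℂ) (a b c i j k : Fin d) :
    ∫ U : Matrix.unitaryGroup (Fin d) ℂ,
      variation (H : Matrix (Fin d) (Fin d) ℂ) a b c i j k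
        ((U : Matrix (Fin d) (Fin d) ℂ) *ᵥ e) ∂μ = 0 := by
  obtain ⟨V, hV, hderiv⟩ := exists_hasDerivAt H
  have hcont : Continuous fun U : Matrix.unitaryGroup (Fin d) ℂ =>
      variation (H : Matrix (Fin d) (Fin d) ℂ) a b c i j k
        ((U : Matrix (Fin d) (Fin d) ℂ) *ᵥ e) :=
    (continuous_variation _ a b c i j k).comp (by fun_prop)
  have h0 := integral_eq_zero_of_hasDerivAt hinv (μ := μ)
    (g := fun U => ((U : Matrix (Fin d) (Fin d) ℂ) *ᵥ e) a *
      ((U : Matrix (Fin d) (Fin d) ℂ) *ᵥ e) b * ((U : Matrix (Fin d) (Fin d) ℂ) *ᵥ e) c *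
      (star (((U : Matrix (Fin d) (Fin d) ℂ) *ᵥ e) i) *
        star (((U : Matrix (Fin d) (Fin d) ℂ) *ᵥ e) j) *
        star (((U : Matrix (Fin d) (Fin d) ℂ) *ᵥ e) k)))
    (h := fun U => Complex.I * variation (H : Matrix (Fin d) (Fin d) ℂ) a b c i j k
        ((U : Matrix (Fin d) (Fin d) ℂ) *ᵥ e))
    (by fun_prop) (continuous_const.mul hcont) hV ?_
  · rw [integral_const_mul] at h0
    simpa using h0
  · intro U t
    have hstar : ∀ w : Fin d → ℂ, star ((H : Matrix (Fin d) (Fin d) ℂ) *ᵥ w) =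
        star w ᵥ* (H : Matrix (Fin d) (Fin d) ℂ) := fun w => by
      rw [star_mulVec]
      congr 1
      exact H.2
    have hD := fun m => hderiv ((U : Matrix (Fin d) (Fin d) ℂ) *ᵥ e) m t
    have hS := fun m => (hD m).star
    have h := (((hD a).mul (hD b)).mul (hD c)).mul (((hS i).mul (hS j)).mul (hS k))
    simp only [Submonoid.coe_mul, ← mulVec_mulVec]
    refine h.congr_deriv ?_
    simp only [variation, ← hstar, Pi.star_apply, star_mul', Complex.star_def, Complex.conj_I,
      Pi.mul_apply]
    ring

lemma integral_variation
    (hinv : ∀ V : Matrix.unitaryGroup (Fin d) ℂ, μ.map (fun U => V * U) = μ)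
    (H : Matrix (Fin d) (Fin d) ℂ) (e : Fin d → ℂ) (a b c i j k : Fin d) :
    ∫ U : Matrix.unitaryGroup (Fin d) ℂ,
      variation H a b c i j k ((U : Matrix (Fin d) (Fin d) ℂ) *ᵥ e) ∂μ = 0 := by
  have hcont : ∀ A : Matrix (Fin d) (Fin d) ℂ,
      Continuous fun U : Matrix.unitaryGroup (Fin d) ℂ =>
        variation A a b c i j k ((U : Matrix (Fin d) (Fin d) ℂ) *ᵥ e) :=
    fun A => (continuous_variation A a b c i j k).comp (by fun_prop)
  rw [← realPart_add_I_smul_imaginaryPart H]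
  simp_rw [variation_add_smul]
  rw [integral_add (integrable_of_continuous (hcont _))
    ((integrable_of_continuous (hcont _)).const_mul _), integral_const_mul,
    integral_variation_selfAdjoint hinv, integral_variation_selfAdjoint hinv]
  simp

lemma integrable_moment (e : Fin d → ℂ) (a b c i j k : Fin d) :
    Integrable (fun U : Matrix.unitaryGroup (Fin d) ℂ =>
      ((U : Matrix (Fin d) (Fin d) ℂ) *ᵥ e) a * ((U : Matrix (Fin d) (Fin d) ℂ) *ᵥ e) b *
        ((U : Matrix (Fin d) (Fin d) ℂ) *ᵥ e) c *
        (star ((U : Matrix (Fin d) (Fin d) ℂ) *ᵥ e) i *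
          star ((U : Matrix (Fin d) (Fin d) ℂ) *ᵥ e) j *
          star ((U : Matrix (Fin d) (Fin d) ℂ) *ᵥ e) k)) μ :=
  integrable_of_continuous (by simp only [Pi.star_apply]; fun_prop)

/-- Infinitesimal unitary invariance of the sixth-order moments. -/
lemma moment_invariance
    (hinv : ∀ V : Matrix.unitaryGroup (Fin d) ℂ, μ.map (fun U => V * U) = μ)
    (e : Fin d → ℂ) (x y a b c i j k : Fin d) :
    (if a = x then moment μ e y b c i j k else 0) +
        (if b = x then moment μ e a y c i j k else 0) +
        (if c = x then moment μ e a b y i j k else 0) =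
      (if i = y then moment μ e a b c x j k else 0) +
        (if j = y then moment μ e a b c i x k else 0) +
        (if k = y then moment μ e a b c i j x else 0) := by
  have h := integral_variation hinv (single x y (1 : ℂ)) e a b c i j k
  have h1 : ∀ (v : Fin d → ℂ) (m : Fin d),
      (single x y (1 : ℂ) *ᵥ v) m = (if m = x then (1 : ℂ) else 0) * v y := fun v m => by
    rw [single_mulVec_eq]
    simp [Pi.single_apply]
  have h2 : ∀ (v : Fin d → ℂ) (m : Fin d),
      (v ᵥ* single x y (1 : ℂ)) m = (if m = y then (1 : ℂ) else 0) * v x := fun v m => by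
    rw [← mulVec_transpose, transpose_single, single_mulVec_eq]
    simp [Pi.single_apply]
  have h3 : ∀ v : Fin d → ℂ, variation (single x y (1 : ℂ)) a b c i j k v =
      (if a = x then (1 : ℂ) else 0) * (v y * v b * v c * (star v i * star v j * star v k)) +
      (if b = x then (1 : ℂ) else 0) * (v a * v y * v c * (star v i * star v j * star v k)) +
      (if c = x then (1 : ℂ) else 0) * (v a * v b * v y * (star v i * star v j * star v k)) -
      ((if i = y then (1 : ℂ) else 0) * (v a * v b * v c * (star v x * star v j * star v k)) +
      (if j = y then (1 : ℂ) else 0) * (v a * v b * v c * (star v i * star v x * star v k)) +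
      (if k = y then (1 : ℂ) else 0) *
        (v a * v b * v c * (star v i * star v j * star v x))) := fun v => by
    rw [variation]
    simp only [h1, h2]
    ring
  simp only [h3] at h
  have ha := fun (P : Prop) [Decidable P] a b c i j k =>
    (integrable_moment (μ := μ) e a b c i j k).const_mul (if P then (1 : ℂ) else 0)
  have hadd := fun {f g : Matrix.unitaryGroup (Fin d) ℂ → ℂ} (hf : Integrable f μ)
    (hg : Integrable g μ) => show Integrable (fun U => f U + g U) μ from hf.add hg
  rw [integral_sub (hadd (hadd (ha _ _ _ _ _ _ _) (ha _ _ _ _ _ _ _)) (ha _ _ _ _ _ _ _))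
      (hadd (hadd (ha _ _ _ _ _ _ _) (ha _ _ _ _ _ _ _)) (ha _ _ _ _ _ _ _)),
    integral_add (hadd (ha _ _ _ _ _ _ _) (ha _ _ _ _ _ _ _)) (ha _ _ _ _ _ _ _),
    integral_add (ha _ _ _ _ _ _ _) (ha _ _ _ _ _ _ _),
    integral_add (hadd (ha _ _ _ _ _ _ _) (ha _ _ _ _ _ _ _)) (ha _ _ _ _ _ _ _),
    integral_add (ha _ _ _ _ _ _ _) (ha _ _ _ _ _ _ _)] at h
  simp only [integral_const_mul] at h
  simpa only [moment, ite_mul, one_mul, zero_mul] using sub_eq_zero.mp h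

lemma sum_moment_diagonal (e : Fin d → ℂ) (he : star e ⬝ᵥ e = 1) :
    ∑ x, ∑ y, ∑ z, moment μ e x y z x y z = 1 := by
  have hnorm : ∀ U : Matrix.unitaryGroup (Fin d) ℂ,
      ∑ x, ((U : Matrix (Fin d) (Fin d) ℂ) *ᵥ e) x *
        star ((U : Matrix (Fin d) (Fin d) ℂ) *ᵥ e) x = 1 := fun U => by
    have h : star ((U : Matrix (Fin d) (Fin d) ℂ) *ᵥ e) ⬝ᵥ
        ((U : Matrix (Fin d) (Fin d) ℂ) *ᵥ e) = 1 := by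
      rw [star_mulVec, ← dotProduct_mulVec, mulVec_mulVec, ← star_eq_conjTranspose,
        UnitaryGroup.star_mul_self, one_mulVec, he]
    rw [dotProduct_comm] at h
    exact h
  simp only [moment]
  simp_rw [← integral_finsetSum _ fun z _ => integrable_moment e _ _ z _ _ z]
  simp_rw [← integral_finsetSum _ fun y _ => integrable_finsetSum _ fun z _ =>
    integrable_moment e _ y z _ y z]
  rw [← integral_finsetSum _ fun x _ => integrable_finsetSum _ fun y _ =>
    integrable_finsetSum _ fun z _ => integrable_moment e x y z x y z]
  have : ∀ v : Fin d → ℂ, ∑ x, ∑ y, ∑ z, v x * v y * v z * (star v x * star v y * star v z) =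
      (∑ x, v x * star v x) * (∑ x, v x * star v x) * (∑ x, v x * star v x) := fun v => by
    simp only [Finset.sum_mul, Finset.mul_sum]
    refine Finset.sum_congr rfl fun x _ => ?_
    rw [Finset.sum_comm]
    refine Finset.sum_congr rfl fun y _ => Finset.sum_congr rfl fun z _ => ?_
    ring
  simp only [this, hnorm]
  simp

/-- The sixth-order moments of a Haar-random unit vector: a Wick-type sum over permutations. -/
lemma moment_eq
    (hinv : ∀ V : Matrix.unitaryGroup (Fin d) ℂ, μ.map (fun U => V * U) = μ)
    (e : Fin d → ℂ) (he : star e ⬝ᵥ e = 1) (a b c i j k : Fin d) :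
    (d : ℂ) * (d + 1) * (d + 2) * moment μ e a b c i j k =
      (if i = a then 1 else 0) * ((if j = b then 1 else 0) * (if k = c then 1 else 0) +
        (if k = b then 1 else 0) * (if j = c then 1 else 0)) +
      (if j = a then 1 else 0) * ((if i = b then 1 else 0) * (if k = c then 1 else 0) +
        (if k = b then 1 else 0) * (if i = c then 1 else 0)) +
      (if k = a then 1 else 0) * ((if i = b then 1 else 0) * (if j = c then 1 else 0) +
        (if j = b then 1 else 0) * (if i = c then 1 else 0)) := by
  let M₂ : Fin d → Fin d → Fin d → Fin d → ℂ := fun a b i j => ∑ x, moment μ e a b x i j x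
  let M₁ : Fin d → Fin d → ℂ := fun a i => ∑ x, M₂ a x i x
  have hM₂swap : ∀ a b i j, M₂ a b i j = M₂ b a i j := fun a b i j =>
    Finset.sum_congr rfl fun x _ => moment_swap_left e _ _ _ _ _ _
  have h3 : ∀ y b c i j k, ((d : ℂ) + 2) * moment μ e y b c i j k =
      (if i = y then 1 else 0) * M₂ b c j k + (if j = y then 1 else 0) * M₂ b c i k +
        (if k = y then 1 else 0) * M₂ b c i j := fun y b c i j k => by
    have h := Finset.sum_congr (rfl : (Finset.univ : Finset (Fin d)) = _) fun x _ =>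
      moment_invariance hinv e x y x b c i j k
    have hl : ∀ x, moment μ e x b c x j k = moment μ e b c x j k x := fun x => by
      rw [moment_swap_left, moment_swap_right, moment_star_swap_left, moment_star_swap_right]
    have hl' : ∀ x, moment μ e x b c i x k = moment μ e b c x i k x := fun x => by
      rw [moment_swap_left, moment_swap_right, moment_star_swap_right]
    have hl'' : ∀ x, moment μ e x b c i j x = moment μ e b c x i j x := fun x => by
      rw [moment_swap_left, moment_swap_right]
    have hc : moment μ e c b y i j k = moment μ e y b c i j k := by
      rw [moment_swap_left, moment_swap_right, moment_swap_left]
    simp only [Finset.sum_add_distrib, if_true, Finset.sum_ite_eq, Finset.mem_univ, hl, hl', hl'',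
      Finset.sum_const, Finset.card_univ, Fintype.card_fin, nsmul_eq_mul, Finset.sum_ite_irrel,
      mul_zero, hc, moment_swap_left (μ := μ) e b y c] at h
    simp only [ite_mul, one_mul, zero_mul, M₂]
    rw [← h]
    ring
  have h2 : ∀ y b i j, ((d : ℂ) + 1) * M₂ y b i j =
      (if i = y then 1 else 0) * M₁ b j + (if j = y then 1 else 0) * M₁ b i :=
      fun y b i j => by
    have h := Finset.sum_congr (rfl : (Finset.univ : Finset (Fin d)) = _) fun z _ =>
      h3 y b z i j z
    simp only [Finset.sum_add_distrib, ← Finset.mul_sum] at h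
    simp only [ite_mul, one_mul, zero_mul, Finset.sum_ite_eq',
      Finset.mem_univ, if_true, hM₂swap b y] at h
    simp only [ite_mul, one_mul, zero_mul]
    change ((d : ℂ) + 2) * M₂ y b i j = (if i = y then M₁ b j else 0) +
      (if j = y then M₁ b i else 0) + M₂ y b i j at h
    linear_combination h
  have h1 : ∀ y i, (d : ℂ) * M₁ y i = if i = y then 1 else 0 := fun y i => by
    have h := Finset.sum_congr (rfl : (Finset.univ : Finset (Fin d)) = _) fun z _ =>
      h2 y z i z
    have hT : ∑ x, M₁ x x = 1 := sum_moment_diagonal e he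
    simp only [Finset.sum_add_distrib, ← Finset.mul_sum, hT] at h
    simp only [ite_mul, one_mul, zero_mul, Finset.sum_ite_eq',
      Finset.mem_univ, if_true] at h
    change ((d : ℂ) + 1) * M₁ y i = (if i = y then 1 else 0) + M₁ y i at h
    linear_combination h
  have h2' : ∀ y b i j, (d : ℂ) * (d + 1) * M₂ y b i j =
      (if i = y then 1 else 0) * (if j = b then 1 else 0) +
        (if j = y then 1 else 0) * (if i = b then 1 else 0) := fun y b i j => by
    linear_combination (d : ℂ) * h2 y b i j + (if i = y then 1 else 0) * h1 b j +
      (if j = y then 1 else 0) * h1 b i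
  rw [mul_assoc, h3]
  linear_combination (if i = a then 1 else 0) * h2' b c j k +
    (if j = a then 1 else 0) * h2' b c i k + (if k = a then 1 else 0) * h2' b c i j

end Matrix.unitaryGroup

/-- the second moment of the rank-one outcome of the uniform POVM
applied to a state `ρ` equals `(I⊗I + F)(I⊗I + I⊗ρ + ρ⊗I) / ((d+1)(d+2))`, where
`F` is the swap matrix.  Haar measure on the unitary group is encoded as a
left-invariant Borel probability measure `μ`. -/
theorem uniform_povm_second_moment
    {d : ℕ} (hd : 1 ≤ d)
    [MeasurableSpace (Matrix.unitaryGroup (Fin d) ℂ)]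
    [BorelSpace (Matrix.unitaryGroup (Fin d) ℂ)]
    (μ : Measure (Matrix.unitaryGroup (Fin d) ℂ)) [IsProbabilityMeasure μ]
    (hinv : ∀ V : Matrix.unitaryGroup (Fin d) ℂ, μ.map (fun U => V * U) = μ)
    (ρ : Matrix (Fin d) (Fin d) ℂ) (hρ : ρ.PosSemidef) (hρtr : ρ.trace = 1)
    (e₀ : Fin d → ℂ) (he₀ : star e₀ ⬝ᵥ e₀ = 1)
    (F : Matrix (Fin d × Fin d) (Fin d × Fin d) ℂ)
    (hF : ∀ a b : Fin d → ℂ,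
      F.mulVec (fun p => a p.1 * b p.2) = fun p => b p.1 * a p.2) :
    ∀ p q : Fin d × Fin d,
      (d : ℂ) * ∫ U : Matrix.unitaryGroup (Fin d) ℂ,
          ((vecMulVec ((U : Matrix (Fin d) (Fin d) ℂ).mulVec e₀)
              (star ((U : Matrix (Fin d) (Fin d) ℂ).mulVec e₀)) ⊗ₖ
            vecMulVec ((U : Matrix (Fin d) (Fin d) ℂ).mulVec e₀)
              (star ((U : Matrix (Fin d) (Fin d) ℂ).mulVec e₀))) p q)
          * (star ((U : Matrix (Fin d) (Fin d) ℂ).mulVec e₀)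
              ⬝ᵥ ρ.mulVec ((U : Matrix (Fin d) (Fin d) ℂ).mulVec e₀)) ∂μ
      = (((((d : ℂ) + 1) * ((d : ℂ) + 2))⁻¹) •
          (((1 : Matrix (Fin d) (Fin d) ℂ) ⊗ₖ (1 : Matrix (Fin d) (Fin d) ℂ) + F) *
            ((1 : Matrix (Fin d) (Fin d) ℂ) ⊗ₖ (1 : Matrix (Fin d) (Fin d) ℂ)
              + (1 : Matrix (Fin d) (Fin d) ℂ) ⊗ₖ ρ
              + ρ ⊗ₖ (1 : Matrix (Fin d) (Fin d) ℂ)))) p q := by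
  intro p q
  have hd0 : (d : ℂ) ≠ 0 := by exact_mod_cast (by omega : d ≠ 0)
  have hd1 : (d : ℂ) + 1 ≠ 0 := by exact_mod_cast (by omega : d + 1 ≠ 0)
  have hd2 : (d : ℂ) + 2 ≠ 0 := by exact_mod_cast (by omega : d + 2 ≠ 0)
  have hFe : ∀ r s : Fin d × Fin d, F r s = if s = (r.2, r.1) then 1 else 0 := fun r s => by
    have h := congrFun (hF (Pi.single s.1 1) (Pi.single s.2 1)) r
    have hs : (fun t : Fin d × Fin d =>
        (Pi.single s.1 1 : Fin d → ℂ) t.1 * (Pi.single s.2 1 : Fin d → ℂ) t.2) =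
        Pi.single s 1 := by
      ext t
      simp only [Pi.single_apply, Prod.ext_iff, ite_and, ite_mul, one_mul, zero_mul]
    rw [hs, mulVec_single_one, col_apply] at h
    rw [h, mul_comm]
    simp only [Pi.single_apply, Prod.ext_iff, ite_and, ite_mul, one_mul, zero_mul,
      eq_comm (a := r.1), eq_comm (a := r.2)]
  have hint : ∀ v : Fin d → ℂ,
      (vecMulVec v (star v) ⊗ₖ vecMulVec v (star v)) p q * (star v ⬝ᵥ ρ *ᵥ v) =
      ∑ m, ∑ n, ρ m n *
        (v p.1 * v p.2 * v n * (star v q.1 * star v q.2 * star v m)) := fun v => by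
    simp only [kroneckerMap_apply, vecMulVec_apply, dotProduct, mulVec, Finset.mul_sum]
    refine Finset.sum_congr rfl fun m _ => Finset.sum_congr rfl fun n _ => ?_
    ring
  simp only [hint]
  have hi := fun m n =>
    (unitaryGroup.integrable_moment (μ := μ) e₀ p.1 p.2 n q.1 q.2 m).const_mul (ρ m n)
  rw [integral_finsetSum _ fun m _ => integrable_finsetSum _ fun n _ => hi m n]
  simp_rw [integral_finsetSum _ fun n _ => hi _ n, integral_const_mul]
  have hmom : ∀ m n, (d : ℂ) * unitaryGroup.moment μ e₀ p.1 p.2 n q.1 q.2 m =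
      (((d : ℂ) + 1) * ((d : ℂ) + 2))⁻¹ *
        ((d : ℂ) * (d + 1) * (d + 2) * unitaryGroup.moment μ e₀ p.1 p.2 n q.1 q.2 m) :=
    fun m n => by field_simp
  simp only [unitaryGroup.moment_eq hinv e₀ he₀] at hmom
  change (d : ℂ) * ∑ m, ∑ n, ρ m n * unitaryGroup.moment μ e₀ p.1 p.2 n q.1 q.2 m = _
  simp_rw [Finset.mul_sum, mul_left_comm (d : ℂ), hmom, mul_left_comm _ (_⁻¹),
    ← Finset.mul_sum]
  rw [Matrix.smul_apply, smul_eq_mul]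
  congr 1
  have htr : ∑ m, ρ m m = 1 := hρtr
  have hsum : ∀ A B C D : ℂ,
      ∑ m, ∑ n, ρ m n *
        (A * (D * (if m = n then 1 else 0) +
            (if m = p.2 then 1 else 0) * (if q.2 = n then 1 else 0)) +
          B * (C * (if m = n then 1 else 0) +
            (if m = p.2 then 1 else 0) * (if q.1 = n then 1 else 0)) +
          (if m = p.1 then 1 else 0) * (C * (if q.2 = n then 1 else 0) +
            D * (if q.1 = n then 1 else 0))) =
      A * (D + ρ p.2 q.2) + B * (C + ρ p.2 q.1) + (C * ρ p.1 q.2 + D * ρ p.1 q.1) := by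
    intro A B C D
    simp only [mul_ite, ite_mul, mul_one, mul_zero, one_mul, zero_mul, mul_add,
      Finset.sum_add_distrib, Finset.sum_ite_eq, Finset.sum_ite_eq', Finset.mem_univ, if_true,
      ← Finset.sum_mul, htr]
    ring
  rw [hsum, one_kronecker_one, add_mul, one_mul, Matrix.add_apply, Matrix.mul_apply]
  simp only [hFe, ite_mul, one_mul, zero_mul, Finset.sum_ite_eq', Finset.mem_univ, if_true]
  simp only [Matrix.add_apply, kroneckerMap_apply, one_apply, Prod.ext_iff, ite_and,
    eq_comm (a := q.1), eq_comm (a := q.2), mul_ite, ite_mul, mul_one, mul_zero, one_mul, zero_mul]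
  split_ifs <;> ring
end

section
/- Let ρ be a density matrix on ℂ^d, M a Hermitian d×d complex matrix, and e₀ a fixed unit vector in ℂ^d. Then d · ∫_{U(d)} ⟨U e₀, M (U e₀)⟩² · ⟨U e₀, ρ (U e₀)⟩ dμ(U) = ((Tr M)² + Tr(M²) + 2·(Tr M)·Tr(Mρ) + 2·Tr(M²ρ)) / ((d+1)(d+2)), where μ is Haar measure on the unitary group U(d). -/
open Matrix MeasureTheory
open scoped BigOperators ComplexOrder

section HaarMoments

variable {d : ℕ}

instance Matrix.unitaryGroup.instCompactSpace : CompactSpace (unitaryGroup (Fin d) ℂ) := by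
  rw [← isCompact_univ_iff, Subtype.isCompact_iff, Set.image_univ, Subtype.range_coe]
  refine (isCompact_univ_pi fun _ => isCompact_univ_pi fun _ =>
    isCompact_closedBall (0 : ℂ) 1).of_isClosed_subset
    (isClosed_unitary (R := Matrix (Fin d) (Fin d) ℂ)) ?_
  intro U hU i _ j _
  simpa using entry_norm_bound_of_unitary hU i j

/-- The quadratic form `U ↦ ⟨U e, A (U e)⟩` as a continuous function on the unitary group,
linear in `A`. -/
noncomputable def orbitForm (e : Fin d → ℂ) :
    Matrix (Fin d) (Fin d) ℂ →ₗ[ℂ] C(unitaryGroup (Fin d) ℂ, ℂ) where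
  toFun A :=
    { toFun := fun U => star ((U : Matrix (Fin d) (Fin d) ℂ) *ᵥ e) ⬝ᵥ
        A *ᵥ ((U : Matrix (Fin d) (Fin d) ℂ) *ᵥ e)
      continuous_toFun := by fun_prop }
  map_add' A B := by
    ext U
    simp only [add_mulVec, dotProduct_add, ContinuousMap.coe_mk, ContinuousMap.add_apply]
  map_smul' c A := by
    ext U
    simp [smul_mulVec]

theorem orbitForm_apply (e : Fin d → ℂ) (A : Matrix (Fin d) (Fin d) ℂ)
    (U : unitaryGroup (Fin d) ℂ) :
    orbitForm e A U = star ((U : Matrix (Fin d) (Fin d) ℂ) *ᵥ e) ⬝ᵥ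
        A *ᵥ ((U : Matrix (Fin d) (Fin d) ℂ) *ᵥ e) := rfl

theorem orbitForm_one {e : Fin d → ℂ} (he : star e ⬝ᵥ e = 1) : orbitForm e 1 = 1 := by
  ext U
  rw [orbitForm_apply, one_mulVec, star_mulVec, ← dotProduct_mulVec, mulVec_mulVec,
    ← star_eq_conjTranspose, mem_unitaryGroup_iff'.mp U.2, one_mulVec, he, ContinuousMap.one_apply]

theorem orbitForm_conj (e : Fin d → ℂ) (A : Matrix (Fin d) (Fin d) ℂ)
    (U V : unitaryGroup (Fin d) ℂ) :
    orbitForm e (star (V : Matrix (Fin d) (Fin d) ℂ) * A * V) U = orbitForm e A (V * U) := by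
  simp only [orbitForm_apply, Submonoid.coe_mul, ← mulVec_mulVec, star_mulVec,
    star_eq_conjTranspose, ← dotProduct_mulVec]

theorem orbitForm_eq_ofReal (e : Fin d → ℂ) {A : Matrix (Fin d) (Fin d) ℂ} (hA : A.IsHermitian)
    (U : unitaryGroup (Fin d) ℂ) : orbitForm e A U = ((orbitForm e A U).re : ℂ) := by
  rw [eq_comm, ← Complex.conj_eq_iff_re, orbitForm_apply]
  set v := (U : Matrix (Fin d) (Fin d) ℂ) *ᵥ e
  change star (star v ⬝ᵥ A *ᵥ v) = _
  rw [← star_dotProduct, star_mulVec, hA.eq, ← dotProduct_mulVec]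

theorem orbitForm_mul_single (e : Fin d → ℂ) (A : Matrix (Fin d) (Fin d) ℂ) (i j : Fin d)
    (U : unitaryGroup (Fin d) ℂ) :
    orbitForm e (A * single i j 1) U =
      (star ((U : Matrix (Fin d) (Fin d) ℂ) *ᵥ e) ᵥ* A) i *
        ((U : Matrix (Fin d) (Fin d) ℂ) *ᵥ e) j := by
  rw [orbitForm_apply, ← mulVec_mulVec, dotProduct_mulVec, single_mulVec_eq]
  simp [mul_comm]

theorem orbitForm_single_mul (e : Fin d → ℂ) (A : Matrix (Fin d) (Fin d) ℂ) (i j : Fin d)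
    (U : unitaryGroup (Fin d) ℂ) :
    orbitForm e (single i j 1 * A) U =
      star (((U : Matrix (Fin d) (Fin d) ℂ) *ᵥ e) i) *
        (A *ᵥ ((U : Matrix (Fin d) (Fin d) ℂ) *ᵥ e)) j := by
  rw [orbitForm_apply, ← mulVec_mulVec, single_mulVec_eq]
  simp [mul_comm]

/-- Contracting the derivations attached to matrix units against `A * single j i 1`. -/
theorem sum_orbitForm_mul_commutator {e : Fin d → ℂ} (he : star e ⬝ᵥ e = 1)
    (A B : Matrix (Fin d) (Fin d) ℂ) :
    ∑ i, ∑ j, orbitForm e (A * single j i 1) *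
        orbitForm e (B * single i j 1 - single i j 1 * B) =
      orbitForm e A * orbitForm e B - orbitForm e (A * B) := by
  ext U
  have h1 := congrArg (fun f : C(unitaryGroup (Fin d) ℂ, ℂ) => f U) (orbitForm_one he)
  simp only [orbitForm_apply, one_mulVec, ContinuousMap.one_apply] at h1
  simp only [map_sub, ContinuousMap.coe_sum, Finset.sum_apply, ContinuousMap.mul_apply,
    ContinuousMap.sub_apply, orbitForm_mul_single, orbitForm_single_mul]
  simp only [orbitForm_apply]
  set v := (U : Matrix (Fin d) (Fin d) ℂ) *ᵥ e
  have h2 : star v ⬝ᵥ (A * B) *ᵥ v = (star v ⬝ᵥ v) * ((star v ᵥ* A) ⬝ᵥ B *ᵥ v) := by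
    rw [h1, one_mul, ← mulVec_mulVec, dotProduct_mulVec]
  rw [h2, dotProduct_mulVec, dotProduct_mulVec (star v) B]
  simp only [dotProduct, Finset.sum_mul_sum, mul_sub, Finset.sum_sub_distrib]
  congr 1
  · rw [Finset.sum_comm]
    exact Finset.sum_congr rfl fun j _ => Finset.sum_congr rfl fun i _ => by ring
  · exact Finset.sum_congr rfl fun i _ => Finset.sum_congr rfl fun j _ => by
      simp only [Pi.star_apply]; ring

theorem sum_commutator_single (A : Matrix (Fin d) (Fin d) ℂ) :
    ∑ i, ∑ j, ((A * single j i 1) * single i j 1 - single i j 1 * (A * single j i 1)) =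
      (d : ℂ) • A - A.trace • (1 : Matrix (Fin d) (Fin d) ℂ) := by
  simp only [Finset.sum_sub_distrib]
  congr 1
  · simp only [Matrix.mul_assoc, single_mul_single_same, mul_one, ← Matrix.mul_sum, sum_single_one]
    simp [Nat.cast_smul_eq_nsmul]
  · simp only [← Matrix.mul_assoc, single_mul_mul_single, one_mul, mul_one]
    rw [trace, Finset.sum_smul, ← sum_single_one, Finset.sum_comm]
    simp [Finset.smul_sum]

/-- A continuous functional on `C(U(d), ℂ)` invariant under left translation. -/
def IsLeftInvariantFunctional (I : C(unitaryGroup (Fin d) ℂ, ℂ) →L[ℂ] ℂ) : Prop :=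
  ∀ (f g : C(unitaryGroup (Fin d) ℂ, ℂ)) (V : unitaryGroup (Fin d) ℂ),
    (∀ U, g U = f (V * U)) → I g = I f

open scoped Matrix.Norms.L2Operator in
theorem IsLeftInvariantFunctional.commutator_of_skew {I : C(unitaryGroup (Fin d) ℂ, ℂ) →L[ℂ] ℂ}
    (hI : IsLeftInvariantFunctional I) (e : Fin d → ℂ) {K : Matrix (Fin d) (Fin d) ℂ}
    (hK : star K = -K) (A B C : Matrix (Fin d) (Fin d) ℂ) :
    I (orbitForm e (A * K - K * A) * orbitForm e B * orbitForm e C +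
      orbitForm e A * orbitForm e (B * K - K * B) * orbitForm e C +
      orbitForm e A * orbitForm e B * orbitForm e (C * K - K * C)) = 0 := by
  have hderiv (X : Matrix (Fin d) (Fin d) ℂ) : HasDerivAt
      (fun t : ℝ => orbitForm e (NormedSpace.exp (t • (-K)) * X * NormedSpace.exp (t • K)))
      (orbitForm e (X * K - K * X)) 0 := by
    have h := ((hasDerivAt_exp_smul_const (-K) (0 : ℝ)).mul_const X).mul
      (hasDerivAt_exp_smul_const K (0 : ℝ))
    have h' := (((LinearMap.toContinuousLinearMap (orbitForm e)).restrictScalars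
      ℝ).hasFDerivAt).comp_hasDerivAt (0 : ℝ) h
    refine h'.congr_deriv ?_
    simp only [zero_smul, NormedSpace.exp_zero, one_mul, mul_one, neg_mul, sub_eq_neg_add]
    rfl
  have htot := ((I.restrictScalars ℝ).hasFDerivAt).comp_hasDerivAt (0 : ℝ)
    (((hderiv A).mul (hderiv B)).mul (hderiv C))
  have hconst : HasDerivAt (fun _ : ℝ => I (orbitForm e A * orbitForm e B * orbitForm e C))
      (0 : ℂ) 0 := hasDerivAt_const _ _
  have huniq := htot.unique (hconst.congr_of_eventuallyEq (Filter.Eventually.of_forall fun t => ?_))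
  · simp only [zero_smul, NormedSpace.exp_zero, one_mul, mul_one, Pi.mul_apply] at huniq
    refine Eq.trans ?_ huniq
    simp only [ContinuousLinearMap.coe_restrictScalars']
    congr 1
    ring
  · let _ : NormedAlgebra ℚ (Matrix (Fin d) (Fin d) ℂ) := NormedAlgebra.restrictScalars ℚ ℂ _
    have hmem : NormedSpace.exp (t • K) ∈ unitary (Matrix (Fin d) (Fin d) ℂ) :=
      NormedSpace.exp_mem_unitary_of_mem_skewAdjoint (by
        rw [skewAdjoint.mem_iff, star_smul, hK, smul_neg, star_trivial])
    have hstar : NormedSpace.exp (t • (-K)) = star (NormedSpace.exp (t • K)) := by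
      rw [NormedSpace.star_exp, star_smul, hK, star_trivial]
    refine hI _ _ ⟨_, hmem⟩ fun U => ?_
    simp only [Pi.mul_apply, ContinuousMap.mul_apply, hstar]
    rw [← orbitForm_conj, ← orbitForm_conj, ← orbitForm_conj]

theorem IsLeftInvariantFunctional.commutator {I : C(unitaryGroup (Fin d) ℂ, ℂ) →L[ℂ] ℂ}
    (hI : IsLeftInvariantFunctional I) (e : Fin d → ℂ) (K A B C : Matrix (Fin d) (Fin d) ℂ) :
    I (orbitForm e (A * K - K * A) * orbitForm e B * orbitForm e C +
      orbitForm e A * orbitForm e (B * K - K * B) * orbitForm e C +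
      orbitForm e A * orbitForm e B * orbitForm e (C * K - K * C)) = 0 := by
  obtain ⟨P, Q, hP, hQ, rfl⟩ : ∃ P Q : Matrix (Fin d) (Fin d) ℂ, star P = -P ∧ star Q = -Q ∧
      K = P + Complex.I • Q := by
    refine ⟨(1 / 2 : ℂ) • (K - star K), (-Complex.I / 2) • (K + star K), ?_, ?_, ?_⟩
    · simp [star_smul, ← smul_neg]
    · simp [star_smul, ← smul_neg, neg_div, add_comm]
    · rw [smul_smul, show Complex.I * (-Complex.I / 2) = 1 / 2 by
        linear_combination (-1 / 2 : ℂ) * Complex.I_mul_I, ← smul_add]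
      rw [sub_add_add_cancel, ← two_smul ℂ, smul_smul]
      norm_num
  have h1 := hI.commutator_of_skew e hP A B C
  have h2 := hI.commutator_of_skew e hQ A B C
  have hexp (X : Matrix (Fin d) (Fin d) ℂ) :
      orbitForm e (X * (P + Complex.I • Q) - (P + Complex.I • Q) * X) =
        orbitForm e (X * P - P * X) + Complex.I • orbitForm e (X * Q - Q * X) := by
    rw [← map_smul, ← map_add]
    congr 1
    rw [mul_add, add_mul, mul_smul_comm, smul_mul_assoc, smul_sub]
    abel
  have hsum := congrArg₂ (fun x y => x + Complex.I • y) h1 h2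
  simp only [← map_smul, ← map_add, smul_zero, add_zero] at hsum
  rw [← hsum, hexp, hexp, hexp]
  congr 1
  simp only [Algebra.smul_def]
  ring

/-- Recursion lowering the degree of an invariant moment by one. -/
theorem IsLeftInvariantFunctional.moment_recursion {I : C(unitaryGroup (Fin d) ℂ, ℂ) →L[ℂ] ℂ}
    (hI : IsLeftInvariantFunctional I) {e : Fin d → ℂ} (he : star e ⬝ᵥ e = 1)
    (A B C : Matrix (Fin d) (Fin d) ℂ) :
    ((d : ℂ) + 2) * I (orbitForm e A * orbitForm e B * orbitForm e C) =
      A.trace * I (orbitForm e B * orbitForm e C) +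
        I (orbitForm e (A * B) * orbitForm e C) + I (orbitForm e (A * C) * orbitForm e B) := by
  have h0 : ∑ i, ∑ j, I _ = ∑ _i : Fin d, ∑ _j : Fin d, (0 : ℂ) :=
    Finset.sum_congr rfl fun i _ => Finset.sum_congr rfl fun j _ =>
      hI.commutator e (single i j 1) (A * single j i 1) B C
  simp only [Finset.sum_const_zero, ← map_sum, Finset.sum_add_distrib, ← Finset.sum_mul] at h0
  have hswap : ∑ i, ∑ j, orbitForm e (A * single j i 1) * orbitForm e B *
        orbitForm e (C * single i j 1 - single i j 1 * C) =
      (∑ i, ∑ j, orbitForm e (A * single j i 1) *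
        orbitForm e (C * single i j 1 - single i j 1 * C)) * orbitForm e B := by
    simp only [Finset.sum_mul]
    exact Finset.sum_congr rfl fun i _ => Finset.sum_congr rfl fun j _ => by ring
  rw [hswap, sum_orbitForm_mul_commutator he, sum_orbitForm_mul_commutator he,
    sum_commutator_single, map_sub, map_smul, map_smul, orbitForm_one he] at h0
  have h3 : (d : ℂ) • (orbitForm e A * orbitForm e B * orbitForm e C) -
        A.trace • (orbitForm e B * orbitForm e C) +
      (orbitForm e A * orbitForm e B * orbitForm e C - orbitForm e (A * B) * orbitForm e C) +
      (orbitForm e A * orbitForm e B * orbitForm e C - orbitForm e (A * C) * orbitForm e B) =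
      ((d : ℂ) • orbitForm e A - A.trace • 1) * orbitForm e B * orbitForm e C +
        (orbitForm e A * orbitForm e B - orbitForm e (A * B)) * orbitForm e C +
        (orbitForm e A * orbitForm e C - orbitForm e (A * C)) * orbitForm e B := by
    simp only [Algebra.smul_def]
    ring
  rw [← h3] at h0
  simp only [map_add, map_sub, map_smul, smul_eq_mul] at h0
  linear_combination h0

theorem IsLeftInvariantFunctional.third_moment {I : C(unitaryGroup (Fin d) ℂ, ℂ) →L[ℂ] ℂ}
    (hI : IsLeftInvariantFunctional I) (hI1 : I 1 = 1) {e : Fin d → ℂ} (he : star e ⬝ᵥ e = 1)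
    (A B C : Matrix (Fin d) (Fin d) ℂ) :
    (d : ℂ) * (d + 1) * (d + 2) * I (orbitForm e A * orbitForm e B * orbitForm e C) =
      A.trace * B.trace * C.trace + A.trace * (B * C).trace + (A * B).trace * C.trace +
        (A * C).trace * B.trace + (A * B * C).trace + (A * C * B).trace := by
  have h1 (X : Matrix (Fin d) (Fin d) ℂ) : (d : ℂ) * I (orbitForm e X) = X.trace := by
    have h := hI.moment_recursion he X 1 1
    simp only [orbitForm_one he, mul_one, hI1] at h
    linear_combination h
  have h2 (X Y : Matrix (Fin d) (Fin d) ℂ) :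
      ((d : ℂ) + 1) * I (orbitForm e X * orbitForm e Y) =
        X.trace * I (orbitForm e Y) + I (orbitForm e (X * Y)) := by
    have h := hI.moment_recursion he X Y 1
    simp only [orbitForm_one he, mul_one] at h
    linear_combination h
  linear_combination (d : ℂ) * (d + 1) * hI.moment_recursion he A B C +
    d * A.trace * h2 B C + d * h2 (A * B) C + d * h2 (A * C) B + A.trace * B.trace * h1 C +
    A.trace * h1 (B * C) + (A * B).trace * h1 C + h1 (A * B * C) + (A * C).trace * h1 B +
    h1 (A * C * B)

/-- Integration against a finite Borel measure as a continuous functional. -/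
noncomputable def integralFunctional [MeasurableSpace (unitaryGroup (Fin d) ℂ)]
    [BorelSpace (unitaryGroup (Fin d) ℂ)] (μ : Measure (unitaryGroup (Fin d) ℂ))
    [IsFiniteMeasure μ] : C(unitaryGroup (Fin d) ℂ, ℂ) →L[ℂ] ℂ :=
  LinearMap.mkContinuous
    { toFun := fun f => ∫ U, f U ∂μ
      map_add' := fun f g => integral_add
        (f.continuous.integrable_of_hasCompactSupport (HasCompactSupport.of_compactSpace f))
        (g.continuous.integrable_of_hasCompactSupport (HasCompactSupport.of_compactSpace g))
      map_smul' := fun c f => integral_smul c f } (μ.real Set.univ) fun f => by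
    rw [mul_comm]
    exact norm_integral_le_of_norm_le_const (Filter.Eventually.of_forall f.norm_coe_le_norm)

theorem isLeftInvariantFunctional_integralFunctional
    [MeasurableSpace (unitaryGroup (Fin d) ℂ)]
    [BorelSpace (unitaryGroup (Fin d) ℂ)] (μ : Measure (unitaryGroup (Fin d) ℂ))
    [IsFiniteMeasure μ] (hinv : ∀ V : unitaryGroup (Fin d) ℂ, μ.map (fun U => V * U) = μ) :
    IsLeftInvariantFunctional (integralFunctional μ) := by
  intro f g V h
  change ∫ U, g U ∂μ = ∫ U, f U ∂μ
  have hV : Continuous fun U : unitaryGroup (Fin d) ℂ => V * U := by fun_prop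
  calc ∫ U, g U ∂μ = ∫ U, f (V * U) ∂μ := integral_congr_ae (Filter.Eventually.of_forall h)
    _ = ∫ U, f U ∂(μ.map fun U => V * U) := by
      refine (integral_map hV.measurable.aemeasurable ?_).symm
      rw [hinv V]
      exact (f.continuous.integrable_of_hasCompactSupport
        (HasCompactSupport.of_compactSpace f)).aestronglyMeasurable
    _ = ∫ U, f U ∂μ := by rw [hinv V]

end HaarMoments

/-- exact formula for the second moment of the observable value
`⟨v, M v⟩` under the uniform-POVM outcome distribution of a state `ρ`.
Haar measure on the unitary group is encoded as a left-invariant Borel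
probability measure `μ`. -/
theorem uniform_povm_observable_second_moment
    {d : ℕ} (hd : 1 ≤ d)
    [MeasurableSpace (Matrix.unitaryGroup (Fin d) ℂ)]
    [BorelSpace (Matrix.unitaryGroup (Fin d) ℂ)]
    (μ : Measure (Matrix.unitaryGroup (Fin d) ℂ)) [IsProbabilityMeasure μ]
    (hinv : ∀ V : Matrix.unitaryGroup (Fin d) ℂ, μ.map (fun U => V * U) = μ)
    (ρ M : Matrix (Fin d) (Fin d) ℂ)
    (hρ : ρ.PosSemidef) (hρtr : ρ.trace = 1) (hM : M.IsHermitian)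
    (e₀ : Fin d → ℂ) (he₀ : star e₀ ⬝ᵥ e₀ = 1) :
    (d : ℝ) * ∫ U : Matrix.unitaryGroup (Fin d) ℂ,
        ((star ((U : Matrix (Fin d) (Fin d) ℂ).mulVec e₀)
            ⬝ᵥ M.mulVec ((U : Matrix (Fin d) (Fin d) ℂ).mulVec e₀)).re) ^ 2
        * (star ((U : Matrix (Fin d) (Fin d) ℂ).mulVec e₀)
            ⬝ᵥ ρ.mulVec ((U : Matrix (Fin d) (Fin d) ℂ).mulVec e₀)).re ∂μ
    = ((M.trace.re) ^ 2 + ((M * M).trace).re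
        + 2 * M.trace.re * ((M * ρ).trace).re + 2 * ((M * M * ρ).trace).re)
      / (((d : ℝ) + 1) * ((d : ℝ) + 2)) := by
  have hI := isLeftInvariantFunctional_integralFunctional μ hinv
  have hI1 : integralFunctional μ 1 = 1 := by
    change ∫ _, (1 : ℂ) ∂μ = 1
    simp
  have hmom := hI.third_moment hI1 he₀ M M ρ
  have hint : integralFunctional μ (orbitForm e₀ M * orbitForm e₀ M * orbitForm e₀ ρ) =
      ((∫ U, (orbitForm e₀ M U).re ^ 2 * (orbitForm e₀ ρ U).re ∂μ : ℝ) : ℂ) := by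
    rw [← integral_complex_ofReal]
    change ∫ U, orbitForm e₀ M U * orbitForm e₀ M U * orbitForm e₀ ρ U ∂μ = _
    congr 1
    ext U
    rw [orbitForm_eq_ofReal e₀ hM U, orbitForm_eq_ofReal e₀ hρ.isHermitian U]
    push_cast [Complex.ofReal_re]
    ring
  have htr : (M.trace.re : ℂ) = M.trace := by
    rw [← Complex.conj_eq_iff_re, starRingEnd_apply, ← trace_conjTranspose, hM.eq]
  rw [hint, hρtr, trace_mul_cycle M ρ M, ← htr] at hmom
  simp only [orbitForm_apply] at hmom
  have hre := congrArg Complex.re hmom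
  norm_cast at hre
  simp only [Complex.add_re, Complex.mul_re, Complex.ofReal_re,
    Complex.ofReal_im, mul_one, mul_zero, sub_zero] at hre
  rw [eq_div_iff (by positivity)]
  push_cast at hre
  linear_combination hre
end

section
/- Let ρ be a density matrix on ℂ^d, M a Hermitian d×d complex matrix, e₀ a fixed unit vector in ℂ^d, and h ≥ 2 an integer. Then |d · ∫_{U(d)} ⟨U e₀, M (U e₀)⟩^h · ⟨U e₀, ρ (U e₀)⟩ dμ(U)| ≤ ((h+1)! / ((d+1)(d+2)⋯(d+h))) · (Tr(M²) + (Tr M)²)^{h/2}, where μ is Haar measure on the unitary group U(d). In particular, the h-th moment of ⟨v, M v⟩ under the uniform-POVM outcome distribution of ρ is at most ((h+1)!/(d+1)^h)·(Tr(M²) + (Tr M)²)^{h/2} in absolute value (hypercontractivity of the uniform POVM). -/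
open Matrix MeasureTheory
open scoped BigOperators ComplexOrder

namespace UniformPOVM

open scoped PowerSeries

section Homogeneous

variable {ι : Type*} [Fintype ι]

/-- The geometric power series `∑ (c z) ^ n`. -/
noncomputable def geom (c : ℝ) : ℝ⟦X⟧ := PowerSeries.mk fun n => c ^ n

lemma coeff_geom (c : ℝ) (n : ℕ) : PowerSeries.coeff n (geom c) = c ^ n := by
  simp [geom]

lemma coeff_geom_sq (c : ℝ) (n : ℕ) :
    PowerSeries.coeff n (geom c * geom c) = (n + 1) * c ^ n := by
  rw [PowerSeries.coeff_mul, Finset.sum_congr rfl (g := fun _ => c ^ n)]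
  · simp
  · intro p hp
    rw [coeff_geom, coeff_geom, ← pow_add, Finset.HasAntidiagonal.mem_antidiagonal.mp hp]

lemma derivative_geom (c : ℝ) :
    PowerSeries.derivative ℝ (geom c) = PowerSeries.C c * (geom c * geom c) := by
  ext n
  rw [PowerSeries.coeff_derivative, PowerSeries.coeff_C_mul,
    coeff_geom_sq, coeff_geom]
  ring

/-- Generating series of the complete homogeneous symmetric polynomials. -/
noncomputable def homSeries (c : ι → ℝ) : ℝ⟦X⟧ := ∏ i, geom (c i)

lemma derivative_homSeries (c : ι → ℝ) :
    PowerSeries.derivative ℝ (homSeries c) =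
      homSeries c * ∑ i, PowerSeries.C (c i) * geom (c i) := by
  classical
  rw [homSeries]
  induction (Finset.univ : Finset ι) using Finset.induction_on with
  | empty => simp
  | insert i t hi ih =>
    rw [Finset.prod_insert hi, Finset.sum_insert hi, Derivation.leibniz, ih, derivative_geom,
      smul_eq_mul, smul_eq_mul]
    ring

lemma newton_homSeries (c : ι → ℝ) (m : ℕ) :
    (m + 1) * PowerSeries.coeff (m + 1) (homSeries c) =
      ∑ p ∈ Finset.HasAntidiagonal.antidiagonal m,
        PowerSeries.coeff p.1 (homSeries c) * ∑ i, c i ^ (p.2 + 1) := by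
  have := congrArg (PowerSeries.coeff m) (derivative_homSeries c)
  rw [PowerSeries.coeff_derivative, PowerSeries.coeff_mul] at this
  rw [mul_comm, this]
  refine Finset.sum_congr rfl fun p _ => ?_
  rw [map_sum]
  congr 1
  refine Finset.sum_congr rfl fun i _ => ?_
  rw [PowerSeries.coeff_C_mul, coeff_geom, pow_succ']

lemma abs_le_of_sum_sq_le {c : ι → ℝ} {s : ℝ} (hs : 0 ≤ s) (h2 : ∑ i, c i ^ 2 ≤ s ^ 2) (j : ι) :
    |c j| ≤ s := by
  refine abs_le_of_sq_le_sq ?_ hs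
  exact (Finset.single_le_sum (f := fun i => c i ^ 2) (fun i _ => sq_nonneg _)
    (Finset.mem_univ j)).trans h2

lemma abs_sum_pow_le {c : ι → ℝ} {s : ℝ} (hs : 0 ≤ s) (h1 : |∑ i, c i| ≤ s)
    (h2 : ∑ i, c i ^ 2 ≤ s ^ 2) (k : ℕ) : |∑ i, c i ^ (k + 1)| ≤ s ^ (k + 1) := by
  rcases k with _ | k
  · simpa using h1
  calc |∑ i, c i ^ (k + 1 + 1)| ≤ ∑ i, |c i ^ (k + 1 + 1)| := Finset.abs_sum_le_sum_abs _ _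
    _ ≤ ∑ i, s ^ k * c i ^ 2 := by
        refine Finset.sum_le_sum fun i _ => ?_
        rw [show k + 1 + 1 = k + 2 from rfl, pow_add, abs_mul, abs_pow, abs_sq]
        gcongr
        exact abs_le_of_sum_sq_le hs h2 i
    _ = s ^ k * ∑ i, c i ^ 2 := by rw [Finset.mul_sum]
    _ ≤ s ^ k * s ^ 2 := by gcongr
    _ = s ^ (k + 1 + 1) := by rw [← pow_add]

lemma abs_coeff_homSeries_le {c : ι → ℝ} {s : ℝ} (hs : 0 ≤ s) (h1 : |∑ i, c i| ≤ s)
    (h2 : ∑ i, c i ^ 2 ≤ s ^ 2) (m : ℕ) : |PowerSeries.coeff m (homSeries c)| ≤ s ^ m := by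
  induction m using Nat.strong_induction_on with
  | _ m ih =>
    rcases m with _ | m
    · simp [homSeries, map_prod, geom]
    have hpos : (0 : ℝ) < m + 1 := by positivity
    refine le_of_mul_le_mul_left ?_ hpos
    rw [← abs_of_pos hpos, ← abs_mul, newton_homSeries, abs_of_pos hpos]
    calc _ ≤ ∑ p ∈ Finset.HasAntidiagonal.antidiagonal m,
          |PowerSeries.coeff p.1 (homSeries c) * ∑ i, c i ^ (p.2 + 1)| :=
          Finset.abs_sum_le_sum_abs _ _
      _ ≤ ∑ p ∈ Finset.HasAntidiagonal.antidiagonal m, s ^ (m + 1) := by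
          refine Finset.sum_le_sum fun p hp => ?_
          have hp' := Finset.HasAntidiagonal.mem_antidiagonal.mp hp
          rw [abs_mul, ← hp', add_assoc, pow_add]
          gcongr
          · exact ih _ (by omega)
          · exact abs_sum_pow_le hs h1 h2 _
      _ = (m + 1) * s ^ (m + 1) := by simp

lemma abs_coeff_homSeries_mul_geom_le {c : ι → ℝ} {s : ℝ} (hs : 0 ≤ s) (h1 : |∑ i, c i| ≤ s)
    (h2 : ∑ i, c i ^ 2 ≤ s ^ 2) (m : ℕ) (j : ι) :
    |PowerSeries.coeff m (homSeries c * geom (c j))| ≤ (m + 1) * s ^ m := by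
  rw [PowerSeries.coeff_mul]
  calc _ ≤ ∑ p ∈ Finset.HasAntidiagonal.antidiagonal m,
        |PowerSeries.coeff p.1 (homSeries c) * PowerSeries.coeff p.2 (geom (c j))| :=
        Finset.abs_sum_le_sum_abs _ _
    _ ≤ ∑ p ∈ Finset.HasAntidiagonal.antidiagonal m, s ^ m := by
        refine Finset.sum_le_sum fun p hp => ?_
        rw [abs_mul, ← Finset.HasAntidiagonal.mem_antidiagonal.mp hp, pow_add, coeff_geom, abs_pow]
        gcongr
        · exact abs_coeff_homSeries_le hs h1 h2 _
        · exact abs_le_of_sum_sq_le hs h2 j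
    _ = (m + 1) * s ^ m := by simp

lemma coeff_homSeries_one_mul_geom (m : ℕ) :
    PowerSeries.coeff m (homSeries (fun _ : ι => (1 : ℝ)) * geom 1) =
      (Nat.choose (Fintype.card ι + m) (Fintype.card ι) : ℝ) := by
  have h1 : geom 1 = PowerSeries.mk 1 := by ext n; simp [geom]
  rw [homSeries, Finset.prod_const, ← pow_succ, h1, Finset.card_univ,
    PowerSeries.mk_one_pow_eq_mk_choose_add, PowerSeries.coeff_mk]

lemma factorial_mul_choose_eq_prod (d h : ℕ) :
    (h.factorial : ℝ) * (Nat.choose (d + h) d : ℝ) = ∏ j ∈ Finset.Icc 1 h, ((d : ℝ) + j) := by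
  induction h with
  | zero => simp
  | succ h ih =>
    rw [Finset.prod_Icc_succ_top (by omega), ← ih]
    have := Nat.add_one_mul_choose_eq (d + h) h
    rw [Nat.choose_symm_add, Nat.choose_symm_add, Nat.factorial_succ]
    have h2 : ((d + h + 1 : ℕ) : ℝ) * ((d + h).choose h : ℕ)
        = ((d + h + 1).choose (h + 1) : ℕ) * ((h + 1 : ℕ) : ℝ) := by exact_mod_cast this
    push_cast at h2 ⊢
    rw [← add_assoc]
    linear_combination -(h.factorial : ℝ) * h2

/-- The coefficients of a finite product of power series, as a sum over `piAntidiag`. -/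
lemma coeff_prod_eq_sum_piAntidiag [DecidableEq ι] (f : ι → ℝ⟦X⟧) (m : ℕ) :
    PowerSeries.coeff m (∏ i, f i) =
      ∑ a ∈ Finset.univ.piAntidiag m, ∏ i, PowerSeries.coeff (a i) (f i) := by
  rw [PowerSeries.coeff_prod]
  refine Finset.sum_bij' (fun a _ => ⇑a) (fun a _ => Finsupp.equivFunOnFinite.symm a)
    ?_ ?_ ?_ ?_ ?_ <;> simp [Finset.mem_finsuppAntidiag]

end Homogeneous

section Gaussian

variable {ι : Type*} [Fintype ι]

/-- The squared Euclidean norm of a complex vector. -/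
noncomputable def sqNorm (x : ι → ℂ) : ℝ := ∑ i, ‖x i‖ ^ 2

lemma integral_normSq_pow_mul_exp (a : ℕ) :
    ∫ z : ℂ, (‖z‖ ^ 2) ^ a * Real.exp (-‖z‖ ^ 2) = Real.pi * a.factorial := by
  have := Complex.integral_rpow_mul_exp_neg_rpow (p := 2) (q := 2 * a) (by norm_num)
    (by have : (0 : ℝ) ≤ a := by positivity
        linarith)
  rw [show ((2 : ℝ) * a + 2) / 2 = a + 1 by ring, Real.Gamma_nat_eq_factorial] at this
  rw [show Real.pi * (a.factorial : ℝ) = 2 * Real.pi / 2 * a.factorial by ring, ← this]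
  congr 1
  ext z
  rw [Real.rpow_two, ← pow_mul]
  congr 1
  rw [← Real.rpow_natCast]
  push_cast
  rfl

lemma integrable_normSq_pow_mul_exp (a : ℕ) :
    Integrable fun z : ℂ => (‖z‖ ^ 2) ^ a * Real.exp (-‖z‖ ^ 2) := by
  refine not_imp_comm.1 integral_undef ?_
  rw [integral_normSq_pow_mul_exp]
  positivity

lemma exp_neg_sqNorm (x : ι → ℂ) : Real.exp (-sqNorm x) = ∏ i, Real.exp (-‖x i‖ ^ 2) := by
  rw [← Real.exp_sum, sqNorm, Finset.sum_neg_distrib]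

lemma moment_eq_sum [DecidableEq ι] (c : ι → ℝ) (h : ℕ) (j : ι) (x : ι → ℂ) :
    (∑ i, c i * ‖x i‖ ^ 2) ^ h * ‖x j‖ ^ 2 * Real.exp (-sqNorm x) =
      ∑ a ∈ Finset.univ.piAntidiag h, (Nat.multinomial Finset.univ a * ∏ i, c i ^ a i) *
        ∏ i, ((‖x i‖ ^ 2) ^ (a i + if i = j then 1 else 0) * Real.exp (-‖x i‖ ^ 2)) := by
  rw [Finset.sum_pow_eq_sum_piAntidiag, Finset.sum_mul, Finset.sum_mul]
  refine Finset.sum_congr rfl fun a _ => ?_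
  rw [exp_neg_sqNorm, Finset.prod_mul_distrib]
  simp only [mul_pow, pow_add, Finset.prod_mul_distrib]
  have : ∏ i, (‖x i‖ ^ 2) ^ (if i = j then 1 else 0) = ‖x j‖ ^ 2 := by
    rw [Finset.prod_eq_single j] <;> simp +contextual
  rw [this]
  ring

lemma integrable_moment (c : ι → ℝ) (h : ℕ) (j : ι) :
    Integrable fun x : ι → ℂ =>
      (∑ i, c i * ‖x i‖ ^ 2) ^ h * ‖x j‖ ^ 2 * Real.exp (-sqNorm x) := by
  classical
  simp only [moment_eq_sum]
  refine integrable_finsetSum _ fun a _ => Integrable.const_mul ?_ _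
  exact Integrable.fintype_prod (f := fun i (z : ℂ) =>
    (‖z‖ ^ 2) ^ (a i + if i = j then 1 else 0) * Real.exp (-‖z‖ ^ 2))
    fun i => integrable_normSq_pow_mul_exp _

lemma integral_moment (c : ι → ℝ) (h : ℕ) (j : ι) :
    ∫ x : ι → ℂ, (∑ i, c i * ‖x i‖ ^ 2) ^ h * ‖x j‖ ^ 2 * Real.exp (-sqNorm x) =
      Real.pi ^ Fintype.card ι *
        (h.factorial * PowerSeries.coeff h (homSeries c * geom (c j))) := by
  classical
  simp only [moment_eq_sum]
  rw [integral_finsetSum]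
  · have hprod : homSeries c * geom (c j) =
        ∏ i, geom (c i) * (if i = j then geom (c i) else 1) := by
      rw [Finset.prod_mul_distrib, Finset.prod_ite_eq' Finset.univ j]
      simp [homSeries]
    rw [hprod, coeff_prod_eq_sum_piAntidiag, Finset.mul_sum, Finset.mul_sum]
    refine Finset.sum_congr rfl fun a ha => ?_
    rw [integral_const_mul, integral_fintype_prod_volume_eq_prod (fun i (z : ℂ) =>
      (‖z‖ ^ 2) ^ (a i + if i = j then 1 else 0) * Real.exp (-‖z‖ ^ 2))]
    simp only [integral_normSq_pow_mul_exp]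
    have hsum : ∑ i, a i = h := (Finset.mem_piAntidiag.mp ha).1
    have hm : (∏ i, ((a i).factorial : ℝ)) * Nat.multinomial Finset.univ a = h.factorial := by
      rw [← hsum]
      exact_mod_cast Nat.multinomial_spec Finset.univ a
    have hcoef : ∀ i, PowerSeries.coeff (a i) (geom (c i) * (if i = j then geom (c i) else 1)) *
        (a i).factorial = c i ^ a i * ((a i + if i = j then 1 else 0).factorial : ℕ) := by
      intro i
      split_ifs
      · rw [coeff_geom_sq, Nat.factorial_succ]
        push_cast
        ring
      · rw [mul_one, coeff_geom, add_zero]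
    rw [← hm, Finset.prod_mul_distrib, Finset.prod_const, Finset.card_univ]
    have := Finset.prod_congr (rfl : Finset.univ = Finset.univ) fun i _ => hcoef i
    rw [Finset.prod_mul_distrib, Finset.prod_mul_distrib] at this
    linear_combination -(Real.pi ^ Fintype.card ι * Nat.multinomial Finset.univ a) * this
  · intro a _
    refine Integrable.const_mul ?_ _
    exact Integrable.fintype_prod (f := fun i (z : ℂ) =>
      (‖z‖ ^ 2) ^ (a i + if i = j then 1 else 0) * Real.exp (-‖z‖ ^ 2))
      fun i => integrable_normSq_pow_mul_exp _

lemma sqNorm_nonneg (x : ι → ℂ) : 0 ≤ sqNorm x := Finset.sum_nonneg fun _ _ => by positivity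

lemma sqNorm_pow_succ_mul_exp (n : ℕ) (x : ι → ℂ) :
    sqNorm x ^ (n + 1) * Real.exp (-sqNorm x) =
      ∑ j, (∑ i, (1 : ℝ) * ‖x i‖ ^ 2) ^ n * ‖x j‖ ^ 2 * Real.exp (-sqNorm x) := by
  rw [← Finset.sum_mul, ← Finset.mul_sum]
  simp [sqNorm, pow_succ]

lemma integrable_sqNorm_pow (n : ℕ) :
    Integrable fun x : ι → ℂ => sqNorm x ^ (n + 1) * Real.exp (-sqNorm x) := by
  simp only [sqNorm_pow_succ_mul_exp]
  exact integrable_finsetSum _ fun j _ => integrable_moment (fun _ => 1) n j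

lemma integral_sqNorm_pow (n : ℕ) :
    ∫ x : ι → ℂ, sqNorm x ^ (n + 1) * Real.exp (-sqNorm x) =
      Real.pi ^ Fintype.card ι * Fintype.card ι *
        ∏ j ∈ Finset.Icc 1 n, ((Fintype.card ι : ℝ) + j) := by
  simp only [sqNorm_pow_succ_mul_exp]
  rw [integral_finsetSum _ fun j _ => integrable_moment (fun _ => 1) n j]
  simp only [integral_moment (fun _ => 1), coeff_homSeries_one_mul_geom,
    factorial_mul_choose_eq_prod]
  rw [Finset.sum_const, Finset.card_univ, nsmul_eq_mul]
  ring

end Gaussian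

section Unitary

variable {ι : Type*} [Fintype ι]

/-- The real part of the sesquilinear form `⟨x, A x⟩`. -/
noncomputable def quadForm (A : Matrix ι ι ℂ) (x : ι → ℂ) : ℝ := (star x ⬝ᵥ A *ᵥ x).re

lemma quadForm_mulVec (A W : Matrix ι ι ℂ) (x : ι → ℂ) :
    quadForm A (W *ᵥ x) = quadForm (Wᴴ * A * W) x := by
  simp only [quadForm, star_mulVec, ← dotProduct_mulVec, mulVec_mulVec, Matrix.mul_assoc]

lemma star_dotProduct_self_eq (x : ι → ℂ) : star x ⬝ᵥ x = (sqNorm x : ℂ) := by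
  simp [dotProduct, sqNorm, Complex.conj_mul']

@[fun_prop]
lemma continuous_sqNorm : Continuous (sqNorm : (ι → ℂ) → ℝ) := by
  unfold sqNorm
  fun_prop

@[fun_prop]
lemma continuous_quadForm (A : Matrix ι ι ℂ) : Continuous (quadForm A) := by
  unfold quadForm
  exact Complex.continuous_re.comp
    (continuous_star.dotProduct (continuous_const.matrix_mulVec continuous_id))

lemma norm_le_sqrt_sqNorm (x : ι → ℂ) (i : ι) : ‖x i‖ ≤ Real.sqrt (sqNorm x) := by
  refine Real.le_sqrt_of_sq_le ?_
  exact Finset.single_le_sum (f := fun i => ‖x i‖ ^ 2) (fun i _ => by positivity)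
    (Finset.mem_univ i)

lemma norm_mul_norm_le_sqNorm (x : ι → ℂ) (i j : ι) : ‖x i‖ * ‖x j‖ ≤ sqNorm x := by
  rw [← Real.mul_self_sqrt (sqNorm_nonneg x)]
  gcongr <;> exact norm_le_sqrt_sqNorm x _

lemma quadForm_eq_sum (A : Matrix ι ι ℂ) (x : ι → ℂ) :
    quadForm A x = ∑ i, ∑ j, (star (x i) * A i j * x j).re := by
  simp [quadForm, dotProduct, mulVec, Finset.mul_sum, Complex.re_sum, mul_assoc]

lemma abs_re_entry_le (A : Matrix ι ι ℂ) (x : ι → ℂ) (i j : ι) :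
    |(star (x i) * A i j * x j).re| ≤ ‖A i j‖ * sqNorm x := by
  refine (Complex.abs_re_le_norm _).trans ?_
  rw [norm_mul, norm_mul, norm_star, mul_right_comm, mul_comm]
  gcongr
  exact norm_mul_norm_le_sqNorm x i j

lemma exists_abs_quadForm_le (A : Matrix ι ι ℂ) :
    ∃ C, 0 ≤ C ∧ ∀ x, |quadForm A x| ≤ C * sqNorm x := by
  refine ⟨∑ i, ∑ j, ‖A i j‖, by positivity, fun x => ?_⟩
  rw [quadForm_eq_sum, Finset.sum_mul]
  refine (Finset.abs_sum_le_sum_abs _ _).trans (Finset.sum_le_sum fun i _ => ?_)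
  rw [Finset.sum_mul]
  exact (Finset.abs_sum_le_sum_abs _ _).trans
    (Finset.sum_le_sum fun j _ => abs_re_entry_le A x i j)

lemma quadForm_smul (A : Matrix ι ι ℂ) (r : ℝ) (x : ι → ℂ) :
    quadForm A ((r : ℂ) • x) = r ^ 2 * quadForm A x := by
  simp only [quadForm, star_smul, mulVec_smul, smul_dotProduct, dotProduct_smul, smul_eq_mul]
  rw [← mul_assoc, RCLike.star_def, Complex.conj_ofReal, ← Complex.ofReal_mul,
    Complex.re_ofReal_mul, sq]

lemma integrable_mul_exp {f : (ι → ℂ) → ℝ} {C : ℝ} {n : ℕ} (hf : Continuous f)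
    (hC : ∀ x, |f x| ≤ C * sqNorm x ^ (n + 1)) :
    Integrable fun x => f x * Real.exp (-sqNorm x) := by
  refine Integrable.mono' ((integrable_sqNorm_pow n).const_mul C)
    (by fun_prop : Continuous _).aestronglyMeasurable (.of_forall fun x => ?_)
  rw [norm_mul, Real.norm_eq_abs, Real.norm_eq_abs, Real.abs_exp, ← mul_assoc]
  gcongr
  exact hC x

variable [DecidableEq ι]

lemma sqNorm_eq_quadForm_one (x : ι → ℂ) : sqNorm x = quadForm 1 x := by
  rw [quadForm, one_mulVec, star_dotProduct_self_eq, Complex.ofReal_re]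

lemma sqNorm_mulVec (W : unitaryGroup ι ℂ) (x : ι → ℂ) :
    sqNorm ((W : Matrix ι ι ℂ) *ᵥ x) = sqNorm x := by
  rw [sqNorm_eq_quadForm_one, quadForm_mulVec, sqNorm_eq_quadForm_one, Matrix.mul_one,
    ← star_eq_conjTranspose, UnitaryGroup.star_mul_self]

lemma sqNorm_star_mulVec (W : unitaryGroup ι ℂ) (x : ι → ℂ) :
    sqNorm ((star W : Matrix ι ι ℂ) *ᵥ x) = sqNorm x :=
  sqNorm_mulVec (star W) x

lemma measurePreserving_mulVec (W : unitaryGroup ι ℂ) :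
    MeasurePreserving (fun x : ι → ℂ => (W : Matrix ι ι ℂ) *ᵥ x) := by
  have hcont : Continuous (fun x : ι → ℂ => (W : Matrix ι ι ℂ) *ᵥ x) :=
    continuous_const.matrix_mulVec continuous_id
  refine ⟨hcont.measurable, ?_⟩
  have hdet : ‖(W : Matrix ι ι ℂ).det‖ = 1 := by
    have := (Unitary.mem_iff.mp (det_of_mem_unitary W.2)).1
    rw [RCLike.star_def, Complex.conj_mul'] at this
    have h2 : ‖(W : Matrix ι ι ℂ).det‖ ^ 2 = 1 := by exact_mod_cast this
    exact (pow_eq_one_iff_of_nonneg (norm_nonneg _) two_ne_zero).mp h2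
  have hreal : LinearMap.det ((Matrix.toLin' (W : Matrix ι ι ℂ)).restrictScalars ℝ) = 1 := by
    rw [LinearMap.det_restrictScalars, Algebra.norm_complex_eq, LinearMap.det_toLin']
    exact (Complex.normSq_eq_norm_sq _).trans (by rw [hdet, one_pow])
  have := Measure.map_linearMap_addHaar_eq_smul_addHaar (volume : Measure (ι → ℂ))
    (f := (Matrix.toLin' (W : Matrix ι ι ℂ)).restrictScalars ℝ) (by rw [hreal]; norm_num)
  rw [hreal, inv_one, abs_one, ENNReal.ofReal_one, one_smul] at this
  exact this

lemma measurableEmbedding_mulVec (W : unitaryGroup ι ℂ) :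
    MeasurableEmbedding (fun x : ι → ℂ => (W : Matrix ι ι ℂ) *ᵥ x) := by
  have hcont : Continuous (fun x : ι → ℂ => (W : Matrix ι ι ℂ) *ᵥ x) :=
    continuous_const.matrix_mulVec continuous_id
  refine hcont.measurableEmbedding (Function.LeftInverse.injective
    (g := fun x => (star W : Matrix ι ι ℂ) *ᵥ x) fun x => ?_)
  simp [mulVec_mulVec]

lemma integral_comp_mulVec (W : unitaryGroup ι ℂ) (F : (ι → ℂ) → ℝ) :
    ∫ x, F ((W : Matrix ι ι ℂ) *ᵥ x) = ∫ x, F x :=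
  (measurePreserving_mulVec W).integral_comp (measurableEmbedding_mulVec W) F

lemma exists_unitary_single (k : ι) (x : ι → ℂ) (hx : sqNorm x = 1) :
    ∃ W : unitaryGroup ι ℂ, (W : Matrix ι ι ℂ) *ᵥ Pi.single k 1 = x := by
  have hv : Orthonormal ℂ
      (({k} : Set ι).domRestrict fun _ : ι => (WithLp.toLp 2 x : EuclideanSpace ℂ ι)) := by
    refine ⟨fun _ => ?_, fun i j hij => (hij (Subsingleton.elim i j)).elim⟩
    simpa [EuclideanSpace.norm_eq, sqNorm] using hx
  obtain ⟨b, hb⟩ := hv.exists_orthonormalBasis_extension_of_card_eq (by simp)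
  refine ⟨⟨Matrix.of fun i j => b j i, ?_⟩, ?_⟩
  · rw [mem_unitaryGroup_iff']
    ext i j
    have := orthonormal_iff_ite.mp b.orthonormal i j
    simp only [PiLp.inner_apply, RCLike.inner_apply] at this
    simp only [Matrix.mul_apply, star_apply, of_apply, one_apply, ← this]
    exact Finset.sum_congr rfl fun _ _ => mul_comm _ _
  · ext i
    simp [hb k rfl]

lemma exists_unitary_mulVec_eq {e x : ι → ℂ} (he : sqNorm e = 1) (hx : sqNorm x = 1) :
    ∃ W : unitaryGroup ι ℂ, (W : Matrix ι ι ℂ) *ᵥ e = x := by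
  have hne : Nonempty ι := by
    by_contra h
    rw [not_nonempty_iff] at h
    simp [sqNorm] at he
  obtain ⟨k⟩ := hne
  obtain ⟨W, hW⟩ := exists_unitary_single k x hx
  obtain ⟨V, hV⟩ := exists_unitary_single k e he
  refine ⟨W * star V, ?_⟩
  rw [← hV, ← hW, mulVec_mulVec, ← UnitaryGroup.mul_val, mul_assoc, Unitary.star_mul_self,
    mul_one]

lemma exists_smul_unitary_mulVec {e : ι → ℂ} (he : sqNorm e = 1) (x : ι → ℂ) :
    ∃ W : unitaryGroup ι ℂ,
      x = ((Real.sqrt (sqNorm x) : ℝ) : ℂ) • ((W : Matrix ι ι ℂ) *ᵥ e) := by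
  rcases (sqNorm_nonneg x).eq_or_lt with h0 | hpos
  · refine ⟨1, ?_⟩
    have : x = 0 := by
      ext i
      have := norm_le_sqrt_sqNorm x i
      rw [← h0, Real.sqrt_zero] at this
      simpa using this
    rw [← h0, Real.sqrt_zero, this]
    simp
  · set r := Real.sqrt (sqNorm x) with hr
    have hrpos : 0 < r := Real.sqrt_pos.mpr hpos
    have hsq : r ^ 2 = sqNorm x := Real.sq_sqrt hpos.le
    obtain ⟨W, hW⟩ := exists_unitary_mulVec_eq he (x := ((r⁻¹ : ℝ) : ℂ) • x) (by
      rw [sqNorm_eq_quadForm_one, quadForm_smul, ← sqNorm_eq_quadForm_one, ← hsq]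
      field_simp)
    refine ⟨W, ?_⟩
    rw [hW, smul_smul, ← Complex.ofReal_mul, mul_inv_cancel₀ hrpos.ne', Complex.ofReal_one,
      one_smul]

section Haar

instance : SecondCountableTopology (unitaryGroup ι ℂ) :=
  haveI : SecondCountableTopology (Matrix ι ι ℂ) :=
    inferInstanceAs (SecondCountableTopology (ι → ι → ℂ))
  TopologicalSpace.Subtype.secondCountableTopology _

lemma continuous_star_mulVec {X : Type*} [TopologicalSpace X] {g : X → unitaryGroup ι ℂ}
    {k : X → ι → ℂ} (hg : Continuous g) (hk : Continuous k) :
    Continuous fun p => (star (g p) : Matrix ι ι ℂ) *ᵥ k p := by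
  have : Continuous fun p => (star (g p) : Matrix ι ι ℂ) :=
    (continuous_subtype_val.comp hg).star
  exact this.matrix_mulVec hk

lemma continuous_coe_mulVec (x : ι → ℂ) :
    Continuous fun U : unitaryGroup ι ℂ => (U : Matrix ι ι ℂ) *ᵥ x :=
  continuous_subtype_val.matrix_mulVec continuous_const

variable [MeasurableSpace (unitaryGroup ι ℂ)] [BorelSpace (unitaryGroup ι ℂ)]
  {μ : Measure (unitaryGroup ι ℂ)}

lemma integral_left_mul (hinv : ∀ V : unitaryGroup ι ℂ, μ.map (fun U => V * U) = μ)
    {F : unitaryGroup ι ℂ → ℝ} (hF : Continuous F) (V : unitaryGroup ι ℂ) :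
    ∫ U, F (V * U) ∂μ = ∫ U, F U ∂μ := by
  have hc : Continuous fun U : unitaryGroup ι ℂ => V * U := by fun_prop
  conv_rhs => rw [← hinv V]
  rw [integral_map hc.measurable.aemeasurable hF.aestronglyMeasurable]

lemma integral_star_mulVec_mulVec
    (hinv : ∀ V : unitaryGroup ι ℂ, μ.map (fun U => V * U) = μ)
    {f : (ι → ℂ) → ℝ} (hf : Continuous f) (W : unitaryGroup ι ℂ) (x : ι → ℂ) :
    ∫ V : unitaryGroup ι ℂ, f ((star V : Matrix ι ι ℂ) *ᵥ ((W : Matrix ι ι ℂ) *ᵥ x)) ∂μ =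
      ∫ V : unitaryGroup ι ℂ, f ((star V : Matrix ι ι ℂ) *ᵥ x) ∂μ := by
  have hF : Continuous fun V : unitaryGroup ι ℂ =>
      f ((star V : Matrix ι ι ℂ) *ᵥ ((W : Matrix ι ι ℂ) *ᵥ x)) :=
    hf.comp (continuous_star_mulVec continuous_id continuous_const)
  rw [← integral_left_mul hinv hF W]
  refine integral_congr_ae (.of_forall fun V => ?_)
  simp [mulVec_mulVec, Matrix.mul_assoc]

variable [IsProbabilityMeasure μ]

/-- Averaging over `U⁻¹` and over `U` agree on a unit vector. -/
lemma integral_star_mulVec_eq (hinv : ∀ V : unitaryGroup ι ℂ, μ.map (fun U => V * U) = μ)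
    {f : (ι → ℂ) → ℝ} {C : ℝ} {n : ℕ} (hf : Continuous f)
    (hC : ∀ x, |f x| ≤ C * sqNorm x ^ n) {e : ι → ℂ} (he : sqNorm e = 1) :
    ∫ V : unitaryGroup ι ℂ, f ((star V : Matrix ι ι ℂ) *ᵥ e) ∂μ =
      ∫ U : unitaryGroup ι ℂ, f ((U : Matrix ι ι ℂ) *ᵥ e) ∂μ := by
  have hF : Continuous fun p : unitaryGroup ι ℂ × unitaryGroup ι ℂ =>
      f ((star p.2 : Matrix ι ι ℂ) *ᵥ ((p.1 : Matrix ι ι ℂ) *ᵥ e)) :=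
    hf.comp (continuous_star_mulVec continuous_snd
      ((continuous_coe_mulVec e).comp continuous_fst))
  have hint : Integrable (fun p : unitaryGroup ι ℂ × unitaryGroup ι ℂ =>
      f ((star p.2 : Matrix ι ι ℂ) *ᵥ ((p.1 : Matrix ι ι ℂ) *ᵥ e))) (μ.prod μ) := by
    refine Integrable.of_bound hF.aestronglyMeasurable C (.of_forall fun p => ?_)
    have := hC ((star p.2 : Matrix ι ι ℂ) *ᵥ ((p.1 : Matrix ι ι ℂ) *ᵥ e))
    rwa [sqNorm_star_mulVec, sqNorm_mulVec, he, one_pow, mul_one] at this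
  calc ∫ V : unitaryGroup ι ℂ, f ((star V : Matrix ι ι ℂ) *ᵥ e) ∂μ
      = ∫ U : unitaryGroup ι ℂ, ∫ V : unitaryGroup ι ℂ,
          f ((star V : Matrix ι ι ℂ) *ᵥ ((U : Matrix ι ι ℂ) *ᵥ e)) ∂μ ∂μ := by
        simp_rw [integral_star_mulVec_mulVec hinv hf]
        simp
    _ = ∫ V : unitaryGroup ι ℂ, ∫ U : unitaryGroup ι ℂ,
          f ((star V : Matrix ι ι ℂ) *ᵥ ((U : Matrix ι ι ℂ) *ᵥ e)) ∂μ ∂μ :=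
        integral_integral_swap hint
    _ = ∫ V : unitaryGroup ι ℂ, ∫ U : unitaryGroup ι ℂ, f ((U : Matrix ι ι ℂ) *ᵥ e) ∂μ ∂μ := by
        refine integral_congr_ae (.of_forall fun V => ?_)
        have := integral_left_mul hinv (hf.comp (continuous_coe_mulVec e)) (star V)
        simpa [mulVec_mulVec] using this
    _ = _ := by simp

/-- The Haar average of a homogeneous function over the orbit of a unit vector, expressed through
Gaussian integrals. -/
theorem haar_integral_mul_gaussian
    (hinv : ∀ V : unitaryGroup ι ℂ, μ.map (fun U => V * U) = μ)
    {f : (ι → ℂ) → ℝ} {C : ℝ} {n : ℕ} (hf : Continuous f)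
    (hC : ∀ x, |f x| ≤ C * sqNorm x ^ (n + 1))
    (hhom : ∀ (r : ℝ) x, f ((r : ℂ) • x) = (r ^ 2) ^ (n + 1) * f x)
    {e : ι → ℂ} (he : sqNorm e = 1) :
    (∫ U : unitaryGroup ι ℂ, f ((U : Matrix ι ι ℂ) *ᵥ e) ∂μ) *
        ∫ x : ι → ℂ, sqNorm x ^ (n + 1) * Real.exp (-sqNorm x) =
      ∫ x, f x * Real.exp (-sqNorm x) := by
  have hpoint : ∀ x : ι → ℂ,
      ∫ V : unitaryGroup ι ℂ, f ((star V : Matrix ι ι ℂ) *ᵥ x) * Real.exp (-sqNorm x) ∂μ =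
      (∫ U : unitaryGroup ι ℂ, f ((U : Matrix ι ι ℂ) *ᵥ e) ∂μ) *
        (sqNorm x ^ (n + 1) * Real.exp (-sqNorm x)) := by
    intro x
    rw [integral_mul_const, ← mul_assoc]
    congr 1
    obtain ⟨W, hW⟩ := exists_smul_unitary_mulVec he x
    conv_lhs => rw [hW]
    simp only [mulVec_smul, hhom, Real.sq_sqrt (sqNorm_nonneg x)]
    rw [integral_const_mul, integral_star_mulVec_mulVec hinv hf,
      integral_star_mulVec_eq hinv hf hC he, mul_comm]
  have hint : Integrable (fun p : unitaryGroup ι ℂ × (ι → ℂ) =>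
      f ((star p.1 : Matrix ι ι ℂ) *ᵥ p.2) * Real.exp (-sqNorm p.2)) (μ.prod volume) := by
    have hdom := ((integrable_sqNorm_pow (ι := ι) n).const_mul C).comp_snd μ
    refine hdom.mono' ?_ (.of_forall fun p => ?_)
    · refine Continuous.aestronglyMeasurable ?_
      exact (hf.comp (continuous_star_mulVec continuous_fst continuous_snd)).mul
        (Real.continuous_exp.comp (continuous_sqNorm.comp continuous_snd).neg)
    · have := hC ((star p.1 : Matrix ι ι ℂ) *ᵥ p.2)
      rw [sqNorm_star_mulVec] at this
      rw [norm_mul, Real.norm_eq_abs, Real.norm_eq_abs, Real.abs_exp, ← mul_assoc]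
      gcongr
  calc _ = ∫ x : ι → ℂ, ∫ V : unitaryGroup ι ℂ,
        f ((star V : Matrix ι ι ℂ) *ᵥ x) * Real.exp (-sqNorm x) ∂μ := by
        simp only [hpoint]
        rw [integral_const_mul]
    _ = ∫ V : unitaryGroup ι ℂ, (∫ x : ι → ℂ,
        f ((star V : Matrix ι ι ℂ) *ᵥ x) * Real.exp (-sqNorm x)) ∂μ :=
        (integral_integral_swap hint).symm
    _ = ∫ V : unitaryGroup ι ℂ, (∫ x, f x * Real.exp (-sqNorm x)) ∂μ := by
        refine integral_congr_ae (.of_forall fun V => ?_)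
        have := integral_comp_mulVec (star V) fun x => f x * Real.exp (-sqNorm x)
        simp only [sqNorm_mulVec] at this
        exact this
    _ = _ := by simp

end Haar

end Unitary

section Diagonalization

variable {ι : Type*} [Fintype ι]

lemma sum_re_diag_mul_coeff_le {c : ι → ℝ} {s : ℝ} (hs : 0 ≤ s) (h1 : |∑ i, c i| ≤ s)
    (h2 : ∑ i, c i ^ 2 ≤ s ^ 2) (h : ℕ) {A : Matrix ι ι ℂ} (hA : A.PosSemidef)
    (htr : A.trace = 1) :
    |∑ j, (A j j).re * PowerSeries.coeff h (homSeries c * geom (c j))| ≤ (h + 1) * s ^ h := by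
  calc _ ≤ ∑ j, |(A j j).re * PowerSeries.coeff h (homSeries c * geom (c j))| :=
        Finset.abs_sum_le_sum_abs _ _
    _ ≤ ∑ j, (A j j).re * ((h + 1) * s ^ h) := by
        refine Finset.sum_le_sum fun j _ => ?_
        have hj : 0 ≤ (A j j).re := (Complex.nonneg_iff.mp hA.diag_nonneg).1
        rw [abs_mul, abs_of_nonneg hj]
        gcongr
        exact abs_coeff_homSeries_mul_geom_le hs h1 h2 h j
    _ = (A.trace).re * ((h + 1) * s ^ h) := by
        rw [← Finset.sum_mul, trace, Complex.re_sum]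
        rfl
    _ = _ := by rw [htr, Complex.one_re, one_mul]

lemma abs_quadForm_pow_mul_le (M A : Matrix ι ι ℂ) (h : ℕ) :
    ∃ C, ∀ x, |quadForm M x ^ h * quadForm A x| ≤ C * sqNorm x ^ (h + 1) := by
  obtain ⟨C, hC0, hC⟩ := exists_abs_quadForm_le M
  obtain ⟨D, hD0, hD⟩ := exists_abs_quadForm_le A
  refine ⟨C ^ h * D, fun x => ?_⟩
  have := sqNorm_nonneg x
  rw [abs_mul, abs_pow]
  calc _ ≤ (C * sqNorm x) ^ h * (D * sqNorm x) := by
        gcongr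
        exacts [hC x, hD x]
    _ = _ := by ring

variable [DecidableEq ι]

lemma quadForm_diagonal (c : ι → ℝ) (x : ι → ℂ) :
    quadForm (diagonal fun i => (c i : ℂ)) x = ∑ i, c i * ‖x i‖ ^ 2 := by
  simp only [quadForm, dotProduct, mulVec_diagonal, Complex.re_sum]
  refine Finset.sum_congr rfl fun i _ => ?_
  rw [mul_left_comm, Pi.star_apply, RCLike.star_def, Complex.conj_mul', ← Complex.ofReal_pow,
    ← Complex.ofReal_mul, Complex.ofReal_re]

lemma signFlip_mem (k : ι) :
    diagonal (fun i => if i = k then (-1 : ℂ) else 1) ∈ unitaryGroup ι ℂ := by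
  rw [mem_unitaryGroup_iff, star_eq_conjTranspose, diagonal_conjTranspose, diagonal_mul_diagonal,
    ← diagonal_one]
  congr 1
  ext i
  by_cases h : i = k <;> simp [h]

lemma integral_offDiagonal (c : ι → ℝ) (h : ℕ) (a : ℂ) {i j : ι} (hij : i ≠ j) :
    ∫ x : ι → ℂ, (∑ i, c i * ‖x i‖ ^ 2) ^ h * (star (x i) * a * x j).re *
      Real.exp (-sqNorm x) = 0 := by
  set S : unitaryGroup ι ℂ := ⟨_, signFlip_mem i⟩
  have hval : ∀ (x : ι → ℂ) k, ((S : Matrix ι ι ℂ) *ᵥ x) k = (if k = i then -1 else 1) * x k :=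
    fun x k => mulVec_diagonal _ _ _
  have hnorm : ∀ (x : ι → ℂ) k, ‖((S : Matrix ι ι ℂ) *ᵥ x) k‖ = ‖x k‖ := fun x k => by
    rw [hval]
    split_ifs <;> simp
  have := integral_comp_mulVec S fun x : ι → ℂ =>
    (∑ i, c i * ‖x i‖ ^ 2) ^ h * (star (x i) * a * x j).re * Real.exp (-sqNorm x)
  simp only [sqNorm_mulVec, hnorm] at this
  simp only [hval, if_true, if_neg hij.symm, one_mul, neg_mul, star_neg, Complex.neg_re,
    mul_neg, integral_neg] at this
  linarith

lemma integral_diagonal_moment (c : ι → ℝ) (h : ℕ) (A : Matrix ι ι ℂ) :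
    ∫ x : ι → ℂ, (∑ i, c i * ‖x i‖ ^ 2) ^ h * quadForm A x * Real.exp (-sqNorm x) =
      Real.pi ^ Fintype.card ι * h.factorial *
        ∑ j, (A j j).re * PowerSeries.coeff h (homSeries c * geom (c j)) := by
  obtain ⟨C, hC0, hC⟩ := exists_abs_quadForm_le (diagonal fun i => (c i : ℂ))
  simp only [quadForm_diagonal] at hC
  have hint : ∀ i j, Integrable fun x : ι → ℂ =>
      (∑ i, c i * ‖x i‖ ^ 2) ^ h * (star (x i) * A i j * x j).re * Real.exp (-sqNorm x) := by
    intro i j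
    refine integrable_mul_exp (C := C ^ h * ‖A i j‖) (n := h) ?_ fun x => ?_
    · refine Continuous.mul (by fun_prop) (Complex.continuous_re.comp ?_)
      exact ((continuous_star.comp (continuous_apply i)).mul continuous_const).mul
        (continuous_apply j)
    · rw [abs_mul, abs_pow]
      calc _ ≤ (C * sqNorm x) ^ h * (‖A i j‖ * sqNorm x) := by
            have := sqNorm_nonneg x
            gcongr
            · exact hC x
            · exact abs_re_entry_le A x i j
        _ = _ := by ring
  simp only [quadForm_eq_sum, Finset.mul_sum, Finset.sum_mul]
  rw [integral_finsetSum _ fun i _ => integrable_finsetSum _ fun j _ => hint i j]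
  refine Finset.sum_congr rfl fun i _ => ?_
  rw [integral_finsetSum _ fun j _ => hint i j, Finset.sum_eq_single i
    (fun j _ hj => integral_offDiagonal c h (A i j) hj.symm) (by simp)]
  have hre : ∀ x : ι → ℂ, (star (x i) * A i i * x i).re = (A i i).re * ‖x i‖ ^ 2 := fun x => by
    rw [mul_right_comm, RCLike.star_def, Complex.conj_mul', ← Complex.ofReal_pow,
      Complex.re_ofReal_mul, mul_comm]
  simp only [hre]
  have := integral_moment c h i
  calc _ = ∫ x : ι → ℂ, (A i i).re *
        ((∑ i, c i * ‖x i‖ ^ 2) ^ h * ‖x i‖ ^ 2 * Real.exp (-sqNorm x)) := by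
        congr 1
        ext x
        ring
    _ = _ := by
        rw [integral_const_mul, this]
        ring

/-- A Hermitian matrix becomes real diagonal after a unitary conjugation. -/
lemma exists_conj_eq_diagonal {M : Matrix ι ι ℂ} (hM : M.IsHermitian) :
    ∃ (V : unitaryGroup ι ℂ) (c : ι → ℝ),
      (V : Matrix ι ι ℂ)ᴴ * M * V = diagonal fun i => (c i : ℂ) := by
  refine ⟨hM.eigenvectorUnitary, hM.eigenvalues, ?_⟩
  have := hM.conjStarAlgAut_star_eigenvectorUnitary
  rw [Unitary.conjStarAlgAut_apply] at this
  simpa [star_eq_conjTranspose, Function.comp_def] using this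

lemma trace_conj_unitary (V : unitaryGroup ι ℂ) (A : Matrix ι ι ℂ) :
    ((V : Matrix ι ι ℂ)ᴴ * A * V).trace = A.trace := by
  have h : (V : Matrix ι ι ℂ) * (V : Matrix ι ι ℂ)ᴴ = 1 := Unitary.coe_mul_star_self V
  rw [trace_mul_comm, ← Matrix.mul_assoc, h, Matrix.one_mul]

lemma conj_unitary_mul_conj_unitary (V : unitaryGroup ι ℂ) (A B : Matrix ι ι ℂ) :
    ((V : Matrix ι ι ℂ)ᴴ * A * V) * ((V : Matrix ι ι ℂ)ᴴ * B * V) =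
      (V : Matrix ι ι ℂ)ᴴ * (A * B) * V := by
  have h : (V : Matrix ι ι ℂ) * (V : Matrix ι ι ℂ)ᴴ = 1 := Unitary.coe_mul_star_self V
  calc _ = (V : Matrix ι ι ℂ)ᴴ * A * (V * (V : Matrix ι ι ℂ)ᴴ) * B * V := by
        simp only [Matrix.mul_assoc]
    _ = _ := by rw [h, Matrix.mul_one, Matrix.mul_assoc _ A B]

/-- The Haar moment of a Hermitian form, in terms of the diagonalization of the form. -/
theorem card_mul_haar_moment [Nonempty ι] [MeasurableSpace (unitaryGroup ι ℂ)]
    [BorelSpace (unitaryGroup ι ℂ)] {μ : Measure (unitaryGroup ι ℂ)} [IsProbabilityMeasure μ]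
    (hinv : ∀ V : unitaryGroup ι ℂ, μ.map (fun U => V * U) = μ) {M : Matrix ι ι ℂ}
    {V : unitaryGroup ι ℂ} {c : ι → ℝ}
    (hV : (V : Matrix ι ι ℂ)ᴴ * M * V = diagonal fun i => (c i : ℂ)) (A : Matrix ι ι ℂ)
    {e : ι → ℂ} (he : sqNorm e = 1) (h : ℕ) :
    (Fintype.card ι : ℝ) * ∫ U : unitaryGroup ι ℂ,
        quadForm M ((U : Matrix ι ι ℂ) *ᵥ e) ^ h * quadForm A ((U : Matrix ι ι ℂ) *ᵥ e) ∂μ =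
      h.factorial / (∏ j ∈ Finset.Icc 1 h, ((Fintype.card ι : ℝ) + j)) *
        ∑ j, (((V : Matrix ι ι ℂ)ᴴ * A * V) j j).re *
          PowerSeries.coeff h (homSeries c * geom (c j)) := by
  obtain ⟨C, hC⟩ := abs_quadForm_pow_mul_le M A h
  have key := haar_integral_mul_gaussian hinv (f := fun x => quadForm M x ^ h * quadForm A x)
    (by fun_prop) hC (fun r x => by
      simp only [quadForm_smul]
      ring) he
  rw [integral_sqNorm_pow, ← integral_comp_mulVec V] at key
  simp only [quadForm_mulVec _ (V : Matrix ι ι ℂ), sqNorm_mulVec, hV, quadForm_diagonal] at key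
  rw [integral_diagonal_moment] at key
  have hprod : (0 : ℝ) < ∏ j ∈ Finset.Icc 1 h, ((Fintype.card ι : ℝ) + j) :=
    Finset.prod_pos fun j _ => by positivity
  have hpi : (0 : ℝ) < Real.pi ^ Fintype.card ι := by positivity
  rw [div_mul_eq_mul_div, eq_div_iff hprod.ne']
  refine mul_left_cancel₀ hpi.ne' ?_
  linear_combination key

end Diagonalization

end UniformPOVM

/-- hypercontractivity of the uniform POVM: the `h`-th moment of the
observable value `⟨v, M v⟩` under the uniform-POVM outcome distribution of a state
`ρ` is at most `((h+1)!/((d+1)⋯(d+h)))·(Tr(M²)+(Tr M)²)^{h/2}` in absolute value.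
Haar measure on the unitary group is encoded as a left-invariant Borel
probability measure `μ`. -/
theorem uniform_povm_hypercontractivity
    {d : ℕ} (hd : 1 ≤ d)
    [MeasurableSpace (Matrix.unitaryGroup (Fin d) ℂ)]
    [BorelSpace (Matrix.unitaryGroup (Fin d) ℂ)]
    (μ : Measure (Matrix.unitaryGroup (Fin d) ℂ)) [IsProbabilityMeasure μ]
    (hinv : ∀ V : Matrix.unitaryGroup (Fin d) ℂ, μ.map (fun U => V * U) = μ)
    (ρ M : Matrix (Fin d) (Fin d) ℂ)
    (hρ : ρ.PosSemidef) (hρtr : ρ.trace = 1) (hM : M.IsHermitian)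
    (e₀ : Fin d → ℂ) (he₀ : star e₀ ⬝ᵥ e₀ = 1)
    (h : ℕ) (hh : 2 ≤ h) :
    |(d : ℝ) * ∫ U : Matrix.unitaryGroup (Fin d) ℂ,
        ((star ((U : Matrix (Fin d) (Fin d) ℂ).mulVec e₀)
            ⬝ᵥ M.mulVec ((U : Matrix (Fin d) (Fin d) ℂ).mulVec e₀)).re) ^ h
        * (star ((U : Matrix (Fin d) (Fin d) ℂ).mulVec e₀)
            ⬝ᵥ ρ.mulVec ((U : Matrix (Fin d) (Fin d) ℂ).mulVec e₀)).re ∂μ|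
    ≤ ((Nat.factorial (h + 1) : ℝ) / ∏ j ∈ Finset.Icc 1 h, ((d : ℝ) + j))
        * ((((M * M).trace).re + (M.trace.re) ^ 2) ^ ((h : ℝ) / 2)) := by
  have : Nonempty (Fin d) := ⟨⟨0, hd⟩⟩
  obtain ⟨V, c, hV⟩ := UniformPOVM.exists_conj_eq_diagonal hM
  have he : UniformPOVM.sqNorm e₀ = 1 := by
    rw [UniformPOVM.star_dotProduct_self_eq] at he₀
    exact_mod_cast he₀
  have h1 : M.trace.re = ∑ i, c i := by
    rw [← UniformPOVM.trace_conj_unitary V, hV, trace_diagonal, ← Complex.ofReal_sum,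
      Complex.ofReal_re]
  have h2 : (M * M).trace.re = ∑ i, c i ^ 2 := by
    rw [← UniformPOVM.trace_conj_unitary V, ← UniformPOVM.conj_unitary_mul_conj_unitary, hV,
      diagonal_mul_diagonal, trace_diagonal]
    simp [sq]
  rw [h1, h2]
  set T : ℝ := ∑ i, c i ^ 2 + (∑ i, c i) ^ 2
  have hsum : 0 ≤ ∑ i, c i ^ 2 := Finset.sum_nonneg fun i _ => sq_nonneg (c i)
  have hT : 0 ≤ T := add_nonneg hsum (sq_nonneg _)
  have hpow : T ^ ((h : ℝ) / 2) = Real.sqrt T ^ h := by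
    rw [Real.sqrt_eq_rpow, ← Real.rpow_natCast, ← Real.rpow_mul hT]
    congr 1
    ring
  have hbound := UniformPOVM.sum_re_diag_mul_coeff_le (c := c) (Real.sqrt_nonneg T)
    (Real.abs_le_sqrt (by simp only [T]; linarith))
    (by rw [Real.sq_sqrt hT]; exact le_add_of_nonneg_right (sq_nonneg _)) h
    (hρ.conjTranspose_mul_mul_same (V : Matrix (Fin d) (Fin d) ℂ))
    ((UniformPOVM.trace_conj_unitary V ρ).trans hρtr)
  have hmoment := UniformPOVM.card_mul_haar_moment hinv hV ρ he h
  simp only [Fintype.card_fin, UniformPOVM.quadForm] at hmoment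
  have hprod : (0 : ℝ) < ∏ j ∈ Finset.Icc 1 h, ((d : ℝ) + j) :=
    Finset.prod_pos fun j _ => by positivity
  rw [hmoment, hpow, abs_mul, abs_of_nonneg (by positivity)]
  calc _ ≤ (h.factorial : ℝ) / (∏ j ∈ Finset.Icc 1 h, ((d : ℝ) + j)) *
        ((h + 1) * Real.sqrt T ^ h) := by gcongr
    _ = _ := by
        rw [Nat.factorial_succ]
        push_cast
        ring
end

section
/- Let ρ be a density matrix on ℂ^d, M a Hermitian d×d complex matrix, and e₀ a fixed unit vector in ℂ^d. Define m₁ = d·∫_{U(d)} ⟨U e₀, M (U e₀)⟩·⟨U e₀, ρ (U e₀)⟩ dμ(U) and m₂ = d·∫_{U(d)} ⟨U e₀, M (U e₀)⟩²·⟨U e₀, ρ (U e₀)⟩ dμ(U), where μ is Haar measure on the unitary group U(d). Then the variance of ⟨v, M v⟩ under the uniform-POVM outcome distribution of ρ satisfies m₂ − m₁² ≤ 3·Tr(M²)/((d+1)(d+2)). -/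
open Matrix MeasureTheory
open scoped BigOperators ComplexOrder

section

variable {n : Type*} [Fintype n] [DecidableEq n]

/-- The matrix acting on the coordinates `i`, `j` by `!![a, b; -conj b, conj a]` and trivially on
all other coordinates. -/
def planeRotation (i j : n) (a b : ℂ) : Matrix n n ℂ := fun k l =>
  if k = i then (if l = i then a else 0) + (if l = j then b else 0)
  else if k = j then (if l = i then -star b else 0) + (if l = j then star a else 0)
  else if k = l then 1 else 0

theorem planeRotation_mulVec (i j : n) (a b : ℂ) (w : n → ℂ) (k : n) :
    (planeRotation i j a b *ᵥ w) k =
      if k = i then a * w i + b * w j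
      else if k = j then -star b * w i + star a * w j
      else w k := by
  simp only [planeRotation, mulVec, dotProduct]
  split_ifs <;> simp [add_mul, Finset.sum_add_distrib]

omit [Fintype n] in
theorem planeRotation_conjTranspose {i j : n} (hij : i ≠ j) (a b : ℂ) :
    (planeRotation i j a b)ᴴ = planeRotation i j (star a) (-b) := by
  ext k l
  simp only [planeRotation, conjTranspose_apply]
  by_cases hki : k = i <;> by_cases hkj : k = j <;> by_cases hli : l = i <;>
    by_cases hlj : l = j <;> by_cases hkl : k = l <;> simp_all [eq_comm]

theorem planeRotation_mem_unitaryGroup {i j : n} (hij : i ≠ j) {a b : ℂ}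
    (hab : star a * a + star b * b = 1) : planeRotation i j a b ∈ unitaryGroup n ℂ := by
  rw [mem_unitaryGroup_iff', star_eq_conjTranspose, planeRotation_conjTranspose hij]
  refine Matrix.ext_of_mulVec_single fun m => ?_
  rw [← mulVec_mulVec, one_mulVec]
  generalize (Pi.single m 1 : n → ℂ) = w
  ext k
  rw [planeRotation_mulVec]
  simp only [planeRotation_mulVec, hij.symm, if_true, if_false]
  split_ifs with h₁ h₂
  · subst h₁
    simp only [RCLike.star_def] at *
    linear_combination w k * hab
  · subst h₂
    simp only [RCLike.star_def, star_neg, Complex.conj_conj] at *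
    linear_combination w k * hab
  · rfl

variable {ν : Measure (n → ℂ)} [IsProbabilityMeasure ν]

omit [DecidableEq n] in
theorem integrable_of_continuous_of_ae_sphere
    (hs : ∀ᵐ w ∂ν, ∑ i, Complex.normSq (w i) = 1) {f : (n → ℂ) → ℝ} (hf : Continuous f) :
    Integrable f ν := by
  have hc : Continuous fun w : n → ℂ => ∑ i, Complex.normSq (w i) := by fun_prop
  have hK : IsCompact {w : n → ℂ | ∑ i, Complex.normSq (w i) = 1} := by
    refine Metric.isCompact_of_isClosed_isBounded (isClosed_eq hc continuous_const) ?_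
    refine (Metric.isBounded_closedBall (x := (0 : n → ℂ)) (r := 1)).subset fun w hw => ?_
    rw [mem_closedBall_zero_iff, pi_norm_le_iff_of_nonneg zero_le_one]
    intro i
    have : Complex.normSq (w i) ≤ 1 := (Finset.single_le_sum
      (f := fun i => Complex.normSq (w i)) (fun _ _ => Complex.normSq_nonneg _)
      (Finset.mem_univ i)).trans_eq hw
    rw [Complex.normSq_eq_norm_sq] at this
    nlinarith [norm_nonneg (w i)]
  obtain ⟨C, hC⟩ := hK.exists_bound_of_continuousOn hf.continuousOn
  exact Integrable.of_bound hf.aestronglyMeasurable C (hs.mono fun w hw => hC w hw)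

omit [IsProbabilityMeasure ν] in
theorem integral_mulVec (hν : ∀ V ∈ unitaryGroup n ℂ, ν.map (V *ᵥ ·) = ν)
    {V : Matrix n n ℂ} (hV : V ∈ unitaryGroup n ℂ) {f : (n → ℂ) → ℝ} (hf : Continuous f) :
    ∫ w, f (V *ᵥ w) ∂ν = ∫ w, f w ∂ν := by
  conv_rhs => rw [← hν V hV]
  have hc : Continuous fun w : n → ℂ => V *ᵥ w := by fun_prop
  exact (integral_map hc.aemeasurable hf.aestronglyMeasurable).symm

/-- The vector of squared moduli of the coordinates. -/
def sqModuli (w : n → ℂ) : n → ℝ := fun i => Complex.normSq (w i)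

omit [Fintype n] [DecidableEq n] in
@[fun_prop]
theorem continuous_sqModuli : Continuous (sqModuli (n := n)) :=
  continuous_pi fun i => Complex.continuous_normSq.comp (continuous_apply i)

theorem sqModuli_planeRotation_of_ne {i j k : n} (hki : k ≠ i) (hkj : k ≠ j) (a b : ℂ)
    (w : n → ℂ) : sqModuli (planeRotation i j a b *ᵥ w) k = sqModuli w k := by
  simp [sqModuli, planeRotation_mulVec, hki, hkj]

omit [IsProbabilityMeasure ν] in
theorem integral_sqModuli_swap (hν : ∀ V ∈ unitaryGroup n ℂ, ν.map (V *ᵥ ·) = ν)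
    {i j : n} (hij : i ≠ j) {g : (n → ℝ) → ℝ} (hg : Continuous g) :
    ∫ w, g (sqModuli w ∘ Equiv.swap i j) ∂ν = ∫ w, g (sqModuli w) ∂ν := by
  rw [← integral_mulVec hν (planeRotation_mem_unitaryGroup hij (a := 0) (b := 1) (by simp))
    (f := fun w => g (sqModuli w)) (by fun_prop)]
  congr! 3 with w
  ext k
  simp only [sqModuli, planeRotation_mulVec, Function.comp_apply, Equiv.swap_apply_def]
  split_ifs <;> simp

omit [IsProbabilityMeasure ν] in
theorem integral_sqModuli_mul_offDiag (hν : ∀ V ∈ unitaryGroup n ℂ, ν.map (V *ᵥ ·) = ν)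
    {k l : n} (hkl : k ≠ l) (c : ℂ) {g : (n → ℝ) → ℝ} (hg : Continuous g) :
    ∫ w, g (sqModuli w) * (star (w k) * (c * w l)).re ∂ν = 0 := by
  have h := integral_mulVec hν
    (planeRotation_mem_unitaryGroup hkl (a := Complex.I) (b := 0) (by simp))
    (f := fun w => g (sqModuli w) * (star (w k) * (c * w l)).re) (by fun_prop)
  have hp (w : n → ℂ) : sqModuli (planeRotation k l Complex.I 0 *ᵥ w) = sqModuli w := by
    ext m
    simp only [sqModuli, planeRotation_mulVec]
    split_ifs with h₁ h₂
    · simp [h₁]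
    · simp [h₂]
    · rfl
  have hq (w : n → ℂ) : (star ((planeRotation k l Complex.I 0 *ᵥ w) k) *
      (c * (planeRotation k l Complex.I 0 *ᵥ w) l)).re = -(star (w k) * (c * w l)).re := by
    rw [← Complex.neg_re]
    congr 1
    simp only [planeRotation_mulVec, hkl.symm, if_true, if_false]
    simp only [RCLike.star_def, map_add, map_mul, Complex.conj_I, zero_mul, map_zero, neg_zero]
    linear_combination (starRingEnd ℂ (w k) * c * w l) * Complex.I_mul_I
  simp only [hp, hq, mul_neg, integral_neg] at h
  linarith

theorem sqModuli_planeRotation (i j : n) (a b : ℂ) (w : n → ℂ) :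
    sqModuli (planeRotation i j a b *ᵥ w) i = Complex.normSq (a * w i + b * w j) := by
  simp [sqModuli, planeRotation_mulVec]

/-- Averaging over the rotations with parameters `(3/5, 4/5 * I ^ m)`. -/
theorem integral_average_planeRotation (hν : ∀ V ∈ unitaryGroup n ℂ, ν.map (V *ᵥ ·) = ν)
    (hs : ∀ᵐ w ∂ν, ∑ i, Complex.normSq (w i) = 1)
    {i j : n} (hij : i ≠ j) {f : (n → ℂ) → ℝ} (hf : Continuous f) :
    ∫ w, ∑ m : Fin 4, f (planeRotation i j (3 / 5) (4/5 * Complex.I ^ (m : ℕ)) *ᵥ w) ∂ν =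
      4 * ∫ w, f w ∂ν := by
  have hab (m : ℕ) : star (3/5 : ℂ) * (3 / 5) +
      star (4/5 * Complex.I ^ m) * (4/5 * Complex.I ^ m) = 1 := by
    have h : star (Complex.I ^ m) * Complex.I ^ m = 1 := by
      rw [star_pow, ← mul_pow]
      simp
    rw [star_mul, mul_mul_mul_comm, mul_comm (star _), mul_mul_mul_comm]
    simp at h ⊢
    linear_combination (16/25) * h
  rw [integral_finsetSum _ fun m _ => integrable_of_continuous_of_ae_sphere hs (by fun_prop)]
  simp [integral_mulVec hν (planeRotation_mem_unitaryGroup hij (hab _)) hf]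

theorem sum_normSq_pow_three (x y : ℂ) :
    ∑ m : Fin 4, Complex.normSq (3/5 * x + 4/5 * Complex.I ^ (m : ℕ) * y) ^ 3 =
      (4 * (9 * Complex.normSq x + 16 * Complex.normSq y) ^ 3 +
        3456 * (9 * Complex.normSq x + 16 * Complex.normSq y) *
          (Complex.normSq x * Complex.normSq y)) / 15625 := by
  have h3 : (3/5 : ℂ) = ((3/5 : ℝ) : ℂ) := by norm_num
  have h4 : (4/5 : ℂ) = ((4/5 : ℝ) : ℂ) := by norm_num
  rw [h3, h4]
  simp [Fin.sum_univ_four, Complex.normSq_apply, pow_succ, Complex.mul_re, Complex.mul_im]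
  ring

theorem sum_normSq_pow_two (x y : ℂ) :
    ∑ m : Fin 4, Complex.normSq (3/5 * x + 4/5 * Complex.I ^ (m : ℕ) * y) ^ 2 =
      (4 * (9 * Complex.normSq x + 16 * Complex.normSq y) ^ 2 +
        1152 * (Complex.normSq x * Complex.normSq y)) / 625 := by
  have h3 : (3/5 : ℂ) = ((3/5 : ℝ) : ℂ) := by norm_num
  have h4 : (4/5 : ℂ) = ((4/5 : ℝ) : ℂ) := by norm_num
  rw [h3, h4]
  simp [Fin.sum_univ_four, Complex.normSq_apply, pow_succ, Complex.mul_re, Complex.mul_im]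
  ring

variable (ν) in
/-- The mixed third moments of the squared moduli of the coordinates. -/
noncomputable def thirdMoment (i j k : n) : ℝ :=
  ∫ w, sqModuli w i * sqModuli w j * sqModuli w k ∂ν

omit [Fintype n] [DecidableEq n] [IsProbabilityMeasure ν] in
theorem thirdMoment_comm₁₂ (i j k : n) : thirdMoment ν i j k = thirdMoment ν j i k := by
  simp only [thirdMoment, mul_comm (sqModuli _ i)]

omit [Fintype n] [DecidableEq n] [IsProbabilityMeasure ν] in
theorem thirdMoment_comm₂₃ (i j k : n) : thirdMoment ν i j k = thirdMoment ν i k j := by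
  simp only [thirdMoment, mul_right_comm]

omit [DecidableEq n] in
theorem integral_trilinear_eq (hs : ∀ᵐ w ∂ν, ∑ i, Complex.normSq (w i) = 1) (α β γ : n → ℝ) :
    ∫ w, (∑ i, α i * sqModuli w i) * (∑ i, β i * sqModuli w i) * (∑ i, γ i * sqModuli w i) ∂ν =
      ∑ i, ∑ j, ∑ k, α i * β j * γ k * thirdMoment ν i j k := by
  have hc (i : n) : Continuous fun w : n → ℂ => sqModuli w i := by
    unfold sqModuli; fun_prop
  have hi {f : (n → ℂ) → ℝ} (hf : Continuous f) : Integrable f ν :=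
    integrable_of_continuous_of_ae_sphere hs hf
  have e (w : n → ℂ) :
      (∑ i, α i * sqModuli w i) * (∑ i, β i * sqModuli w i) * (∑ i, γ i * sqModuli w i) =
      ∑ i, ∑ j, ∑ k, α i * β j * γ k * (sqModuli w i * sqModuli w j * sqModuli w k) := by
    rw [Finset.sum_mul_sum, Finset.sum_mul]
    refine Finset.sum_congr rfl fun i _ => ?_
    rw [Finset.sum_mul]
    refine Finset.sum_congr rfl fun j _ => ?_
    rw [Finset.mul_sum]
    refine Finset.sum_congr rfl fun k _ => ?_
    ring
  simp_rw [e]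
  rw [integral_finsetSum _ fun i _ => hi (by fun_prop)]
  refine Finset.sum_congr rfl fun i _ => ?_
  rw [integral_finsetSum _ fun i _ => hi (by fun_prop)]
  refine Finset.sum_congr rfl fun j _ => ?_
  rw [integral_finsetSum _ fun i _ => hi (by fun_prop)]
  refine Finset.sum_congr rfl fun k _ => ?_
  rw [integral_const_mul, thirdMoment]

omit [IsProbabilityMeasure ν] in
theorem thirdMoment_self (hν : ∀ V ∈ unitaryGroup n ℂ, ν.map (V *ᵥ ·) = ν) (i j : n) :
    thirdMoment ν i i i = thirdMoment ν j j j := by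
  rcases eq_or_ne i j with rfl | hij
  · rfl
  have h := integral_sqModuli_swap hν hij (g := fun p => p j * p j * p j) (by fun_prop)
  simpa [thirdMoment] using h

theorem thirdMoment_pair (hν : ∀ V ∈ unitaryGroup n ℂ, ν.map (V *ᵥ ·) = ν)
    (hs : ∀ᵐ w ∂ν, ∑ i, Complex.normSq (w i) = 1) {i j : n} (hij : i ≠ j) :
    3 * thirdMoment ν i i j = thirdMoment ν i i i := by
  have hc (i : n) : Continuous fun w : n → ℂ => sqModuli w i := by
    unfold sqModuli; fun_prop
  have hi {f : (n → ℂ) → ℝ} (hf : Continuous f) : Integrable f ν :=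
    integrable_of_continuous_of_ae_sphere hs hf
  have hswap := integral_sqModuli_swap hν hij (g := fun p => p j * p j * p i) (by fun_prop)
  have h := integral_average_planeRotation hν hs hij (f := fun w => sqModuli w i ^ 3)
    (by fun_prop)
  simp only [sqModuli_planeRotation, sum_normSq_pow_three] at h
  have e (w : n → ℂ) : (4 * (9 * Complex.normSq (w i) + 16 * Complex.normSq (w j)) ^ 3 +
        3456 * (9 * Complex.normSq (w i) + 16 * Complex.normSq (w j)) *
          (Complex.normSq (w i) * Complex.normSq (w j))) / 15625 =
      2916 / 15625 * (sqModuli w i * sqModuli w i * sqModuli w i) +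
      46656 / 15625 * (sqModuli w i * sqModuli w i * sqModuli w j) +
      82944 / 15625 * (sqModuli w j * sqModuli w j * sqModuli w i) +
      16384 / 15625 * (sqModuli w j * sqModuli w j * sqModuli w j) := by
    simp only [sqModuli]
    ring
  simp only [e] at h
  rw [integral_add (hi (by fun_prop)) (hi (by fun_prop)),
    integral_add (hi (by fun_prop)) (hi (by fun_prop)),
    integral_add (hi (by fun_prop)) (hi (by fun_prop))] at h
  simp only [integral_const_mul] at h
  have hs' := thirdMoment_self hν i j
  simp only [pow_succ, pow_zero, one_mul] at h
  simp only [Function.comp_apply, Equiv.swap_apply_left, Equiv.swap_apply_right] at hswap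
  simp only [thirdMoment] at *
  linarith

theorem thirdMoment_distinct (hν : ∀ V ∈ unitaryGroup n ℂ, ν.map (V *ᵥ ·) = ν)
    (hs : ∀ᵐ w ∂ν, ∑ i, Complex.normSq (w i) = 1) {i j k : n} (hij : i ≠ j) (hik : i ≠ k)
    (hjk : j ≠ k) : 6 * thirdMoment ν i j k = thirdMoment ν i i i := by
  have hc (i : n) : Continuous fun w : n → ℂ => sqModuli w i := by
    unfold sqModuli; fun_prop
  have hi {f : (n → ℂ) → ℝ} (hf : Continuous f) : Integrable f ν :=
    integrable_of_continuous_of_ae_sphere hs hf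
  have h := integral_average_planeRotation hν hs hij
    (f := fun w => sqModuli w i ^ 2 * sqModuli w k) (by fun_prop)
  simp only [sqModuli_planeRotation, sqModuli_planeRotation_of_ne hik.symm hjk.symm,
    ← Finset.sum_mul, sum_normSq_pow_two] at h
  have e (w : n → ℂ) : (4 * (9 * Complex.normSq (w i) + 16 * Complex.normSq (w j)) ^ 2 +
        1152 * (Complex.normSq (w i) * Complex.normSq (w j))) / 625 * sqModuli w k =
      324 / 625 * (sqModuli w i * sqModuli w i * sqModuli w k) +
      2304 / 625 * (sqModuli w i * sqModuli w j * sqModuli w k) +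
      1024 / 625 * (sqModuli w j * sqModuli w j * sqModuli w k) := by
    simp only [sqModuli]
    ring
  simp only [e] at h
  rw [integral_add (hi (by fun_prop)) (hi (by fun_prop)),
    integral_add (hi (by fun_prop)) (hi (by fun_prop))] at h
  simp only [integral_const_mul] at h
  have hs' := thirdMoment_self hν i j
  have h₁ := thirdMoment_pair hν hs hik
  have h₂ := thirdMoment_pair hν hs hjk
  simp only [pow_two] at h
  simp only [thirdMoment] at *
  linarith

theorem thirdMoment_eq (hν : ∀ V ∈ unitaryGroup n ℂ, ν.map (V *ᵥ ·) = ν)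
    (hs : ∀ᵐ w ∂ν, ∑ i, Complex.normSq (w i) = 1) (i₀ i j k : n) :
    thirdMoment ν i j k = thirdMoment ν i₀ i₀ i₀ / 6 *
      (1 + (if i = j then 1 else 0) + (if j = k then 1 else 0) + (if i = k then 1 else 0) +
        2 * ((if i = j then 1 else 0) * (if j = k then 1 else 0))) := by
  rw [thirdMoment_self hν i₀ i]
  by_cases hij : i = j
  · subst hij
    by_cases hik : i = k
    · subst hik
      simp only [if_true]
      ring
    · simp only [hik, if_true, if_false]
      linarith [thirdMoment_pair hν hs hik]
  · by_cases hik : i = k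
    · subst hik
      simp only [hij, Ne.symm hij, if_true, if_false]
      rw [thirdMoment_comm₂₃]
      linarith [thirdMoment_pair hν hs hij]
    · by_cases hjk : j = k
      · subst hjk
        simp only [hij, if_true, if_false]
        rw [thirdMoment_comm₁₂, thirdMoment_comm₂₃]
        linarith [thirdMoment_pair hν hs (Ne.symm hij), thirdMoment_self hν i j]
      · simp only [hij, hik, hjk, if_false]
        linarith [thirdMoment_distinct hν hs hij hik hjk]

theorem integral_trilinear (hν : ∀ V ∈ unitaryGroup n ℂ, ν.map (V *ᵥ ·) = ν)
    (hs : ∀ᵐ w ∂ν, ∑ i, Complex.normSq (w i) = 1) (i₀ : n) (α β γ : n → ℝ) :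
    ∫ w, (∑ i, α i * sqModuli w i) * (∑ i, β i * sqModuli w i) * (∑ i, γ i * sqModuli w i) ∂ν =
      thirdMoment ν i₀ i₀ i₀ / 6 *
        ((∑ i, α i) * (∑ i, β i) * (∑ i, γ i) + (∑ i, α i * β i) * (∑ i, γ i) +
          (∑ i, β i * γ i) * (∑ i, α i) + (∑ i, α i * γ i) * (∑ i, β i) +
          2 * ∑ i, α i * β i * γ i) := by
  rw [integral_trilinear_eq hs]
  have hT := thirdMoment_eq hν hs i₀
  generalize thirdMoment ν i₀ i₀ i₀ / 6 = C at hT ⊢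
  simp only [hT]
  have hk (i j : n) : ∑ k, α i * β j * γ k * (C * (1 + (if i = j then 1 else 0) +
      (if j = k then 1 else 0) + (if i = k then 1 else 0) +
        2 * ((if i = j then 1 else 0) * (if j = k then 1 else 0)))) =
      (C * α i * (∑ k, γ k)) * β j + (C * α i * (∑ k, γ k)) * (if i = j then β j else 0) +
        C * α i * (β j * γ j) + (C * α i * γ i) * β j +
        2 * C * α i * (if i = j then β j * γ j else 0) := by
    have e (k : n) : α i * β j * γ k * (C * (1 + (if i = j then 1 else 0) +
        (if j = k then 1 else 0) + (if i = k then 1 else 0) +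
        2 * ((if i = j then 1 else 0) * (if j = k then 1 else 0)))) =
        (C * α i * β j * (1 + if i = j then 1 else 0)) * γ k +
        (C * α i * β j * (1 + 2 * if i = j then 1 else 0)) * (if j = k then γ k else 0) +
        C * α i * β j * (if i = k then γ k else 0) := by
      split_ifs <;> ring
    simp only [e, Finset.sum_add_distrib, ← Finset.mul_sum, Finset.sum_ite_eq, Finset.mem_univ,
      if_true]
    split_ifs <;> ring
  have hj (i : n) : ∑ j, ((C * α i * (∑ k, γ k)) * β j +
        (C * α i * (∑ k, γ k)) * (if i = j then β j else 0) +
        C * α i * (β j * γ j) + (C * α i * γ i) * β j +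
        2 * C * α i * (if i = j then β j * γ j else 0)) =
      C * ((∑ k, β k) * (∑ k, γ k) + ∑ k, β k * γ k) * α i + C * (∑ k, γ k) * (α i * β i) +
        C * (∑ k, β k) * (α i * γ i) + 2 * C * (α i * β i * γ i) := by
    simp only [Finset.sum_add_distrib, ← Finset.mul_sum, Finset.sum_ite_eq, Finset.mem_univ,
      if_true]
    ring
  simp only [hk, hj, Finset.sum_add_distrib, ← Finset.mul_sum]
  ring

/-- The diagonal part of an observable suffices when integrating against squared moduli. -/
theorem integral_sqModuli_mul_quadForm (hν : ∀ V ∈ unitaryGroup n ℂ, ν.map (V *ᵥ ·) = ν)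
    (hs : ∀ᵐ w ∂ν, ∑ i, Complex.normSq (w i) = 1) (A : Matrix n n ℂ)
    {g : (n → ℝ) → ℝ} (hg : Continuous g) :
    ∫ w, g (sqModuli w) * (star w ⬝ᵥ A *ᵥ w).re ∂ν =
      ∫ w, g (sqModuli w) * ∑ k, (A k k).re * sqModuli w k ∂ν := by
  have hc (i : n) : Continuous fun w : n → ℂ => sqModuli w i := by
    unfold sqModuli; fun_prop
  have hi {f : (n → ℂ) → ℝ} (hf : Continuous f) : Integrable f ν :=
    integrable_of_continuous_of_ae_sphere hs hf
  simp only [dotProduct, mulVec, Finset.mul_sum, Complex.re_sum, Pi.star_apply]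
  rw [integral_finsetSum _ fun i _ => hi (by fun_prop),
    integral_finsetSum _ fun i _ => hi (by fun_prop)]
  refine Finset.sum_congr rfl fun k _ => ?_
  rw [integral_finsetSum _ fun i _ => hi (by fun_prop), Finset.sum_eq_single k]
  · congr! 3 with w
    simp [sqModuli, Complex.normSq_apply]
    ring
  · intro l _ hl
    exact integral_sqModuli_mul_offDiag hν hl.symm _ hg
  · simp

theorem variance_bound_of_diagonal (hν : ∀ V ∈ unitaryGroup n ℂ, ν.map (V *ᵥ ·) = ν)
    (hs : ∀ᵐ w ∂ν, ∑ i, Complex.normSq (w i) = 1) [Nonempty n] (lam : n → ℝ)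
    {A : Matrix n n ℂ} (hA : A.PosSemidef) (hAtr : A.trace = 1) :
    (Fintype.card n : ℝ) * ∫ w, (∑ i, lam i * sqModuli w i) ^ 2 * (star w ⬝ᵥ A *ᵥ w).re ∂ν -
      ((Fintype.card n : ℝ) *
        ∫ w, (∑ i, lam i * sqModuli w i) * (star w ⬝ᵥ A *ᵥ w).re ∂ν) ^ 2 ≤
    3 * (∑ i, lam i ^ 2) / (((Fintype.card n : ℝ) + 1) * ((Fintype.card n : ℝ) + 2)) := by
  obtain ⟨i₀⟩ := ‹Nonempty n›
  set r : n → ℝ := fun k => (A k k).re with hr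
  have hr0 (k : n) : 0 ≤ r k := (Complex.nonneg_iff.mp hA.diag_nonneg).1
  have hr1 : ∑ k, r k = 1 := by
    simpa [Matrix.trace, Complex.re_sum] using congrArg Complex.re hAtr
  have hrle (k : n) : r k ≤ 1 :=
    (Finset.single_le_sum (f := r) (fun _ _ => hr0 _) (Finset.mem_univ k)).trans_eq hr1
  have hsum {f g : (n → ℂ) → ℝ} (h : ∀ w, ∑ i, Complex.normSq (w i) = 1 → f w = g w) :
      ∫ w, f w ∂ν = ∫ w, g w ∂ν := integral_congr_ae (hs.mono h)
  have h1 := integral_trilinear hν hs i₀ (fun _ => 1) (fun _ => 1) (fun _ => 1)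
  rw [hsum (g := fun _ => 1) (by intro w hw; simp [sqModuli, hw])] at h1
  rw [integral_sqModuli_mul_quadForm hν hs A
      (g := fun p => (∑ i, lam i * p i) ^ 2) (by fun_prop),
    integral_sqModuli_mul_quadForm hν hs A (g := fun p => ∑ i, lam i * p i) (by fun_prop),
    hsum (f := fun w => (∑ i, lam i * sqModuli w i) * ∑ k, (A k k).re * sqModuli w k)
      (g := fun w => (∑ i, lam i * sqModuli w i) * (∑ i, 1 * sqModuli w i) *
        ∑ k, (A k k).re * sqModuli w k) (by intro w hw; simp [sqModuli, hw])]
  simp only [pow_two (∑ i, lam i * sqModuli _ i)]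
  have hq : ∑ i, lam i * lam i * r i ≤ ∑ i, lam i ^ 2 :=
    Finset.sum_le_sum fun i _ => by nlinarith [hrle i, sq_nonneg (lam i)]
  rw [integral_trilinear hν hs i₀, integral_trilinear hν hs i₀ lam (fun _ => 1)]
  simp only [← hr, hr1, one_mul, mul_one, Finset.sum_const, Finset.card_univ, nsmul_eq_mul,
    integral_const, probReal_univ, smul_eq_mul, ← pow_two] at h1 hq ⊢
  generalize thirdMoment ν i₀ i₀ i₀ / 6 = C at *
  have hd : (0 : ℝ) < Fintype.card n := by
    exact_mod_cast Fintype.card_pos_iff.mpr ⟨i₀⟩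
  generalize (Fintype.card n : ℝ) = D at *
  generalize ∑ i, lam i ^ 2 * r i = q at *
  generalize ∑ i, lam i ^ 2 = s at *
  generalize ∑ i, lam i * r i = u at *
  generalize ∑ i, lam i = t at *
  have hC : C = 1 / (D * (D + 1) * (D + 2)) := by
    field_simp
    linarith
  have e : D * (C * (t ^ 2 + s + u * t + u * t + 2 * q)) -
      (D * (C * (t * D + t + t + u * D + 2 * u))) ^ 2 =
      3 * s / ((D + 1) * (D + 2)) - (2 * (s - q) / ((D + 1) * (D + 2)) +
        (t + u) ^ 2 / ((D + 1) ^ 2 * (D + 2)) + u ^ 2 / ((D + 1) * (D + 2))) := by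
    rw [hC]
    field_simp
    ring
  have h2 : 0 ≤ s - q := by linarith
  have : 0 ≤ 2 * (s - q) / ((D + 1) * (D + 2)) +
        (t + u) ^ 2 / ((D + 1) ^ 2 * (D + 2)) + u ^ 2 / ((D + 1) * (D + 2)) := by positivity
  linarith

end

/-- variance bound for the observable value `⟨v, M v⟩` under the
uniform-POVM outcome distribution of a state `ρ`: `m₂ − m₁² ≤ 3·Tr(M²)/((d+1)(d+2))`.
Haar measure on the unitary group is encoded as a left-invariant Borel probability
measure `μ`. -/
theorem uniform_povm_observable_variance_bound
    {d : ℕ} (hd : 1 ≤ d)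
    [MeasurableSpace (Matrix.unitaryGroup (Fin d) ℂ)]
    [BorelSpace (Matrix.unitaryGroup (Fin d) ℂ)]
    (μ : Measure (Matrix.unitaryGroup (Fin d) ℂ)) [IsProbabilityMeasure μ]
    (hinv : ∀ V : Matrix.unitaryGroup (Fin d) ℂ, μ.map (fun U => V * U) = μ)
    (ρ M : Matrix (Fin d) (Fin d) ℂ)
    (hρ : ρ.PosSemidef) (hρtr : ρ.trace = 1) (hM : M.IsHermitian)
    (e₀ : Fin d → ℂ) (he₀ : star e₀ ⬝ᵥ e₀ = 1)
    (m₁ m₂ : ℝ)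
    (hm₁ : m₁ = (d : ℝ) * ∫ U : Matrix.unitaryGroup (Fin d) ℂ,
        (star ((U : Matrix (Fin d) (Fin d) ℂ).mulVec e₀)
            ⬝ᵥ M.mulVec ((U : Matrix (Fin d) (Fin d) ℂ).mulVec e₀)).re
        * (star ((U : Matrix (Fin d) (Fin d) ℂ).mulVec e₀)
            ⬝ᵥ ρ.mulVec ((U : Matrix (Fin d) (Fin d) ℂ).mulVec e₀)).re ∂μ)
    (hm₂ : m₂ = (d : ℝ) * ∫ U : Matrix.unitaryGroup (Fin d) ℂ,
        ((star ((U : Matrix (Fin d) (Fin d) ℂ).mulVec e₀)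
            ⬝ᵥ M.mulVec ((U : Matrix (Fin d) (Fin d) ℂ).mulVec e₀)).re) ^ 2
        * (star ((U : Matrix (Fin d) (Fin d) ℂ).mulVec e₀)
            ⬝ᵥ ρ.mulVec ((U : Matrix (Fin d) (Fin d) ℂ).mulVec e₀)).re ∂μ) :
    m₂ - m₁ ^ 2 ≤ 3 * ((M * M).trace).re / (((d : ℝ) + 1) * ((d : ℝ) + 2)) := by
  have hce : Continuous fun U : Matrix.unitaryGroup (Fin d) ℂ =>
      (U : Matrix (Fin d) (Fin d) ℂ) *ᵥ e₀ := by fun_prop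
  set ν : Measure (Fin d → ℂ) :=
    μ.map fun U : Matrix.unitaryGroup (Fin d) ℂ => (U : Matrix (Fin d) (Fin d) ℂ) *ᵥ e₀ with hνdef
  have : IsProbabilityMeasure ν := Measure.isProbabilityMeasure_map hce.aemeasurable
  have : Nonempty (Fin d) := ⟨⟨0, hd⟩⟩
  have hν : ∀ V ∈ unitaryGroup (Fin d) ℂ, ν.map (V *ᵥ ·) = ν := by
    intro V hV
    have hcV : Continuous fun w : Fin d → ℂ => V *ᵥ w := by fun_prop
    have hcm : Continuous fun U : Matrix.unitaryGroup (Fin d) ℂ =>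
      (⟨V, hV⟩ : Matrix.unitaryGroup (Fin d) ℂ) * U := by fun_prop
    rw [hνdef, Measure.map_map hcV.measurable hce.measurable]
    conv_rhs => rw [← hinv ⟨V, hV⟩, Measure.map_map hce.measurable hcm.measurable]
    congr 1
    ext1 U
    simp [mulVec_mulVec]
  have hs : ∀ᵐ w ∂ν, ∑ i, Complex.normSq (w i) = 1 := by
    have hc : Continuous fun w : Fin d → ℂ => ∑ i, Complex.normSq (w i) := by fun_prop
    rw [hνdef, ae_map_iff hce.aemeasurable (isClosed_eq hc continuous_const).measurableSet]
    refine ae_of_all _ fun U => ?_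
    have h : star ((U : Matrix (Fin d) (Fin d) ℂ) *ᵥ e₀) ⬝ᵥ
        ((U : Matrix (Fin d) (Fin d) ℂ) *ᵥ e₀) = 1 := by
      rw [star_mulVec, dotProduct_mulVec, vecMul_vecMul, ← star_eq_conjTranspose,
        mem_unitaryGroup_iff'.mp U.2, vecMul_one, he₀]
    have h' := congrArg Complex.re h
    simpa [dotProduct, Complex.re_sum, Complex.normSq_apply] using h'
  set W : Matrix (Fin d) (Fin d) ℂ := ↑hM.eigenvectorUnitary
  have hWm : W ∈ unitaryGroup (Fin d) ℂ := hM.eigenvectorUnitary.2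
  have hWs : W * Wᴴ = 1 := mem_unitaryGroup_iff.mp hWm
  have hspec : Wᴴ * M * W = diagonal (RCLike.ofReal ∘ hM.eigenvalues) := by
    have h := hM.conjStarAlgAut_star_eigenvectorUnitary
    rwa [Unitary.conjStarAlgAut_star_apply] at h
  have hquad (A : Matrix (Fin d) (Fin d) ℂ) (w : Fin d → ℂ) :
      star (W *ᵥ w) ⬝ᵥ A *ᵥ (W *ᵥ w) = star w ⬝ᵥ (Wᴴ * A * W) *ᵥ w := by
    rw [star_mulVec, ← dotProduct_mulVec, mulVec_mulVec, mulVec_mulVec, Matrix.mul_assoc]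
  have hdiag (w : Fin d → ℂ) : (star (W *ᵥ w) ⬝ᵥ M *ᵥ (W *ᵥ w)).re =
      ∑ i, hM.eigenvalues i * sqModuli w i := by
    rw [hquad, hspec]
    simp only [dotProduct, mulVec_diagonal, Complex.re_sum]
    refine Finset.sum_congr rfl fun i _ => ?_
    simp [sqModuli, Complex.normSq_apply]
    ring
  have htrans {f : (Fin d → ℂ) → ℝ} (hf : Continuous f) :
      ∫ U : Matrix.unitaryGroup (Fin d) ℂ, f ((U : Matrix (Fin d) (Fin d) ℂ) *ᵥ e₀) ∂μ =
        ∫ w, f (W *ᵥ w) ∂ν := by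
    rw [integral_mulVec hν hWm hf, hνdef,
      integral_map hce.aemeasurable hf.aestronglyMeasurable]
  have hρ' : (Wᴴ * ρ * W).PosSemidef := hρ.conjTranspose_mul_mul_same W
  have hρtr' : (Wᴴ * ρ * W).trace = 1 := by
    rw [Matrix.trace_mul_cycle, hWs, Matrix.one_mul, hρtr]
  have hMtr : ((M * M).trace).re = ∑ i, hM.eigenvalues i ^ 2 := by
    have h : (M * M).trace = ((Wᴴ * M * W) * (Wᴴ * M * W)).trace := by
      rw [show (Wᴴ * M * W) * (Wᴴ * M * W) = Wᴴ * (M * (W * Wᴴ) * M) * W by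
        simp only [Matrix.mul_assoc], hWs, Matrix.mul_one, Matrix.trace_mul_cycle, hWs,
        Matrix.one_mul]
    rw [h, hspec, diagonal_mul_diagonal, trace_diagonal]
    simp [Complex.re_sum, pow_two]
  have key := variance_bound_of_diagonal hν hs hM.eigenvalues hρ' hρtr'
  rw [htrans (f := fun v => (star v ⬝ᵥ M *ᵥ v).re * (star v ⬝ᵥ ρ *ᵥ v).re) (by fun_prop)] at hm₁
  rw [htrans (f := fun v => (star v ⬝ᵥ M *ᵥ v).re ^ 2 * (star v ⬝ᵥ ρ *ᵥ v).re)
    (by fun_prop)] at hm₂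
  simp only [hdiag, hquad ρ] at hm₁ hm₂
  rw [hm₁, hm₂, hMtr]
  simpa using key
end

section
/- Let Δ be a traceless Hermitian d×d complex matrix and let p ≥ 2 be an even integer. For a unitary U ∈ U(d) let u_1, …, u_d denote its columns. Then ∫_{U(d)} Σ_{x=1}^d ⟨u_x, Δ u_x⟩^p dμ(U) ≤ (d/2) · binom(d+p−1, p)^{−1} · (Tr(Δ²))^{p/2}, where μ is Haar measure on the unitary group U(d) and binom(d+p−1, p) is the binomial coefficient. -/
open Matrix MeasureTheory
open scoped BigOperators ComplexOrder

lemma abs_sum_pow_le {ι : Type*} [Fintype ι] (l : ι → ℝ) {n : ℕ} (hn : 2 ≤ n) :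
    |∑ i, l i ^ n| ≤ √(∑ i, l i ^ 2) ^ n := by
  set s := √(∑ i, l i ^ 2) with hs
  have hs2 : s ^ 2 = ∑ i, l i ^ 2 := Real.sq_sqrt (Finset.sum_nonneg fun i _ => sq_nonneg _)
  obtain ⟨m, rfl⟩ := Nat.exists_eq_add_of_le hn
  calc |∑ i, l i ^ (2 + m)| ≤ ∑ i, |l i ^ (2 + m)| := Finset.abs_sum_le_sum_abs _ _
    _ ≤ ∑ i, l i ^ 2 * s ^ m := by
      refine Finset.sum_le_sum fun i _ => ?_
      rw [abs_pow, pow_add, sq_abs]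
      gcongr
      exact Real.abs_le_sqrt
        (Finset.single_le_sum (f := fun i => l i ^ 2) (fun j _ => sq_nonneg _) (Finset.mem_univ i))
    _ = s ^ (2 + m) := by rw [← Finset.sum_mul, ← hs2, pow_add]

/-- The complete homogeneous symmetric polynomial of degree `n` evaluated at `l`. -/
noncomputable def completeHomogeneous {ι : Type*} [Fintype ι] [DecidableEq ι]
    (l : ι → ℝ) (n : ℕ) : ℝ :=
  ∑ k ∈ Finset.piAntidiag Finset.univ n, ∏ i, l i ^ k i

section CompleteHomogeneous

variable {ι : Type*} [Fintype ι] [DecidableEq ι]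

lemma card_piAntidiag_univ (n : ℕ) :
    (Finset.piAntidiag (Finset.univ : Finset ι) n).card
      = (Fintype.card ι + n - 1).choose n := by
  rw [← Nat.multichoose_eq, ← Finset.card_univ,
    ← Finset.card_finsuppAntidiag_nat_eq_multichoose]
  refine Finset.card_bij' (fun k _ => Finsupp.equivFunOnFinite.symm k) (fun k _ => ⇑k)
    ?_ ?_ ?_ ?_ <;> simp

lemma completeHomogeneous_zero (l : ι → ℝ) : completeHomogeneous l 0 = 1 := by
  simp [completeHomogeneous]

lemma sum_exponent_mul_monomial_succ (l : ι → ℝ) (i : ι) (n : ℕ) :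
    ∑ k ∈ Finset.piAntidiag Finset.univ (n + 1), (k i : ℝ) * ∏ j, l j ^ k j
      = l i * (∑ k ∈ Finset.piAntidiag Finset.univ n, (k i : ℝ) * ∏ j, l j ^ k j
        + completeHomogeneous l n) := by
  rw [completeHomogeneous, ← Finset.sum_add_distrib, Finset.mul_sum]
  symm
  refine Finset.sum_of_injOn (fun k => k + Pi.single i 1)
    (fun a _ b _ h => by simpa using h) ?_ ?_ ?_
  · intro k hk
    simp only [Finset.mem_coe, Finset.mem_piAntidiag] at hk ⊢
    simp_all [Finset.sum_add_distrib]
  · intro k hk hk'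
    by_cases h : k i = 0
    · simp [h]
    · refine absurd ⟨k - Pi.single i 1, ?_, ?_⟩ hk'
      · have hle : ∀ j, (Pi.single i 1 : ι → ℕ) j ≤ k j := by
          intro j
          by_cases hj : j = i
          · subst hj; simp; omega
          · simp [hj]
        have hk2 : ∑ j, k j = n + 1 := by simpa using hk
        have : ∑ j, (k - Pi.single i 1 : ι → ℕ) j = n := by
          simp only [Pi.sub_apply]
          rw [Finset.sum_tsub_distrib _ (fun j _ => hle j), hk2]
          simp
        simpa using this
      · funext j
        by_cases hj : j = i
        · subst hj; simp; omega
        · simp [hj]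
  · intro k _
    have : ∏ j, l j ^ (k + Pi.single i 1 : ι → ℕ) j = l i * ∏ j, l j ^ k j := by
      simp only [Pi.add_apply, pow_add, Finset.prod_mul_distrib]
      rw [mul_comm]
      congr 1
      rw [Finset.prod_eq_single i] <;> simp +contextual
    rw [this]
    simp
    ring

lemma sum_exponent_mul_monomial (l : ι → ℝ) (i : ι) (n : ℕ) :
    ∑ k ∈ Finset.piAntidiag Finset.univ n, (k i : ℝ) * ∏ j, l j ^ k j
      = ∑ m ∈ Finset.range n, l i ^ (n - m) * completeHomogeneous l m := by
  induction n with
  | zero => simp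
  | succ n ih =>
    rw [sum_exponent_mul_monomial_succ, ih, Finset.sum_range_succ, mul_add, Finset.mul_sum]
    congr 1
    · refine Finset.sum_congr rfl fun m hm => ?_
      rw [Nat.succ_sub (Finset.mem_range.1 hm).le, pow_succ]
      ring
    · simp

/-- Newton's identity for complete homogeneous symmetric polynomials. -/
lemma mul_completeHomogeneous (l : ι → ℝ) (n : ℕ) :
    n * completeHomogeneous l n
      = ∑ m ∈ Finset.range n, (∑ i, l i ^ (n - m)) * completeHomogeneous l m := by
  simp_rw [Finset.sum_mul]
  rw [Finset.sum_comm]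
  simp_rw [← sum_exponent_mul_monomial]
  rw [Finset.sum_comm, completeHomogeneous, Finset.mul_sum]
  refine Finset.sum_congr rfl fun k hk => ?_
  rw [← Finset.sum_mul]
  congr 1
  have : ∑ j, k j = n := by simpa using hk
  exact_mod_cast this.symm

lemma abs_completeHomogeneous_le (l : ι → ℝ) (hl : ∑ i, l i = 0) {n : ℕ} (hn : 1 ≤ n) :
    |completeHomogeneous l n| ≤ √(∑ i, l i ^ 2) ^ n / 2 := by
  induction n using Nat.strong_induction_on with
  | _ n ih =>
    have hN := mul_completeHomogeneous l n
    match n, hn with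
    | 1, _ =>
      have : completeHomogeneous l 1 = 0 := by simpa [hl] using hN
      rw [this, abs_zero]
      positivity
    | m + 2, _ =>
      rw [Finset.sum_range_succ, Finset.sum_range_succ', completeHomogeneous_zero] at hN
      have h1 : m + 2 - (m + 1) = 1 := by omega
      simp only [h1, pow_one, hl, zero_mul, add_zero, mul_one, Nat.sub_zero] at hN
      set s := √(∑ i, l i ^ 2) with hs
      have hs0 : 0 ≤ s := Real.sqrt_nonneg _
      have hsum : |∑ k ∈ Finset.range m,
          (∑ i, l i ^ (m + 2 - (k + 1))) * completeHomogeneous l (k + 1)|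
            ≤ m * (s ^ (m + 2) / 2) := by
        refine (Finset.abs_sum_le_sum_abs _ _).trans ?_
        refine (Finset.sum_le_card_nsmul _ _ (s ^ (m + 2) / 2) fun k hk => ?_).trans_eq
          (by simp)
        have hk' := Finset.mem_range.1 hk
        rw [abs_mul]
        calc _ ≤ s ^ (m + 2 - (k + 1)) * (s ^ (k + 1) / 2) :=
              mul_le_mul (abs_sum_pow_le l (by omega)) (ih (k + 1) (by omega) (by omega))
                (abs_nonneg _) (by positivity)
          _ = s ^ (m + 2) / 2 := by
              rw [mul_div_assoc', ← pow_add, Nat.sub_add_cancel (by omega)]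
      have hp := abs_sum_pow_le l (n := m + 2) (by omega)
      have hpos : (0 : ℝ) < ((m + 2 : ℕ) : ℝ) := by positivity
      have : ((m + 2 : ℕ) : ℝ) * |completeHomogeneous l (m + 2)|
          ≤ ((m + 2 : ℕ) : ℝ) * (s ^ (m + 2) / 2) := by
        rw [← abs_of_pos hpos, ← abs_mul, abs_of_pos hpos, hN]
        refine (abs_add_le _ _).trans ((add_le_add hsum hp).trans_eq ?_)
        push_cast
        ring
      exact le_of_mul_le_mul_left this hpos

end CompleteHomogeneous

section UnitarilyInvariant

variable {ι : Type*} [Fintype ι] {ν : Measure (ι → ℂ)}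

lemma integrable_of_continuous_of_ae_sphere_s16 {E : Type*} [NormedAddCommGroup E]
    [SecondCountableTopology E] [IsFiniteMeasure ν]
    (hsph : ∀ᵐ v ∂ν, ∑ i, ‖v i‖ ^ 2 = 1) {f : (ι → ℂ) → E} (hf : Continuous f) :
    Integrable f ν := by
  have hK : ∀ᵐ v ∂ν, v ∈ Metric.closedBall (0 : ι → ℂ) 1 := by
    filter_upwards [hsph] with v hv
    rw [mem_closedBall_zero_iff, pi_norm_le_iff_of_nonneg zero_le_one]
    intro i
    have := Finset.single_le_sum (f := fun i => ‖v i‖ ^ 2) (fun j _ => sq_nonneg _)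
      (Finset.mem_univ i)
    rw [hv] at this
    exact (sq_le_one_iff₀ (norm_nonneg _)).1 this
  have := hf.continuousOn.integrableOn_compact (μ := ν)
    (isCompact_closedBall (0 : ι → ℂ) 1)
  rwa [IntegrableOn, Measure.restrict_eq_self_of_ae_mem hK] at this

variable [DecidableEq ι]

lemma integral_comp_mulVec {E : Type*} [NormedAddCommGroup E] [NormedSpace ℝ E]
    [SecondCountableTopology E]
    (hinv : ∀ V ∈ Matrix.unitaryGroup ι ℂ, ν.map (fun v => V *ᵥ v) = ν)
    {V : Matrix ι ι ℂ} (hV : V ∈ Matrix.unitaryGroup ι ℂ) {f : (ι → ℂ) → E}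
    (hf : Continuous f) : ∫ v, f (V *ᵥ v) ∂ν = ∫ v, f v ∂ν := by
  have hc : Continuous fun v : ι → ℂ => V *ᵥ v := by fun_prop
  conv_rhs => rw [← hinv V hV]
  rw [integral_map hc.aemeasurable hf.aestronglyMeasurable]

lemma integral_monomial_mul_star_monomial_eq_zero
    (hinv : ∀ V ∈ Matrix.unitaryGroup ι ℂ, ν.map (fun v => V *ᵥ v) = ν)
    {k l : ι → ℕ} (hkl : k ≠ l) :
    ∫ v, (∏ i, v i ^ k i) * ∏ i, star (v i) ^ l i ∂ν = 0 := by
  obtain ⟨i, hi⟩ := Function.ne_iff.1 hkl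
  have hne : ((k i : ℂ) - l i) ≠ 0 := sub_ne_zero.2 (by exact_mod_cast hi)
  set θ : ℝ := Real.pi / ((k i : ℝ) - l i) with hθ
  set ζ : ℂ := Complex.exp (θ * Complex.I) with hζ
  have hζstar : star ζ = Complex.exp (-(θ * Complex.I)) := by
    rw [hζ, Complex.star_def, ← Complex.exp_conj]
    simp
  have hζ1 : star ζ * ζ = 1 := by rw [hζstar, hζ, ← Complex.exp_add]; simp
  have hζkl : ζ ^ k i * star ζ ^ l i = -1 := by
    rw [hζstar, hζ, ← Complex.exp_nat_mul, ← Complex.exp_nat_mul, ← Complex.exp_add,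
      ← Complex.exp_pi_mul_I]
    congr 1
    rw [hθ]
    push_cast
    field_simp
    ring
  set z : ι → ℂ := Function.update 1 i ζ with hz
  have hV : Matrix.diagonal z ∈ Matrix.unitaryGroup ι ℂ := by
    rw [Matrix.mem_unitaryGroup_iff', Matrix.star_eq_conjTranspose, Matrix.diagonal_conjTranspose,
      Matrix.diagonal_mul_diagonal, ← Matrix.diagonal_one]
    congr 1
    funext j
    by_cases hj : j = i
    · subst hj
      simpa [hz] using hζ1
    · simp [hz, hj]
  have h := integral_comp_mulVec hinv hV
    (f := fun v => (∏ i, v i ^ k i) * ∏ i, star (v i) ^ l i) (by fun_prop)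
  have hpt : ∀ v : ι → ℂ, (∏ j, (Matrix.diagonal z *ᵥ v) j ^ k j)
      * ∏ j, star ((Matrix.diagonal z *ᵥ v) j) ^ l j
        = -((∏ j, v j ^ k j) * ∏ j, star (v j) ^ l j) := by
    intro v
    have hzk : ∏ j, z j ^ k j = ζ ^ k i := by
      rw [Finset.prod_eq_single i] <;> simp +contextual [hz]
    have hzl : ∏ j, star (z j) ^ l j = star ζ ^ l i := by
      rw [Finset.prod_eq_single i] <;> simp +contextual [hz]
    simp only [Matrix.mulVec_diagonal, mul_pow, star_mul', Finset.prod_mul_distrib, hzk, hzl]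
    linear_combination ((∏ j, v j ^ k j) * ∏ j, star (v j) ^ l j) * hζkl
  simp only [hpt, integral_neg] at h
  exact self_eq_neg.1 h.symm

lemma exists_mem_unitaryGroup_row_eq (i : ι) {a : ι → ℂ} (ha : ∑ j, ‖a j‖ ^ 2 = 1) :
    ∃ V ∈ Matrix.unitaryGroup ι ℂ, V i = a := by
  set w : EuclideanSpace ℂ ι := WithLp.toLp 2 a with hw
  have hw1 : ‖w‖ = 1 := by
    rw [EuclideanSpace.norm_eq, Real.sqrt_eq_one]
    exact ha
  have horth : Orthonormal ℂ (Set.domRestrict {i} fun _ : ι => w) := by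
    refine ⟨fun _ => hw1, fun x y hxy => absurd (Subsingleton.elim x y) hxy⟩
  obtain ⟨b, hb⟩ := horth.exists_orthonormalBasis_extension_of_card_eq (by simp)
  refine ⟨((EuclideanSpace.basisFun ι ℂ).toBasis.toMatrix b)ᵀ, ?_, ?_⟩
  · have := (EuclideanSpace.basisFun ι ℂ).toMatrix_orthonormalBasis_mem_unitary b
    exact Matrix.transpose_mem_unitaryGroup_iff.2 this
  · funext j
    simp [Module.Basis.toMatrix_apply, hb i rfl, hw]

lemma integral_linear_pow_mul_star
    (hinv : ∀ V ∈ Matrix.unitaryGroup ι ℂ, ν.map (fun v => V *ᵥ v) = ν)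
    (i₀ : ι) (p : ℕ) {t : ι → ℝ} (ht : ∀ i, 0 < t i) :
    ∫ v, (∑ i, (√(t i) : ℂ) * v i) ^ p * (∑ i, (√(t i) : ℂ) * star (v i)) ^ p ∂ν
      = (((∑ i, t i) ^ p * ∫ v, (‖v i₀‖ ^ 2) ^ p ∂ν : ℝ) : ℂ) := by
  set r := ∑ i, t i with hr
  have hr0 : 0 < r := Finset.sum_pos (fun i _ => ht i) ⟨i₀, Finset.mem_univ _⟩
  obtain ⟨V, hV, hVi⟩ := exists_mem_unitaryGroup_row_eq i₀ (a := fun j => ((√(t j) / √r : ℝ) : ℂ))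
    (by
      simp only [Complex.norm_real, Real.norm_eq_abs, sq_abs, div_pow, Real.sq_sqrt hr0.le,
        Real.sq_sqrt (ht _).le]
      rw [← Finset.sum_div, ← hr, div_self hr0.ne'])
  have h := integral_comp_mulVec hinv hV (f := fun v => (‖v i₀‖ ^ 2) ^ p) (by fun_prop)
  rw [← h, ← integral_const_mul, ← integral_complex_ofReal]
  refine integral_congr_ae (Filter.Eventually.of_forall fun v => ?_)
  have hs : (√r : ℂ) ≠ 0 := by exact_mod_cast (Real.sqrt_pos.2 hr0).ne'
  have hsr : (√r : ℂ) ^ 2 = r := by exact_mod_cast Real.sq_sqrt hr0.le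
  have hrow : ∑ i, (√(t i) : ℂ) * v i = √r * (V *ᵥ v) i₀ := by
    simp only [Matrix.mulVec, dotProduct, hVi, Finset.mul_sum]
    refine Finset.sum_congr rfl fun j _ => ?_
    push_cast
    field_simp
  have hrow' : ∑ i, (√(t i) : ℂ) * star (v i) = √r * star ((V *ᵥ v) i₀) := by
    have := congrArg star hrow
    simpa using this
  simp only [hrow, hrow']
  push_cast
  rw [← mul_pow, ← mul_pow, ← hsr, ← Complex.mul_conj', Complex.star_def]
  ring

lemma multinomial_mul_integral_monomial [IsFiniteMeasure ν]
    (hsph : ∀ᵐ v ∂ν, ∑ i, ‖v i‖ ^ 2 = 1)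
    (hinv : ∀ V ∈ Matrix.unitaryGroup ι ℂ, ν.map (fun v => V *ᵥ v) = ν)
    (i₀ : ι) (p : ℕ) {k : ι → ℕ} (hk : k ∈ Finset.piAntidiag Finset.univ p) :
    Nat.multinomial Finset.univ k * ∫ v, ∏ i, (‖v i‖ ^ 2) ^ k i ∂ν
      = ∫ v, (‖v i₀‖ ^ 2) ^ p ∂ν := by
  set m : (ι → ℕ) → ℝ := fun k => ∫ v, ∏ i, (‖v i‖ ^ 2) ^ k i ∂ν with hm
  set c : ℝ := ∫ v, (‖v i₀‖ ^ 2) ^ p ∂ν with hc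
  have hexp : ∀ t : ι → ℝ, (∀ i, 0 < t i) →
      ∑ k ∈ Finset.piAntidiag Finset.univ p,
        (Nat.multinomial Finset.univ k : ℝ) ^ 2 * m k * ∏ i, t i ^ k i
      = ∑ k ∈ Finset.piAntidiag Finset.univ p,
        (Nat.multinomial Finset.univ k : ℝ) * c * ∏ i, t i ^ k i := by
    intro t ht
    have h := integral_linear_pow_mul_star hinv i₀ p ht
    have hdiag : ∀ k : ι → ℕ, ∫ v, (∏ i, v i ^ k i) * ∏ i, star (v i) ^ k i ∂ν = (m k : ℂ) := by
      intro k
      rw [← integral_complex_ofReal]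
      refine integral_congr_ae (Filter.Eventually.of_forall fun v => ?_)
      simp only [← Finset.prod_mul_distrib, ← mul_pow, Complex.star_def, Complex.mul_conj']
      push_cast
      rfl
    have hlhs : ∫ v, (∑ i, (√(t i) : ℂ) * v i) ^ p * (∑ i, (√(t i) : ℂ) * star (v i)) ^ p ∂ν
        = ∑ k ∈ Finset.piAntidiag Finset.univ p, ∑ l ∈ Finset.piAntidiag Finset.univ p,
            (Nat.multinomial Finset.univ k * Nat.multinomial Finset.univ l
              * (∏ i, (√(t i) : ℂ) ^ k i) * ∏ i, (√(t i) : ℂ) ^ l i)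
              * ∫ v, (∏ i, v i ^ k i) * ∏ i, star (v i) ^ l i ∂ν := by
      simp only [← integral_const_mul]
      have hint : ∀ k l : ι → ℕ, Integrable (fun v : ι → ℂ =>
          (Nat.multinomial Finset.univ k * Nat.multinomial Finset.univ l
              * (∏ i, (√(t i) : ℂ) ^ k i) * ∏ i, (√(t i) : ℂ) ^ l i)
              * ((∏ i, v i ^ k i) * ∏ i, star (v i) ^ l i)) ν := fun k l =>
        integrable_of_continuous_of_ae_sphere_s16 hsph (by fun_prop)
      simp only [← integral_finsetSum _ fun l _ => hint _ l]
      rw [← integral_finsetSum _ fun k _ => integrable_finsetSum _ fun l _ => hint k l]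
      refine integral_congr_ae (Filter.Eventually.of_forall fun v => ?_)
      simp only [Finset.sum_pow_eq_sum_piAntidiag, Finset.sum_mul_sum, mul_pow,
        Finset.prod_mul_distrib]
      refine Finset.sum_congr rfl fun k _ => Finset.sum_congr rfl fun l _ => ?_
      ring
    rw [hlhs] at h
    have hcollapse : ∀ k ∈ Finset.piAntidiag (Finset.univ : Finset ι) p,
        ∑ l ∈ Finset.piAntidiag Finset.univ p,
            ((Nat.multinomial Finset.univ k : ℂ) * Nat.multinomial Finset.univ l
              * (∏ i, (√(t i) : ℂ) ^ k i) * ∏ i, (√(t i) : ℂ) ^ l i)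
              * ∫ v, (∏ i, v i ^ k i) * ∏ i, star (v i) ^ l i ∂ν
          = (((Nat.multinomial Finset.univ k : ℝ) ^ 2 * m k * ∏ i, t i ^ k i : ℝ) : ℂ) := by
      intro k hk
      rw [Finset.sum_eq_single_of_mem k hk, hdiag]
      · have : (∏ i, (√(t i) : ℂ) ^ k i) * ∏ i, (√(t i) : ℂ) ^ k i
            = ((∏ i, t i ^ k i : ℝ) : ℂ) := by
          rw [← Finset.prod_mul_distrib]
          push_cast
          refine Finset.prod_congr rfl fun i _ => ?_
          rw [← mul_pow, ← Complex.ofReal_mul, Real.mul_self_sqrt (ht i).le]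
        push_cast at this ⊢
        rw [← this]
        ring
      · intro l _ hl
        rw [integral_monomial_mul_star_monomial_eq_zero hinv hl.symm, mul_zero]
    rw [Finset.sum_congr rfl hcollapse, ← Complex.ofReal_sum, Complex.ofReal_inj] at h
    rw [h, Finset.sum_pow_eq_sum_piAntidiag, Finset.sum_mul]
    refine Finset.sum_congr rfl fun k _ => ?_
    ring
  have hpoly : ∑ k ∈ Finset.piAntidiag Finset.univ p,
        MvPolynomial.monomial (Finsupp.equivFunOnFinite.symm k)
          ((Nat.multinomial Finset.univ k : ℝ) ^ 2 * m k)
      = ∑ k ∈ Finset.piAntidiag Finset.univ p,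
        MvPolynomial.monomial (Finsupp.equivFunOnFinite.symm k)
          ((Nat.multinomial Finset.univ k : ℝ) * c) := by
    refine MvPolynomial.funext_set (fun _ => Set.Ioi (0 : ℝ)) (fun _ => Set.Ioi_infinite _) ?_
    intro t ht
    simpa [MvPolynomial.eval_monomial, Finsupp.prod_fintype] using
      hexp t fun i => ht i (Set.mem_univ i)
  have hcoeff := congrArg (MvPolynomial.coeff (Finsupp.equivFunOnFinite.symm k)) hpoly
  simp only [MvPolynomial.coeff_sum, MvPolynomial.coeff_monomial,
    EmbeddingLike.apply_eq_iff_eq, Finset.sum_ite_eq', hk, if_true] at hcoeff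
  have hpos : (0 : ℝ) < Nat.multinomial Finset.univ k := by
    exact_mod_cast Nat.multinomial_pos _ _
  rw [sq, mul_assoc] at hcoeff
  exact mul_left_cancel₀ hpos.ne' hcoeff

/-- Moments of a real diagonal quadratic form under a unitarily invariant probability measure on
the complex unit sphere. -/
theorem integral_diagonal_form_pow [IsProbabilityMeasure ν] [Nonempty ι]
    (hsph : ∀ᵐ v ∂ν, ∑ i, ‖v i‖ ^ 2 = 1)
    (hinv : ∀ V ∈ Matrix.unitaryGroup ι ℂ, ν.map (fun v => V *ᵥ v) = ν)
    (l : ι → ℝ) (p : ℕ) :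
    ∫ v, (∑ i, l i * ‖v i‖ ^ 2) ^ p ∂ν
      = ((Fintype.card ι + p - 1).choose p : ℝ)⁻¹ * completeHomogeneous l p := by
  obtain ⟨i₀⟩ := ‹Nonempty ι›
  set c : ℝ := ∫ v, (‖v i₀‖ ^ 2) ^ p ∂ν with hc
  have key : ∀ l : ι → ℝ, ∫ v, (∑ i, l i * ‖v i‖ ^ 2) ^ p ∂ν = c * completeHomogeneous l p := by
    intro l
    simp only [Finset.sum_pow_eq_sum_piAntidiag, mul_pow, Finset.prod_mul_distrib]
    rw [integral_finsetSum _ fun k _ =>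
      integrable_of_continuous_of_ae_sphere_s16 hsph (by fun_prop), completeHomogeneous, Finset.mul_sum]
    refine Finset.sum_congr rfl fun k hk => ?_
    rw [integral_const_mul, integral_const_mul, hc,
      ← multinomial_mul_integral_monomial hsph hinv i₀ p hk]
    ring
  have hone : c * ((Fintype.card ι + p - 1).choose p : ℝ) = 1 := by
    have h := key 1
    rw [integral_congr_ae (g := fun _ => (1 : ℝ))
      (by filter_upwards [hsph] with v hv; simp [hv])] at h
    simp only [completeHomogeneous, Pi.one_apply, one_pow, Finset.prod_const_one,
      Finset.sum_const, card_piAntidiag_univ, nsmul_eq_mul, mul_one] at h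
    simpa using h.symm
  rw [key, eq_inv_of_mul_eq_one_left hone]

end UnitarilyInvariant

section HermitianForm

variable {ι : Type*} [Fintype ι] [DecidableEq ι] {A : Matrix ι ι ℂ}

lemma Matrix.IsHermitian.re_star_dotProduct_mulVec (hA : A.IsHermitian) (v : ι → ℂ) :
    (star v ⬝ᵥ A *ᵥ v).re
      = ∑ i, hA.eigenvalues i * ‖(star (hA.eigenvectorUnitary : Matrix ι ι ℂ) *ᵥ v) i‖ ^ 2 := by
  set W : Matrix ι ι ℂ := (hA.eigenvectorUnitary : Matrix ι ι ℂ) with hW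
  have hspec : A = W * Matrix.diagonal (RCLike.ofReal ∘ hA.eigenvalues) * star W := by
    conv_lhs => rw [hA.spectral_theorem, Unitary.conjStarAlgAut_apply]
  have hform : star v ⬝ᵥ A *ᵥ v
      = star (star W *ᵥ v) ⬝ᵥ
          Matrix.diagonal (RCLike.ofReal ∘ hA.eigenvalues) *ᵥ (star W *ᵥ v) := by
    conv_lhs => rw [hspec]
    rw [← Matrix.mulVec_mulVec, ← Matrix.mulVec_mulVec, Matrix.dotProduct_mulVec,
      Matrix.star_mulVec, Matrix.star_eq_conjTranspose, Matrix.conjTranspose_conjTranspose]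
  rw [hform, dotProduct, Complex.re_sum]
  refine Finset.sum_congr rfl fun i _ => ?_
  rw [Matrix.mulVec_diagonal, Pi.star_apply, Complex.star_def, mul_left_comm, Complex.conj_mul']
  simp [← Complex.ofReal_pow, ← Complex.ofReal_mul]

lemma Matrix.IsHermitian.trace_mul_self_re (hA : A.IsHermitian) :
    (A * A).trace.re = ∑ i, hA.eigenvalues i ^ 2 := by
  have h : A * A = Unitary.conjStarAlgAut ℂ _ hA.eigenvectorUnitary
      (Matrix.diagonal (RCLike.ofReal ∘ hA.eigenvalues)
        * Matrix.diagonal (RCLike.ofReal ∘ hA.eigenvalues)) := by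
    rw [map_mul, ← hA.spectral_theorem]
  rw [h, Unitary.conjStarAlgAut_apply, Matrix.trace_mul_comm, ← mul_assoc,
    Unitary.coe_star_mul_self, one_mul, Matrix.diagonal_mul_diagonal, Matrix.trace_diagonal,
    Complex.re_sum]
  simp [sq]

end HermitianForm

section HaarColumn

variable {ι : Type*} [Fintype ι] [DecidableEq ι]

lemma sum_norm_sq_col_of_mem_unitaryGroup (U : Matrix.unitaryGroup ι ℂ) (x : ι) :
    ∑ j, ‖(U : Matrix ι ι ℂ) j x‖ ^ 2 = 1 := by
  have h := congrFun (congrFun (Unitary.coe_star_mul_self U) x) x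
  rw [Matrix.mul_apply, Matrix.one_apply_eq] at h
  simp only [Matrix.star_apply, Complex.star_def, Complex.conj_mul'] at h
  exact_mod_cast h

lemma continuous_unitaryGroup_col (x : ι) :
    Continuous fun (U : Matrix.unitaryGroup ι ℂ) j => (U : Matrix ι ι ℂ) j x :=
  continuous_pi fun j => continuous_subtype_val.matrix_elem j x

variable [MeasurableSpace (Matrix.unitaryGroup ι ℂ)] [BorelSpace (Matrix.unitaryGroup ι ℂ)]
  {μ : Measure (Matrix.unitaryGroup ι ℂ)}

lemma map_mulVec_map_col
    (hinv : ∀ V : Matrix.unitaryGroup ι ℂ, μ.map (fun U => V * U) = μ) (x : ι)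
    {V : Matrix ι ι ℂ} (hV : V ∈ Matrix.unitaryGroup ι ℂ) :
    (μ.map fun (U : Matrix.unitaryGroup ι ℂ) j => (U : Matrix ι ι ℂ) j x).map (fun v => V *ᵥ v)
      = μ.map fun (U : Matrix.unitaryGroup ι ℂ) j => (U : Matrix ι ι ℂ) j x := by
  have hcol := (continuous_unitaryGroup_col (ι := ι) x).measurable
  have hmul : Measurable fun U : Matrix.unitaryGroup ι ℂ =>
      (⟨V, hV⟩ : Matrix.unitaryGroup ι ℂ) * U :=
    (continuous_const_mul _).measurable
  have hvec : Measurable fun v : ι → ℂ => V *ᵥ v :=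
    Continuous.measurable (by fun_prop)
  conv_rhs => rw [← hinv ⟨V, hV⟩]
  rw [Measure.map_map hvec hcol, Measure.map_map hcol hmul]
  rfl

/-- Moments of a Hermitian form at a column of a Haar-random unitary matrix. -/
theorem integral_hermitian_form_col_pow [IsProbabilityMeasure μ] [Nonempty ι]
    (hinv : ∀ V : Matrix.unitaryGroup ι ℂ, μ.map (fun U => V * U) = μ)
    {A : Matrix ι ι ℂ} (hA : A.IsHermitian) (x : ι) (p : ℕ) :
    ∫ U : Matrix.unitaryGroup ι ℂ, (star (fun j => (U : Matrix ι ι ℂ) j x)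
        ⬝ᵥ A.mulVec (fun j => (U : Matrix ι ι ℂ) j x)).re ^ p ∂μ
      = ((Fintype.card ι + p - 1).choose p : ℝ)⁻¹ * completeHomogeneous hA.eigenvalues p := by
  have hcol := continuous_unitaryGroup_col (ι := ι) x
  set ν :=
    μ.map fun (U : Matrix.unitaryGroup ι ℂ) j => (U : Matrix ι ι ℂ) j x with hν
  have : IsProbabilityMeasure ν := Measure.isProbabilityMeasure_map hcol.aemeasurable
  have hsph : ∀ᵐ v ∂ν, ∑ i, ‖v i‖ ^ 2 = 1 := by
    rw [hν, ae_map_iff hcol.aemeasurable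
      (isClosed_eq (by fun_prop) continuous_const).measurableSet]
    exact Filter.Eventually.of_forall fun U => sum_norm_sq_col_of_mem_unitaryGroup U x
  have hν_inv : ∀ V ∈ Matrix.unitaryGroup ι ℂ, ν.map (fun v => V *ᵥ v) = ν :=
    fun V hV => map_mulVec_map_col hinv x hV
  rw [← integral_diagonal_form_pow hsph hν_inv,
    ← integral_comp_mulVec hν_inv (star hA.eigenvectorUnitary).2
      (f := fun v => (∑ i, hA.eigenvalues i * ‖v i‖ ^ 2) ^ p) (by fun_prop),
    hν, integral_map hcol.aemeasurable (Continuous.aestronglyMeasurable (by fun_prop))]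
  simp only [hA.re_star_dotProduct_mulVec]
  rfl

end HaarColumn

/-- for a traceless Hermitian `Δ` and even `p ≥ 2`, the expected
`ℓ_p^p` mass of the Haar-random-basis outcome differences `⟨u_x, Δ u_x⟩` is at most
`(d/2)·binom(d+p−1,p)⁻¹·(Tr Δ²)^{p/2}`.  Haar measure on the unitary group is
encoded as a left-invariant Borel probability measure `μ`; `u_x` is the `x`-th
column of `U`. -/
theorem haar_basis_lp_moment_bound
    {d : ℕ} (hd : 1 ≤ d)
    [MeasurableSpace (Matrix.unitaryGroup (Fin d) ℂ)]
    [BorelSpace (Matrix.unitaryGroup (Fin d) ℂ)]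
    (μ : Measure (Matrix.unitaryGroup (Fin d) ℂ)) [IsProbabilityMeasure μ]
    (hinv : ∀ V : Matrix.unitaryGroup (Fin d) ℂ, μ.map (fun U => V * U) = μ)
    (Δ : Matrix (Fin d) (Fin d) ℂ) (hΔ : Δ.IsHermitian) (hΔtr : Δ.trace = 0)
    (p : ℕ) (hp : 2 ≤ p) (hpeven : Even p) :
    (∫ U : Matrix.unitaryGroup (Fin d) ℂ,
        ∑ x : Fin d,
          ((star (fun j => (U : Matrix (Fin d) (Fin d) ℂ) j x)
            ⬝ᵥ Δ.mulVec (fun j => (U : Matrix (Fin d) (Fin d) ℂ) j x)).re) ^ p ∂μ)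
    ≤ ((d : ℝ) / 2) * ((Nat.choose (d + p - 1) p : ℝ))⁻¹
        * ((((Δ * Δ).trace).re) ^ ((p : ℝ) / 2)) := by
  have : Nonempty (Fin d) := ⟨⟨0, hd⟩⟩
  have hl : ∑ i, hΔ.eigenvalues i = 0 := by
    have := hΔ.trace_eq_sum_eigenvalues
    rw [hΔtr] at this
    rw [← Complex.ofReal_inj, Complex.ofReal_sum]
    exact this.symm
  have hint : ∀ x : Fin d, Integrable (fun U : Matrix.unitaryGroup (Fin d) ℂ =>
      (star (fun j => (U : Matrix (Fin d) (Fin d) ℂ) j x)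
        ⬝ᵥ Δ.mulVec (fun j => (U : Matrix (Fin d) (Fin d) ℂ) j x)).re ^ p) μ := by
    intro x
    have hcol := continuous_unitaryGroup_col (ι := Fin d) x
    exact (integrable_map_measure (Continuous.aestronglyMeasurable
      (f := fun v : Fin d → ℂ => (star v ⬝ᵥ Δ.mulVec v).re ^ p) (by fun_prop))
      hcol.aemeasurable).1 (integrable_of_continuous_of_ae_sphere_s16
        ((ae_map_iff hcol.aemeasurable
          (isClosed_eq (by fun_prop) continuous_const).measurableSet).2
            (Filter.Eventually.of_forall fun U => sum_norm_sq_col_of_mem_unitaryGroup U x))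
        (by fun_prop))
  rw [integral_finsetSum _ fun x _ => hint x]
  simp only [integral_hermitian_form_col_pow hinv hΔ, Finset.sum_const, Finset.card_univ,
    Fintype.card_fin, nsmul_eq_mul]
  have hbound := (le_abs_self _).trans
    (abs_completeHomogeneous_le hΔ.eigenvalues hl (by omega : 1 ≤ p))
  have hpow : √(∑ i, hΔ.eigenvalues i ^ 2) ^ p
      = ((Δ * Δ).trace.re) ^ ((p : ℝ) / 2) := by
    rw [hΔ.trace_mul_self_re, Real.sqrt_eq_rpow, ← Real.rpow_mul_natCast
      (Finset.sum_nonneg fun i _ => sq_nonneg _)]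
    congr 1
    ring
  rw [← hpow]
  calc (d : ℝ) * (((d + p - 1).choose p : ℝ)⁻¹ * completeHomogeneous hΔ.eigenvalues p)
      ≤ d * (((d + p - 1).choose p : ℝ)⁻¹ * (√(∑ i, hΔ.eigenvalues i ^ 2) ^ p / 2)) := by
        gcongr
    _ = _ := by ring
end

section
/- Let d ≥ 200, let ρ and σ be density matrices on ℂ^d, and set Δ = ρ − σ. For a unitary U ∈ U(d) with columns u_1, …, u_d, with probability at least 0.95 over U drawn from the Haar measure μ on U(d), one has max_{1 ≤ x ≤ d} |⟨u_x, Δ u_x⟩| ≤ (3e·ln(d)/d)·√(Tr(Δ²)). Equivalently, the ℓ∞ distance between the outcome distributions of the basis measurement given by U applied to ρ and to σ is at most (3e·ln(d)/d)·‖ρ−σ‖_F with Haar probability at least 0.95. -/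
open Matrix MeasureTheory
open scoped BigOperators ComplexOrder

section RandomBasis

theorem exp_sub_sub_sq_le {x : ℝ} (hx : 1 / 2 ≤ x) : Real.exp ((x - 1) - (x - 1) ^ 2) ≤ x := by
  have hx0 : 0 < x := by linarith
  have key : x⁻¹ ≤ Real.exp ((x - 1) ^ 2 - (x - 1)) := by
    rcases le_total 1 x with h | h
    · refine le_trans ?_ (Real.add_one_le_exp _)
      rw [inv_le_iff_one_le_mul₀ hx0]
      nlinarith [pow_nonneg (sub_nonneg.2 h) 3]
    · refine le_trans ?_ (Real.quadratic_le_exp_of_nonneg (by nlinarith))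
      obtain ⟨z, rfl⟩ : ∃ z, x = 1 - z := ⟨1 - x, by ring⟩
      have hz : 0 ≤ z := by linarith
      have hz2 : z ≤ 1 / 2 := by linarith
      rw [inv_le_iff_one_le_mul₀ hx0]
      have : 0 ≤ z ^ 2 * ((1 - z) * (1 + z) ^ 2 / 2 - z) :=
        mul_nonneg (sq_nonneg z) (by nlinarith [mul_nonneg hz (sub_nonneg.2 hz2)])
      nlinarith
  rw [← neg_sub, Real.exp_neg]
  exact inv_le_of_inv_le₀ hx0 key

theorem exp_one_mul_log_lt {d : ℝ} (hd : 200 ≤ d) : 3 * Real.exp 1 * Real.log d < 2 * d := by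
  have h1 : Real.log d = Real.log (d / 8) + 3 * Real.log 2 := by
    rw [Real.log_div (by positivity) (by norm_num), show (8 : ℝ) = 2 ^ 3 by norm_num, Real.log_pow]
    push_cast
    ring
  have h2 := Real.log_le_sub_one_of_pos (show 0 < d / 8 by positivity)
  have h3 := Real.log_two_lt_d9
  have h4 := Real.exp_one_lt_d9
  have h5 : 0 < Real.log d := Real.log_pos (by linarith)
  nlinarith [mul_lt_mul_of_pos_right h4 h5]

theorem two_mul_mul_exp_le {d : ℝ} (hd : 200 ≤ d) :
    2 * d * Real.exp (1 / 4 - 3 * Real.exp 1 * Real.log d / 2) ≤ 0.05 := by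
  have hd0 : 0 < d := by linarith
  have hlog : 0 < Real.log d := Real.log_pos (by linarith)
  have he : 2 ≤ Real.exp 1 := by linarith [Real.add_one_le_exp 1]
  have he4 : Real.exp (1 / 4) ≤ 3 :=
    (Real.exp_le_exp.2 (by norm_num)).trans (Real.exp_one_lt_d9.le.trans (by norm_num))
  have h : Real.exp (1 / 4 - 3 * Real.exp 1 * Real.log d / 2) ≤ 3 * (d ^ 3)⁻¹ := by
    calc _ ≤ Real.exp (1 / 4 - 3 * Real.log d) := by
          rw [Real.exp_le_exp]
          nlinarith
      _ = Real.exp (1 / 4) * (d ^ 3)⁻¹ := by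
          rw [sub_eq_add_neg, Real.exp_add, Real.exp_neg, show (3 : ℝ) = (3 : ℕ) by norm_num,
            Real.exp_nat_mul, Real.exp_log hd0]
      _ ≤ _ := by gcongr
  calc _ ≤ 2 * d * (3 * (d ^ 3)⁻¹) := by gcongr
    _ = 6 / d ^ 2 := by field_simp; norm_num
    _ ≤ 0.05 := by
      rw [div_le_iff₀ (by positivity)]
      nlinarith

theorem trace_mul_self_eq_sum_eigenvalues_sq {n : Type*} [Fintype n] [DecidableEq n]
    {A : Matrix n n ℂ} (hA : A.IsHermitian) :
    (A * A).trace = ∑ i, (hA.eigenvalues i : ℂ) ^ 2 := by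
  conv_lhs => rw [hA.spectral_theorem, ← map_mul, Unitary.conjStarAlgAut_apply, trace_mul_cycle]
  simp [diagonal_mul_diagonal, trace_diagonal, sq]

theorem measure_preimage_inv_of_isMulLeftInvariant {G : Type*} [Group G] [MeasurableSpace G]
    [MeasurableMul₂ G] [MeasurableInv G] (μ : Measure G) [IsProbabilityMeasure μ]
    [μ.IsMulLeftInvariant] {s : Set G} (hs : MeasurableSet s) :
    μ {g | g⁻¹ ∈ s} = μ s := by
  have hS : MeasurableSet {p : G × G | p.1⁻¹ * p.2 ∈ s} :=
    (measurable_fst.inv.mul measurable_snd) hs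
  have h1 : (μ.prod μ) {p : G × G | p.1⁻¹ * p.2 ∈ s} = μ s := by
    rw [Measure.prod_apply hS]
    have (a : G) : μ (Prod.mk a ⁻¹' {p : G × G | p.1⁻¹ * p.2 ∈ s}) = μ s :=
      measure_preimage_mul μ a⁻¹ s
    simp only [this, lintegral_const, measure_univ, mul_one]
  have h2 : (μ.prod μ) {p : G × G | p.1⁻¹ * p.2 ∈ s} = μ {g | g⁻¹ ∈ s} := by
    rw [Measure.prod_apply_symm hS]
    have (b : G) : μ ((fun a => (a, b)) ⁻¹' {p : G × G | p.1⁻¹ * p.2 ∈ s})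
        = μ {g | g⁻¹ ∈ s} := by
      rw [← measure_preimage_mul μ b⁻¹ {g | g⁻¹ ∈ s}]
      congr 1
      ext a
      simp
    simp only [this, lintegral_const, measure_univ, mul_one]
  rw [← h1, h2]

theorem measure_preimage_mul_right_of_isMulLeftInvariant {G : Type*} [Group G]
    [MeasurableSpace G] [MeasurableMul₂ G] [MeasurableInv G] (μ : Measure G)
    [IsProbabilityMeasure μ] [μ.IsMulLeftInvariant] {s : Set G} (hs : MeasurableSet s) (w : G) :
    μ {g | g * w ∈ s} = μ s := by
  have hs' : MeasurableSet {g : G | g * w ∈ s} := (measurable_mul_const w) hs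
  rw [← measure_preimage_inv_of_isMulLeftInvariant μ hs', ← measure_preimage_inv_of_isMulLeftInvariant μ hs,
    ← measure_preimage_mul μ w⁻¹ {g | g⁻¹ ∈ s}]
  congr 1
  ext a
  simp

variable {n : Type*} [Fintype n]

/-- The closed Euclidean unit ball of `n → ℂ`. -/
def euclideanUnitBall (n : Type*) [Fintype n] : Set (n → ℂ) := {g | (star g ⬝ᵥ g).re ≤ 1}

theorem re_star_dotProduct_self (g : n → ℂ) : (star g ⬝ᵥ g).re = ∑ i, ‖g i‖ ^ 2 := by
  simp [dotProduct, Complex.sq_norm, Complex.normSq_apply]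

theorem isClosed_euclideanUnitBall : IsClosed (euclideanUnitBall n) :=
  isClosed_le (by fun_prop) continuous_const

theorem volume_euclideanUnitBall_ne_top : volume (euclideanUnitBall n) ≠ ⊤ := by
  refine ne_top_of_le_ne_top (isCompact_closedBall (0 : n → ℂ) 1).measure_lt_top.ne
    (measure_mono fun g hg => ?_)
  rw [mem_closedBall_zero_iff, pi_norm_le_iff_of_nonneg zero_le_one]
  intro i
  have h1 : ∑ i, ‖g i‖ ^ 2 ≤ 1 := by
    rw [← re_star_dotProduct_self]
    exact hg
  have h2 := Finset.single_le_sum (fun i _ => sq_nonneg ‖g i‖) (Finset.mem_univ i)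
  exact (sq_le_one_iff₀ (norm_nonneg _)).1 (h2.trans h1)

theorem volume_euclideanUnitBall_ne_zero : volume (euclideanUnitBall n) ≠ 0 := by
  have ho : IsOpen {g : n → ℂ | (star g ⬝ᵥ g).re < 1} :=
    isOpen_lt (by fun_prop) continuous_const
  refine (lt_of_lt_of_le (ho.measure_pos volume ⟨0, by simp⟩)
    (measure_mono fun g hg => ?_)).ne'
  exact le_of_lt (Set.mem_ofPred_eq ▸ hg)

variable [DecidableEq n]

theorem secondCountableTopology_unitaryGroup :
    SecondCountableTopology (Matrix.unitaryGroup n ℂ) := by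
  have : SecondCountableTopology (Matrix n n ℂ) :=
    inferInstanceAs (SecondCountableTopology (n → n → ℂ))
  exact TopologicalSpace.Subtype.secondCountableTopology _

theorem volume_preimage_mulVec {M : Matrix n n ℂ} (hM : M.det ≠ 0) (s : Set (n → ℂ)) :
    volume ((fun g => M *ᵥ g) ⁻¹' s) = ENNReal.ofReal (Complex.normSq M.det)⁻¹ * volume s := by
  have hdet : LinearMap.det ((Matrix.toLin' M).restrictScalars ℝ) = Complex.normSq M.det := by
    rw [LinearMap.det_restrictScalars, Algebra.norm_complex_apply, LinearMap.det_toLin']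
  have h := Measure.addHaar_preimage_linearMap (volume : Measure (n → ℂ))
    (f := (Matrix.toLin' M).restrictScalars ℝ)
    (by rw [hdet]; exact (Complex.normSq_pos.2 hM).ne') s
  rw [hdet, abs_of_nonneg (inv_nonneg.2 (Complex.normSq_nonneg _))] at h
  exact h

theorem volume_preimage_unitary_mulVec (U : Matrix.unitaryGroup n ℂ) (s : Set (n → ℂ)) :
    volume ((fun g => (U : Matrix n n ℂ) *ᵥ g) ⁻¹' s) = volume s := by
  have h1 : Complex.normSq (U : Matrix n n ℂ).det = 1 := by
    have h := (Matrix.det_of_mem_unitary U.2).1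
    rw [Complex.star_def, ← Complex.normSq_eq_conj_mul_self] at h
    exact_mod_cast h
  rw [volume_preimage_mulVec (fun h0 => by simp [h0] at h1), h1]
  simp

theorem star_dotProduct_self_unitary (U : Matrix.unitaryGroup n ℂ) (g : n → ℂ) :
    star ((U : Matrix n n ℂ) *ᵥ g) ⬝ᵥ ((U : Matrix n n ℂ) *ᵥ g) = star g ⬝ᵥ g := by
  have h : (U : Matrix n n ℂ)ᴴ * U = 1 := Unitary.coe_star_mul_self U
  rw [star_mulVec, dotProduct_mulVec, vecMul_vecMul, h, vecMul_one]

/-- The unitary group acts transitively on the unit sphere. -/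
theorem exists_unitary_mulVec_single (x : n) {v : n → ℂ} (hv : (star v ⬝ᵥ v).re = 1) :
    ∃ W : Matrix.unitaryGroup n ℂ, (W : Matrix n n ℂ) *ᵥ Pi.single x 1 = v := by
  have hnorm : ‖(WithLp.toLp 2 v : EuclideanSpace ℂ n)‖ = 1 := by
    rw [EuclideanSpace.norm_eq, ← re_star_dotProduct_self, hv, Real.sqrt_one]
  obtain ⟨b, hb⟩ := Orthonormal.exists_orthonormalBasis_extension_of_card_eq
    (𝕜 := ℂ) (E := EuclideanSpace ℂ n) (ι := n) (by simp)
    (v := fun _ => WithLp.toLp 2 v) (s := {x})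
    ⟨fun _ => hnorm, fun _ _ hij => (hij (Subsingleton.elim _ _)).elim⟩
  refine ⟨⟨_, (EuclideanSpace.basisFun n ℂ).toMatrix_orthonormalBasis_mem_unitary b⟩, ?_⟩
  ext i
  simp [Module.Basis.toMatrix_apply, hb x rfl]

theorem volume_ellipsoid {A : Matrix n n ℂ} (hA : A.PosDef) {r : ℝ} (hr : 0 < r) :
    volume {g : n → ℂ | (star g ⬝ᵥ A *ᵥ g).re ≤ r}
      = ENNReal.ofReal (r ^ Fintype.card n / A.det.re) * volume (euclideanUnitBall n) := by
  open scoped MatrixOrder in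
  obtain ⟨B, hB⟩ := CStarAlgebra.nonneg_iff_eq_star_mul_self.mp hA.posSemidef.nonneg
  have hdet : A.det = Complex.normSq B.det := by
    rw [hB, det_mul, star_eq_conjTranspose, det_conjTranspose, Complex.star_def,
      ← Complex.normSq_eq_conj_mul_self]
  have hB0 : B.det ≠ 0 := fun h => hA.det_pos.ne' (by simp [hdet, h])
  set c : ℝ := (Real.sqrt r)⁻¹ with hc
  have hc0 : 0 < c := inv_pos.2 (Real.sqrt_pos.2 hr)
  have hc2 : c * c = r⁻¹ := by rw [hc, ← mul_inv, Real.mul_self_sqrt hr.le]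
  have hdetc : Complex.normSq ((c : ℂ) • B).det = (r ^ Fintype.card n)⁻¹ * A.det.re := by
    rw [det_smul, map_mul, map_pow, Complex.normSq_ofReal, hc2, inv_pow, hdet, Complex.ofReal_re]
  have hne : ((c : ℂ) • B).det ≠ 0 := by
    rw [det_smul]
    exact mul_ne_zero (pow_ne_zero _ (by exact_mod_cast hc0.ne')) hB0
  have hpre : {g : n → ℂ | (star g ⬝ᵥ A *ᵥ g).re ≤ r}
      = (fun g => ((c : ℂ) • B) *ᵥ g) ⁻¹' euclideanUnitBall n := by
    ext g
    have h : star (((c : ℂ) • B) *ᵥ g) ⬝ᵥ (((c : ℂ) • B) *ᵥ g)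
        = ((c * c : ℝ) : ℂ) * (star g ⬝ᵥ A *ᵥ g) := by
      rw [hB, star_mulVec, dotProduct_mulVec, vecMul_vecMul, ← dotProduct_mulVec,
        conjTranspose_smul, smul_mul_smul_comm, smul_mulVec, dotProduct_smul, smul_eq_mul,
        star_eq_conjTranspose]
      simp
    simp only [euclideanUnitBall, Set.mem_preimage, Set.mem_ofPred_eq, h, Complex.re_ofReal_mul,
      hc2]
    rw [inv_mul_le_iff₀ hr, mul_one]
  rw [hpre, volume_preimage_mulVec hne, hdetc, mul_inv, inv_inv, div_eq_mul_inv]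

theorem posDef_and_det_of_trace_sub_one {A : Matrix n n ℂ} (hA : A.IsHermitian)
    (htr : (A - 1).trace = 0) (hsq : ((A - 1) * (A - 1)).trace.re ≤ 1 / 4) :
    A.PosDef ∧ Real.exp (-(1 / 4)) ≤ A.det.re := by
  have hsum : ∑ i, (hA.eigenvalues i - 1) = 0 := by
    have h := hA.trace_eq_sum_eigenvalues
    rw [trace_sub, sub_eq_zero, h, trace_one] at htr
    have : ∑ i, hA.eigenvalues i = Fintype.card n := by
      apply Complex.ofReal_injective
      simpa using htr
    simp [this]
  have hsum2 : ∑ i, (hA.eigenvalues i - 1) ^ 2 ≤ 1 / 4 := by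
    have h : ((A - 1) * (A - 1)).trace = ((∑ i, (hA.eigenvalues i - 1) ^ 2 : ℝ) : ℂ) := by
      have h1 : (A - 1) * (A - 1) = A * A - A - A + 1 := by noncomm_ring
      rw [h1, trace_add, trace_sub, trace_sub, trace_mul_self_eq_sum_eigenvalues_sq hA,
        hA.trace_eq_sum_eigenvalues, trace_one]
      have h2 (i : n) : (hA.eigenvalues i - 1) ^ 2
          = hA.eigenvalues i ^ 2 - hA.eigenvalues i - hA.eigenvalues i + 1 := by ring
      simp [h2, Finset.sum_add_distrib]
    rw [h] at hsq
    exact_mod_cast hsq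
  have hhalf (i : n) : 1 / 2 ≤ hA.eigenvalues i := by
    have h := Finset.single_le_sum (fun i _ => sq_nonneg (hA.eigenvalues i - 1))
      (Finset.mem_univ i)
    nlinarith
  refine ⟨hA.posDef_iff_eigenvalues_pos.2 fun i => by linarith [hhalf i], ?_⟩
  have hdet : A.det.re = ∏ i, hA.eigenvalues i := by
    rw [hA.det_eq_prod_eigenvalues]
    simp [← Complex.ofReal_prod]
  calc Real.exp (-(1 / 4))
      ≤ Real.exp (∑ i, ((hA.eigenvalues i - 1) - (hA.eigenvalues i - 1) ^ 2)) := by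
        rw [Real.exp_le_exp, Finset.sum_sub_distrib, hsum]
        linarith
    _ = ∏ i, Real.exp ((hA.eigenvalues i - 1) - (hA.eigenvalues i - 1) ^ 2) := Real.exp_sum _ _
    _ ≤ A.det.re := hdet ▸ Finset.prod_le_prod (fun i _ => (Real.exp_pos _).le)
        fun i _ => exp_sub_sub_sq_le (hhalf i)

theorem volume_cone_inter_ball_le {D : Matrix n n ℂ} (hD : D.IsHermitian) (htr : D.trace = 0)
    (hsq : (D * D).trace.re ≤ 1 / 4) {s : ℝ} (hs : s < 1) :
    volume ({g : n → ℂ | s * (star g ⬝ᵥ g).re ≤ (star g ⬝ᵥ D *ᵥ g).re} ∩ euclideanUnitBall n)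
      ≤ ENNReal.ofReal (Real.exp (1 / 4 - Fintype.card n * s)) * volume (euclideanUnitBall n) := by
  obtain ⟨hpos, hdet⟩ := posDef_and_det_of_trace_sub_one (A := 1 - D) (isHermitian_one.sub hD)
    (by simp [htr]) (by simpa using hsq)
  have hs' : 0 < 1 - s := sub_pos.2 hs
  calc _ ≤ volume {g : n → ℂ | (star g ⬝ᵥ (1 - D) *ᵥ g).re ≤ 1 - s} := by
        refine measure_mono fun g hg => ?_
        have h1 : s * (star g ⬝ᵥ g).re ≤ (star g ⬝ᵥ D *ᵥ g).re := hg.1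
        have h2 : (star g ⬝ᵥ g).re ≤ 1 := hg.2
        have h3 : (star g ⬝ᵥ (1 - D) *ᵥ g).re = (star g ⬝ᵥ g).re - (star g ⬝ᵥ D *ᵥ g).re := by
          simp [sub_mulVec, dotProduct_sub]
        rw [Set.mem_ofPred_eq, h3]
        nlinarith
    _ = _ := volume_ellipsoid hpos hs'
    _ ≤ _ := by
        gcongr
        rw [div_le_iff₀ ((Real.exp_pos _).trans_le hdet)]
        calc (1 - s) ^ Fintype.card n ≤ Real.exp (-s) ^ Fintype.card n := by
              gcongr
              linarith [Real.add_one_le_exp (-s)]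
          _ = Real.exp (1 / 4 - Fintype.card n * s) * Real.exp (-(1 / 4)) := by
              rw [← Real.exp_nat_mul, ← Real.exp_add]
              ring_nf
          _ ≤ _ := by gcongr

variable [MeasurableSpace (Matrix.unitaryGroup n ℂ)] [BorelSpace (Matrix.unitaryGroup n ℂ)]

/-- A column of a Haar random unitary lies in a cone with probability the relative volume of the
cone in the unit ball. -/
theorem measure_column_mem_cone (μ : Measure (Matrix.unitaryGroup n ℂ)) [IsProbabilityMeasure μ]
    [μ.IsMulLeftInvariant] {C : Set (n → ℂ)} (hC : IsClosed C)
    (hcone : ∀ r : ℝ, 0 < r → ∀ g ∈ C, (r : ℂ) • g ∈ C) (x : n) :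
    μ {U | (U : Matrix n n ℂ) *ᵥ Pi.single x 1 ∈ C} * volume (euclideanUnitBall n)
      = volume (C ∩ euclideanUnitBall n) := by
  have := secondCountableTopology_unitaryGroup (n := n)
  have : Nonempty n := ⟨x⟩
  have hcont : Continuous fun p : Matrix.unitaryGroup n ℂ × (n → ℂ) =>
      (p.1 : Matrix n n ℂ) *ᵥ p.2 :=
    (continuous_subtype_val.comp continuous_fst).matrix_mulVec continuous_snd
  have hS : MeasurableSet {p : Matrix.unitaryGroup n ℂ × (n → ℂ) |
      p.2 ∈ euclideanUnitBall n ∧ (p.1 : Matrix n n ℂ) *ᵥ p.2 ∈ C} :=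
    ((isClosed_euclideanUnitBall.preimage continuous_snd).inter
      (hC.preimage hcont)).measurableSet
  have hsingle : MeasurableSet {U : Matrix.unitaryGroup n ℂ |
      (U : Matrix n n ℂ) *ᵥ Pi.single x 1 ∈ C} :=
    (hC.preimage (hcont.comp (Continuous.prodMk_left (Pi.single x 1)))).measurableSet
  have h1 : (μ.prod volume) {p : Matrix.unitaryGroup n ℂ × (n → ℂ) |
      p.2 ∈ euclideanUnitBall n ∧ (p.1 : Matrix n n ℂ) *ᵥ p.2 ∈ C}
      = volume (C ∩ euclideanUnitBall n) := by
    rw [Measure.prod_apply hS]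
    have (U : Matrix.unitaryGroup n ℂ) : volume (Prod.mk U ⁻¹' {p | p.2 ∈ euclideanUnitBall n ∧
        (p.1 : Matrix n n ℂ) *ᵥ p.2 ∈ C}) = volume (C ∩ euclideanUnitBall n) := by
      rw [← volume_preimage_unitary_mulVec U (C ∩ euclideanUnitBall n)]
      congr 1
      ext g
      simp [euclideanUnitBall, star_dotProduct_self_unitary, and_comm]
    simp only [this, lintegral_const, measure_univ, mul_one]
  rw [← h1, Measure.prod_apply_symm hS, ← setLIntegral_const,
    ← lintegral_indicator isClosed_euclideanUnitBall.measurableSet]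
  have hne : ∀ᵐ g : n → ℂ, g ≠ 0 := by simp [ae_iff]
  refine lintegral_congr_ae (hne.mono fun g hg => ?_)
  by_cases hgB : g ∈ euclideanUnitBall n
  · have hpos : 0 < (star g ⬝ᵥ g).re :=
      (Complex.pos_iff.1 (dotProduct_star_self_pos_iff.2 hg)).1
    set r := Real.sqrt (star g ⬝ᵥ g).re with hr
    have hr0 : 0 < r := Real.sqrt_pos.2 hpos
    have hrC : (r : ℂ) ≠ 0 := by exact_mod_cast hr0.ne'
    obtain ⟨W, hW⟩ := exists_unitary_mulVec_single x (v := ((r⁻¹ : ℝ) : ℂ) • g) (by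
      rw [re_star_dotProduct_self]
      simp only [Pi.smul_apply, smul_eq_mul, norm_mul, Complex.norm_real, mul_pow,
        ← Finset.mul_sum, ← re_star_dotProduct_self]
      rw [Real.norm_of_nonneg (inv_nonneg.2 hr0.le), inv_pow, hr, Real.sq_sqrt hpos.le,
        inv_mul_cancel₀ hpos.ne'])
    simp only [Set.indicator_of_mem hgB, Set.preimage_ofPred_eq, hgB, true_and]
    rw [← measure_preimage_mul_right_of_isMulLeftInvariant μ hsingle W]
    congr 1
    ext U
    simp only [Set.mem_ofPred_eq, Submonoid.coe_mul, ← mulVec_mulVec, hW, mulVec_smul]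
    refine ⟨fun h => ?_, fun h => hcone _ (inv_pos.2 hr0) _ h⟩
    have := hcone r hr0 _ h
    simpa [smul_smul, hrC] using this
  · simp [hgB]

theorem measure_column_quadraticForm_ge_le (μ : Measure (Matrix.unitaryGroup n ℂ))
    [IsProbabilityMeasure μ] [μ.IsMulLeftInvariant] {D : Matrix n n ℂ} (hD : D.IsHermitian)
    (htr : D.trace = 0) (hsq : (D * D).trace.re ≤ 1 / 4) {s : ℝ} (hs : s < 1) (x : n) :
    μ {U | s ≤ (star (fun j => (U : Matrix n n ℂ) j x)
        ⬝ᵥ D *ᵥ (fun j => (U : Matrix n n ℂ) j x)).re}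
      ≤ ENNReal.ofReal (Real.exp (1 / 4 - Fintype.card n * s)) := by
  set C : Set (n → ℂ) := {g | s * (star g ⬝ᵥ g).re ≤ (star g ⬝ᵥ D *ᵥ g).re}
  have hC : IsClosed C := isClosed_le (by fun_prop) (by fun_prop)
  have hcone (r : ℝ) (_ : 0 < r) (g : n → ℂ) (hg : g ∈ C) : (r : ℂ) • g ∈ C := by
    have h : s * (star g ⬝ᵥ g).re ≤ (star g ⬝ᵥ D *ᵥ g).re := hg
    have h2 := mul_le_mul_of_nonneg_left h (mul_self_nonneg r)
    simp only [C, Set.mem_ofPred_eq, mulVec_smul, star_smul, smul_dotProduct, dotProduct_smul,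
      smul_eq_mul, Complex.star_def, Complex.conj_ofReal, Complex.re_ofReal_mul]
    linarith
  have hset : {U : Matrix.unitaryGroup n ℂ | s ≤ (star (fun j => (U : Matrix n n ℂ) j x)
      ⬝ᵥ D *ᵥ (fun j => (U : Matrix n n ℂ) j x)).re}
      = {U : Matrix.unitaryGroup n ℂ | (U : Matrix n n ℂ) *ᵥ Pi.single x 1 ∈ C} := by
    ext U
    have h := star_dotProduct_self_unitary U (Pi.single x 1)
    simp only [C, Set.mem_ofPred_eq, h]
    simp [col_def]
    rfl
  have h := measure_column_mem_cone μ hC hcone x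
  rw [hset]
  exact (ENNReal.mul_le_mul_iff_left (volume_euclideanUnitBall_ne_zero (n := n))
    volume_euclideanUnitBall_ne_top).1 (h.trans_le (volume_cone_inter_ball_le hD htr hsq hs))

theorem measure_column_quadraticForm_gt_le (μ : Measure (Matrix.unitaryGroup n ℂ))
    [IsProbabilityMeasure μ] [μ.IsMulLeftInvariant] {D : Matrix n n ℂ} (hD : D.IsHermitian)
    (htr : D.trace = 0) {F : ℝ} (hF : 0 < F) (hsq : (D * D).trace.re ≤ F ^ 2)
    {s : ℝ} (hs : s < 1) (x : n) :
    μ {U | 2 * s * F < (star (fun j => (U : Matrix n n ℂ) j x)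
        ⬝ᵥ D *ᵥ (fun j => (U : Matrix n n ℂ) j x)).re}
      ≤ ENNReal.ofReal (Real.exp (1 / 4 - Fintype.card n * s)) := by
  set a : ℝ := (2 * F)⁻¹ with ha
  have ha0 : 0 < a := inv_pos.2 (by positivity)
  have haF : a * (2 * F) = 1 := inv_mul_cancel₀ (by positivity)
  refine le_trans (measure_mono fun U hU => ?_) (measure_column_quadraticForm_ge_le μ
    (D := (a : ℂ) • D) ?_ (by simp [htr]) ?_ hs x)
  · have hU' := mul_le_mul_of_nonneg_left (le_of_lt (Set.mem_ofPred_eq ▸ hU)) ha0.le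
    simp only [Set.mem_ofPred_eq, smul_mulVec, dotProduct_smul, smul_eq_mul,
      Complex.re_ofReal_mul]
    refine le_trans (le_of_eq ?_) hU'
    linear_combination -s * haF
  · exact hD.smul (by simp [IsSelfAdjoint, Complex.conj_ofReal])
  · rw [smul_mul_smul_comm, trace_smul, smul_eq_mul, ← Complex.ofReal_mul, Complex.re_ofReal_mul]
    have h := mul_le_mul_of_nonneg_left hsq (mul_self_nonneg a)
    nlinarith

end RandomBasis

/-- for `d ≥ 200` and density matrices `ρ, σ` with `Δ = ρ − σ`,
with Haar probability at least 0.95 the ℓ∞ distance between the outcome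
distributions of the random basis measurement is at most `(3e·ln d/d)·‖Δ‖_F`.
Haar measure on the unitary group is encoded as a left-invariant Borel
probability measure `μ`; `u_x` is the `x`-th column of `U`. -/
theorem haar_basis_linf_bound
    {d : ℕ} (hd : 200 ≤ d)
    [MeasurableSpace (Matrix.unitaryGroup (Fin d) ℂ)]
    [BorelSpace (Matrix.unitaryGroup (Fin d) ℂ)]
    (μ : Measure (Matrix.unitaryGroup (Fin d) ℂ)) [IsProbabilityMeasure μ]
    (hinv : ∀ V : Matrix.unitaryGroup (Fin d) ℂ, μ.map (fun U => V * U) = μ)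
    (ρ σ : Matrix (Fin d) (Fin d) ℂ)
    (hρ : ρ.PosSemidef) (hρtr : ρ.trace = 1)
    (hσ : σ.PosSemidef) (hσtr : σ.trace = 1) :
    ENNReal.ofReal 0.95 ≤
      μ {U : Matrix.unitaryGroup (Fin d) ℂ |
        ∀ x : Fin d,
          |(star (fun j => (U : Matrix (Fin d) (Fin d) ℂ) j x)
            ⬝ᵥ (ρ - σ).mulVec (fun j => (U : Matrix (Fin d) (Fin d) ℂ) j x)).re|
          ≤ (3 * Real.exp 1 * Real.log d / d)
              * Real.sqrt (((ρ - σ) * (ρ - σ)).trace.re)} := by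
  have hleft : μ.IsMulLeftInvariant := ⟨hinv⟩
  have hd' : (200 : ℝ) ≤ d := by exact_mod_cast hd
  have hd0 : (0 : ℝ) < d := by linarith
  have hHerm : (ρ - σ).IsHermitian := hρ.isHermitian.sub hσ.isHermitian
  have htr : (ρ - σ).trace = 0 := by rw [trace_sub, hρtr, hσtr, sub_self]
  obtain hzero | hne := eq_or_ne (ρ - σ) 0
  · simp only [hzero, zero_mulVec, dotProduct_zero, Complex.zero_re, abs_zero, mul_zero,
      trace_zero, Real.sqrt_zero, le_refl, implies_true, Set.ofPred_true, measure_univ]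
    exact ENNReal.ofReal_le_one.2 (by norm_num)
  generalize ρ - σ = D at *
  have hsqpos : 0 < (D * D).trace.re := by
    have h := (posSemidef_conjTranspose_mul_self D).trace_nonneg
    rw [hHerm.eq] at h
    refine lt_of_le_of_ne (Complex.nonneg_iff.1 h).1 fun h0 => hne ?_
    rw [← trace_conjTranspose_mul_self_eq_zero_iff, hHerm.eq]
    exact Complex.ext h0.symm (Complex.nonneg_iff.1 h).2.symm
  set F := Real.sqrt (D * D).trace.re with hFdef
  have hF : 0 < F := Real.sqrt_pos.2 hsqpos
  have hF2 : (D * D).trace.re ≤ F ^ 2 := (Real.sq_sqrt hsqpos.le).ge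
  set s : ℝ := 3 * Real.exp 1 * Real.log d / (2 * d) with hsdef
  have hs : s < 1 := by
    rw [hsdef, div_lt_one (by positivity)]
    exact exp_one_mul_log_lt hd'
  have hthr : 3 * Real.exp 1 * Real.log d / d * F = 2 * s * F := by
    rw [hsdef]
    field_simp
  rw [hthr]
  set E := Real.exp (1 / 4 - Fintype.card (Fin d) * s) with hE
  have hEd : 2 * d * E ≤ 0.05 := by
    have h : Fintype.card (Fin d) * s = 3 * Real.exp 1 * Real.log d / 2 := by
      rw [hsdef, Fintype.card_fin]
      field_simp
    rw [hE, h]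
    exact two_mul_mul_exp_le hd'
  set q : Fin d → Matrix.unitaryGroup (Fin d) ℂ → ℝ := fun x U =>
    (star (fun j => (U : Matrix (Fin d) (Fin d) ℂ) j x)
      ⬝ᵥ D *ᵥ (fun j => (U : Matrix (Fin d) (Fin d) ℂ) j x)).re with hq
  have hbad (x : Fin d) : μ {U | 2 * s * F < |q x U|} ≤ ENNReal.ofReal (2 * E) := by
    have hp := measure_column_quadraticForm_gt_le μ hHerm htr hF hF2 hs x
    have hm := measure_column_quadraticForm_gt_le μ (D := -D) hHerm.neg (by simp [htr]) hF
      (by simpa using hF2) hs x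
    rw [two_mul E, ENNReal.ofReal_add (Real.exp_pos _).le (Real.exp_pos _).le]
    refine le_trans (measure_mono fun U hU => ?_) ((measure_union_le _ _).trans (add_le_add hp hm))
    rcases lt_abs.1 (Set.mem_ofPred_eq ▸ hU) with h | h
    · exact Or.inl h
    · refine Or.inr ?_
      simpa [neg_mulVec, hq] using h
  have hcompl : μ {U | ∀ x, |q x U| ≤ 2 * s * F}ᶜ ≤ ENNReal.ofReal 0.05 := by
    calc μ {U | ∀ x, |q x U| ≤ 2 * s * F}ᶜ ≤ μ (⋃ x, {U | 2 * s * F < |q x U|}) := by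
          refine measure_mono fun U hU => ?_
          simpa using hU
      _ ≤ ∑ x, μ {U | 2 * s * F < |q x U|} := measure_iUnion_fintype_le _ _
      _ ≤ ∑ _x : Fin d, ENNReal.ofReal (2 * E) := Finset.sum_le_sum fun x _ => hbad x
      _ = ENNReal.ofReal (2 * d * E) := by
          rw [Finset.sum_const, Finset.card_univ, Fintype.card_fin, nsmul_eq_mul,
            ← ENNReal.ofReal_natCast, ← ENNReal.ofReal_mul hd0.le]
          ring_nf
      _ ≤ _ := ENNReal.ofReal_le_ofReal hEd
  have hone : (1 : ENNReal) ≤ μ {U | ∀ x, |q x U| ≤ 2 * s * F} + ENNReal.ofReal 0.05 := by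
    rw [← measure_univ (μ := μ), ← Set.union_compl_self {U | ∀ x, |q x U| ≤ 2 * s * F}]
    exact (measure_union_le _ _).trans (by gcongr)
  refine le_trans (le_of_eq ?_) (tsub_le_iff_right.2 hone)
  rw [← ENNReal.ofReal_one, ← ENNReal.ofReal_sub _ (by norm_num)]
  norm_num
end
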